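/- Let K be a convex body in ℝ^n whose John ellipsoid is B^n ⊆ K, and suppose W(K) ≥ (1−ε)W(Δ_n°) for some ε ∈ (0,1). Then there exists an orthogonal transformation T ∈ O(n) such that δ_H(K, TΔ_n°) ≤ n^{27n}·ε^{1/4}. -/

import Mathlib

open MeasureTheory Metric Set
open scoped RealInnerProductSpace ENNReal

noncomputable section

/-- The standard Gaussian measure `γ_n` on `ℝ^n`. -/
def gaussianM (n : ℕ) : Measure (EuclideanSpace ℝ (Fin n)) :=
  volume.withDensity fun x =>
    ENNReal.ofReal ((2 * Real.pi) ^ (-(n : ℝ) / 2) * Real.exp (-‖x‖ ^ 2 / 2))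

/-- The ℓ-norm of a convex body: `ℓ(K) = ∫ ‖x‖_K dγ_n(x)`, where `‖·‖_K` is the gauge of `K`. -/
def ellNorm (n : ℕ) (K : Set (EuclideanSpace ℝ (Fin n))) : ℝ :=
  ∫ x, gauge K x ∂(gaussianM n)

/-- The support function `h_K`. -/
def suppFn {n : ℕ} (K : Set (EuclideanSpace ℝ (Fin n))) (u : EuclideanSpace ℝ (Fin n)) : ℝ :=
  sSup ((fun y => ⟪u, y⟫) '' K)

/-- The mean width `W(K) = (1/(n κ_n)) ∫_{S^{n-1}} (h_K(u) + h_K(-u)) du`, the integration over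
the unit sphere being with respect to the (n-1)-dimensional Hausdorff measure. -/
def meanWidth (n : ℕ) (K : Set (EuclideanSpace ℝ (Fin n))) : ℝ :=
  (1 / (n * (volume (closedBall (0 : EuclideanSpace ℝ (Fin n)) 1)).toReal)) *
    ∫ u in sphere (0 : EuclideanSpace ℝ (Fin n)) 1,
      (suppFn K u + suppFn K (-u)) ∂(μH[(n : ℝ) - 1])

/-- The polar set `K° = {x : ⟨x,y⟩ ≤ 1 for all y ∈ K}`. -/
def polarSet {n : ℕ} (K : Set (EuclideanSpace ℝ (Fin n))) : Set (EuclideanSpace ℝ (Fin n)) :=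
  {x | ∀ y ∈ K, ⟪x, y⟫ ≤ 1}

/-- `w` lists the vertices of a regular simplex inscribed in the unit ball: `n+1` unit vectors
with pairwise inner products `-1/n`. -/
def IsRegVerts {n : ℕ} (w : Fin (n + 1) → EuclideanSpace ℝ (Fin n)) : Prop :=
  (∀ i, ‖w i‖ = 1) ∧ ∀ i j, i ≠ j → ⟪w i, w j⟫ = -1 / n

/-- An ellipsoid: an image of the closed Euclidean unit ball under an invertible affine map. -/
def IsEllipsoid {n : ℕ} (D : Set (EuclideanSpace ℝ (Fin n))) : Prop :=
  ∃ f : EuclideanSpace ℝ (Fin n) ≃ᵃ[ℝ] EuclideanSpace ℝ (Fin n),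
    D = f '' closedBall 0 1

/-- `D` is the Löwner ellipsoid (minimal volume ellipsoid containing) of `K`. -/
def IsLoewnerEllipsoid {n : ℕ} (D K : Set (EuclideanSpace ℝ (Fin n))) : Prop :=
  IsEllipsoid D ∧ K ⊆ D ∧ ∀ D', IsEllipsoid D' → K ⊆ D' → volume D ≤ volume D'

/-- `D` is the John ellipsoid (maximal volume ellipsoid contained in) of `K`. -/
def IsJohnEllipsoid {n : ℕ} (D K : Set (EuclideanSpace ℝ (Fin n))) : Prop :=
  IsEllipsoid D ∧ D ⊆ K ∧ ∀ D', IsEllipsoid D' → D' ⊆ K → volume D' ≤ volume D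

namespace JMW
open ProbabilityTheory Filter Topology

/-- standard normal density -/
def phi (x : ℝ) : ℝ := gaussianPDFReal 0 1 x

/-- standard normal law -/
abbrev g1 : Measure ℝ := gaussianReal 0 1

/-- standard normal distribution function -/
def Phi (x : ℝ) : ℝ := (gaussianReal 0 1).real (Iic x)

lemma phi_eq (x : ℝ) : phi x = (Real.sqrt (2 * Real.pi))⁻¹ * Real.exp (-x ^ 2 / 2) := by
  simp [phi, gaussianPDFReal]

lemma phi_pos (x : ℝ) : 0 < phi x := gaussianPDFReal_pos 0 1 x one_ne_zero

lemma phi_neg (x : ℝ) : phi (-x) = phi x := by simp [phi_eq]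

lemma phi_cont : Continuous phi := by
  have : phi = fun x => (Real.sqrt (2 * Real.pi))⁻¹ * Real.exp (-x ^ 2 / 2) := funext phi_eq
  rw [this]; fun_prop

lemma phi_int : Integrable phi := integrable_gaussianPDFReal 0 1

lemma Phi_eq_integral (x : ℝ) : Phi x = ∫ t in Iic x, phi t := by
  unfold Phi
  rw [measureReal_def, gaussianReal_apply_eq_integral 0 one_ne_zero, ENNReal.toReal_ofReal]
  · rfl
  · exact integral_nonneg fun t => gaussianPDFReal_nonneg 0 1 t

lemma Phi_sub (x y : ℝ) : Phi y - Phi x = ∫ t in x..y, phi t := by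
  rw [Phi_eq_integral, Phi_eq_integral, intervalIntegral.integral_Iic_sub_Iic]
  · exact phi_int.integrableOn
  · exact phi_int.integrableOn

lemma Phi_hasDerivAt (x : ℝ) : HasDerivAt Phi (phi x) x := by
  have h : Phi = fun y => (∫ t in (0:ℝ)..y, phi t) + Phi 0 := by
    funext y; rw [← Phi_sub]; ring
  rw [h]
  exact (intervalIntegral.integral_hasDerivAt_right (phi_cont.intervalIntegrable _ _)
    (phi_cont.stronglyMeasurableAtFilter _ _) phi_cont.continuousAt).add_const _

lemma Phi_cont : Continuous Phi :=
  continuous_iff_continuousAt.2 fun x => (Phi_hasDerivAt x).continuousAt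

lemma Phi_strictMono : StrictMono Phi :=
  strictMono_of_deriv_pos fun x => by rw [(Phi_hasDerivAt x).deriv]; exact phi_pos x

lemma Phi_atBot : Tendsto Phi atBot (𝓝 0) := by
  have : Phi = cdf (gaussianReal 0 1) := by funext x; rw [cdf_eq_real]; rfl
  rw [this]; exact tendsto_cdf_atBot _

lemma Phi_atTop : Tendsto Phi atTop (𝓝 1) := by
  have : Phi = cdf (gaussianReal 0 1) := by funext x; rw [cdf_eq_real]; rfl
  rw [this]; exact tendsto_cdf_atTop _

lemma Phi_pos (x : ℝ) : 0 < Phi x :=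
  lt_of_le_of_lt measureReal_nonneg (Phi_strictMono (sub_one_lt x))

lemma Phi_lt_one (x : ℝ) : Phi x < 1 :=
  lt_of_lt_of_le (Phi_strictMono (lt_add_one x)) measureReal_le_one

lemma Phi_surj {q : ℝ} (h0 : 0 < q) (h1 : q < 1) : ∃ x, Phi x = q := by
  obtain ⟨a, ha⟩ := (Phi_atBot.eventually_lt_const h0).exists
  obtain ⟨b, hb⟩ := (Phi_atTop.eventually_const_lt h1).exists
  exact mem_range_of_exists_le_of_exists_ge Phi_cont ⟨a, ha.le⟩ ⟨b, hb.le⟩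

lemma Phi_neg (x : ℝ) : Phi (-x) = 1 - Phi x := by
  have h1 : Phi (-x) = (gaussianReal 0 1).real (Ici x) := by
    have h := gaussianReal_map_neg (μ := 0) (v := 1)
    rw [neg_zero] at h
    unfold Phi
    conv_lhs => rw [← h]
    rw [map_measureReal_apply measurable_neg measurableSet_Iic]
    congr 1; ext t; simp
  have : NullSingletonClass (gaussianReal 0 1) := nullSingletonClass_gaussianReal one_ne_zero
  have h2 : (gaussianReal 0 1).real (Iio x) = Phi x := measureReal_congr Iio_ae_eq_Iic
  rw [h1, ← h2, ← compl_Iio, probReal_compl_eq_one_sub measurableSet_Iio]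

lemma Phi_zero : Phi 0 = 1 / 2 := by
  have := Phi_neg 0
  rw [neg_zero] at this; linarith

/-- quantile function -/
def ci (q : ℝ) : ℝ := if h : 0 < q ∧ q < 1 then (Phi_surj h.1 h.2).choose else 0

lemma Phi_ci {q : ℝ} (h0 : 0 < q) (h1 : q < 1) : Phi (ci q) = q := by
  unfold ci; rw [dif_pos ⟨h0, h1⟩]; exact (Phi_surj h0 h1).choose_spec

lemma ci_Phi (x : ℝ) : ci (Phi x) = x :=
  Phi_strictMono.injective (Phi_ci (Phi_pos x) (Phi_lt_one x))

lemma ci_hasDerivAt {q : ℝ} (h0 : 0 < q) (h1 : q < 1) :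
    HasDerivAt ci (phi (ci q))⁻¹ q := by
  have hmem : Ioo (0:ℝ) 1 ∈ 𝓝 q := Ioo_mem_nhds h0 h1
  refine HasDerivAt.of_local_left_inverse ?_ (Phi_hasDerivAt _) (phi_pos _).ne' ?_
  · refine continuousAt_of_monotoneOn_of_image_mem_nhds (s := Ioo (0:ℝ) 1) ?_ hmem ?_
    · intro a ha b hb hab
      rw [← Phi_strictMono.le_iff_le, Phi_ci ha.1 ha.2, Phi_ci hb.1 hb.2]; exact hab
    · have : ci '' Ioo (0:ℝ) 1 = univ := by
        refine eq_univ_of_forall fun x => ⟨Phi x, ⟨Phi_pos x, Phi_lt_one x⟩, ci_Phi x⟩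
      rw [this]; exact univ_mem
  · filter_upwards [hmem] with y hy using Phi_ci hy.1 hy.2

/-- The transport map from the Gaussian to the Gaussian restricted to `(-∞, l]`. -/
def U (l z : ℝ) : ℝ := ci (Phi l * Phi z)

lemma PhiPhi_mem (l z : ℝ) : 0 < Phi l * Phi z ∧ Phi l * Phi z < 1 :=
  ⟨mul_pos (Phi_pos _) (Phi_pos _), by
    nlinarith [Phi_pos l, Phi_pos z, Phi_lt_one l, Phi_lt_one z]⟩

lemma Phi_U (l z : ℝ) : Phi (U l z) = Phi l * Phi z :=
  Phi_ci (PhiPhi_mem l z).1 (PhiPhi_mem l z).2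

lemma U_lt (l z : ℝ) : U l z < l := by
  rw [← Phi_strictMono.lt_iff_lt, Phi_U]
  nlinarith [Phi_pos l, Phi_lt_one z]

lemma U_lt_self (l z : ℝ) : U l z < z := by
  rw [← Phi_strictMono.lt_iff_lt, Phi_U]
  nlinarith [Phi_pos z, Phi_lt_one l]

lemma U_strictMono (l : ℝ) : StrictMono (U l) := by
  intro a b hab
  rw [← Phi_strictMono.lt_iff_lt, Phi_U, Phi_U]
  exact mul_lt_mul_of_pos_left (Phi_strictMono hab) (Phi_pos l)

/-- derivative of `U` -/
def U' (l z : ℝ) : ℝ := Phi l * phi z / phi (U l z)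

lemma U'_pos (l z : ℝ) : 0 < U' l z := div_pos (mul_pos (Phi_pos _) (phi_pos _)) (phi_pos _)

lemma U_hasDerivAt (l z : ℝ) : HasDerivAt (U l) (U' l z) z := by
  have h := (ci_hasDerivAt (PhiPhi_mem l z).1 (PhiPhi_mem l z).2).comp z
    ((Phi_hasDerivAt z).const_mul (Phi l))
  refine h.congr_deriv ?_
  unfold U' U; ring

lemma U_cont (l : ℝ) : Continuous (U l) :=
  continuous_iff_continuousAt.2 fun x => (U_hasDerivAt l x).continuousAt

lemma log_U' (l z : ℝ) : Real.log (U' l z) = Real.log (Phi l) - z ^ 2 / 2 + (U l z) ^ 2 / 2 := by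
  have hs : Real.sqrt (2 * Real.pi) ≠ 0 := by positivity
  have : U' l z = Phi l * Real.exp (- z ^ 2 / 2 + (U l z) ^ 2 / 2) := by
    unfold U'; rw [phi_eq, phi_eq, Real.exp_add]
    rw [show -(U l z)^2/2 = -((U l z)^2/2) by ring, Real.exp_neg ((U l z)^2/2)]
    field_simp
  rw [this, Real.log_mul (Phi_pos l).ne' (Real.exp_pos _).ne', Real.log_exp]; ring

/-- shift estimate: `Φ(x - c) ≤ exp(cx-c²/2) Φ(x)` for `0 ≤ c`. -/
lemma Phi_shift {x c : ℝ} (hc : 0 ≤ c) :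
    Phi (x - c) ≤ Real.exp (c * x - c ^ 2 / 2) * Phi x := by
  have h1 : Phi (x - c) = ∫ t in Iic x, phi (t - c) := by
    rw [Phi_eq_integral]
    have h := (measurePreserving_sub_right (volume : Measure ℝ) c).setIntegral_preimage_emb
      (measurableEmbedding_subRight c) phi (Iic (x - c))
    rw [← h]; congr 2; ext t; simp
  rw [h1, Phi_eq_integral, ← integral_const_mul]
  refine setIntegral_mono_on ?_ ?_ measurableSet_Iic ?_
  · exact (phi_int.comp_sub_right c).integrableOn
  · exact (phi_int.const_mul _).integrableOn
  · intro t ht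
    have ht : t ≤ x := ht
    rw [phi_eq, phi_eq, mul_left_comm, ← Real.exp_add]
    refine mul_le_mul_of_nonneg_left (Real.exp_le_exp.2 ?_) (by positivity)
    nlinarith

lemma U_lower (l : ℝ) : ∃ c : ℝ, 0 ≤ c ∧ ∀ z, |U l z| ≤ |z| + c := by
  obtain ⟨c, hc0, hc⟩ : ∃ c : ℝ, 0 ≤ c ∧ Real.exp (-c ^ 2 / 2) ≤ Phi l := by
    have h : Tendsto (fun c : ℝ => Real.exp (-c ^ 2 / 2)) atTop (𝓝 0) := by
      refine Real.tendsto_exp_atBot.comp ?_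
      have : (fun c : ℝ => -c ^ 2 / 2) = fun c => - (c ^ 2 / 2) := by funext c; ring
      rw [this]
      exact tendsto_neg_atTop_atBot.comp ((tendsto_pow_atTop two_ne_zero).atTop_div_const two_pos)
    obtain ⟨c, h1, h2⟩ := ((h.eventually_lt_const (Phi_pos l)).and (eventually_ge_atTop 0)).exists
    exact ⟨c, h2, h1.le⟩
  have key : ∀ z ≤ 0, z - c ≤ U l z := by
    intro z hz
    rw [← Phi_strictMono.le_iff_le, Phi_U]
    refine (Phi_shift hc0).trans (mul_le_mul_of_nonneg_right ?_ (Phi_pos z).le)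
    refine (Real.exp_le_exp.2 ?_).trans hc
    nlinarith
  refine ⟨c + |l|, by positivity, fun z => abs_le.2 ⟨?_, ?_⟩⟩
  · rcases le_total z 0 with hz | hz
    · have := key z hz; have := neg_abs_le z; have := abs_nonneg l; linarith
    · have := key 0 le_rfl; have := (U_strictMono l).monotone hz
      have := abs_nonneg l; have := abs_nonneg z; linarith
  · have := U_lt l z; have := le_abs_self l; have := abs_nonneg z; linarith

lemma int_pow (k : ℕ) : Integrable (fun z : ℝ => z ^ k) (gaussianReal 0 1) := by
  have h := (memLp_id_gaussianReal (μ := 0) (v := 1) (k : NNReal))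
  by_cases hk : k = 0
  · subst hk; simp
  have h2 := h.integrable_norm_pow hk
  refine h2.mono' (by fun_prop) (ae_of_all _ fun z => ?_)
  simp

lemma int_abs_pow (k : ℕ) : Integrable (fun z : ℝ => |z| ^ k) (gaussianReal 0 1) := by
  simpa using (int_pow k).norm

lemma m1 : ∫ z, z ∂(gaussianReal 0 1) = 0 := integral_id_gaussianReal

lemma m2 : ∫ z, z ^ 2 ∂(gaussianReal 0 1) = 1 := by
  have h := variance_fun_id_gaussianReal (μ := 0) (v := 1)
  rw [variance_of_integral_eq_zero (by fun_prop) m1] at h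
  simpa using h

lemma m4 : ∫ z, (z ^ 2 - 1) ^ 2 ∂(gaussianReal 0 1) ≤ 80 := by
  have hi1 := integrable_exp_mul_gaussianReal (μ := 0) (v := 1) 1
  have hi2 := integrable_exp_mul_gaussianReal (μ := 0) (v := 1) (-1)
  have e1 : ∫ z, Real.exp (1 * z) ∂(gaussianReal 0 1) = Real.exp (1 / 2) := by
    have := congrFun (mgf_id_gaussianReal (μ := 0) (v := 1)) 1
    simpa [mgf] using this
  have e2 : ∫ z, Real.exp (-1 * z) ∂(gaussianReal 0 1) = Real.exp (1 / 2) := by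
    have := congrFun (mgf_id_gaussianReal (μ := 0) (v := 1)) (-1)
    simpa [mgf] using this
  have hb : ∀ x : ℝ, (x ^ 2 - 1) ^ 2 ≤ 24 * (Real.exp (1 * x) + Real.exp (-1 * x)) + (1 - 2 * x ^ 2) := by
    intro x
    have : x ^ 4 ≤ 24 * (Real.exp (1 * x) + Real.exp (-1 * x)) := by
      rcases le_total 0 x with h | h
      · have h4 := Real.pow_div_factorial_le_exp x h 4
        have : ((4 : ℕ).factorial : ℝ) = 24 := by norm_num [Nat.factorial]
        rw [this] at h4
        have := Real.exp_pos (-1 * x)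
        rw [one_mul]; linarith
      · have h4 := Real.pow_div_factorial_le_exp (-x) (by linarith) 4
        have : ((4 : ℕ).factorial : ℝ) = 24 := by norm_num [Nat.factorial]
        rw [this] at h4
        have := Real.exp_pos (1 * x)
        rw [show -1 * x = -x by ring]
        nlinarith
    nlinarith
  have hi3 : Integrable (fun x : ℝ => (1 - 2 * x ^ 2)) (gaussianReal 0 1) :=
    (integrable_const _).sub ((int_pow 2).const_mul 2)
  have hi4 : Integrable (fun x : ℝ => 24 * (Real.exp (1 * x) + Real.exp (-1 * x))) (gaussianReal 0 1) :=
    (hi1.add hi2).const_mul 24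
  have hi5 : Integrable (fun x : ℝ => (x ^ 2 - 1) ^ 2) (gaussianReal 0 1) := by
    have : (fun x : ℝ => (x ^ 2 - 1) ^ 2) = fun x => x ^ 4 - 2 * x ^ 2 + 1 := by funext x; ring
    rw [this]
    exact ((int_pow 4).sub ((int_pow 2).const_mul 2)).add (integrable_const _)
  have h := integral_mono hi5 (hi4.add hi3) hb
  simp only [Pi.add_apply] at h
  rw [integral_add hi4 hi3, integral_const_mul, integral_add hi1 hi2, e1, e2,
    integral_sub (integrable_const _) ((int_pow 2).const_mul 2), integral_const_mul, m2] at h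
  simp at h
  have he : Real.exp (1 / 2) < 1.65 := by
    have h1 : Real.exp (1 / 2) ^ 2 = Real.exp 1 := by rw [← Real.exp_nat_mul]; norm_num
    have := Real.exp_one_lt_d9
    have := Real.exp_pos (1/2)
    nlinarith
  norm_num at he h ⊢
  linarith

lemma sqrt_two_pi_lt : Real.sqrt (2 * Real.pi) < 3 := by
  rw [Real.sqrt_lt' (by norm_num)]; have := Real.pi_lt_d2; linarith

lemma phi_lower (x : ℝ) (k : ℕ) (hk : x ^ 2 / 2 ≤ k) : 1 / (3 * 2.7182818286 ^ k) ≤ phi x := by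
  rw [phi_eq, show -x ^ 2 / 2 = -(x ^ 2 / 2) by ring, Real.exp_neg, ← mul_inv, one_div]
  have h1 : Real.exp (x ^ 2 / 2) ≤ 2.7182818286 ^ k := by
    refine (Real.exp_le_exp.2 hk).trans ?_
    have : Real.exp (k : ℝ) = Real.exp 1 ^ k := by rw [← Real.exp_nat_mul]; simp
    rw [this]
    exact pow_le_pow_left₀ (Real.exp_pos _).le Real.exp_one_lt_d9.le k
  exact inv_anti₀ (by positivity) (mul_le_mul sqrt_two_pi_lt.le h1 (Real.exp_pos _).le (by norm_num))

lemma phi_anti {x y : ℝ} (hx : |x| ≤ |y|) : phi y ≤ phi x := by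
  rw [phi_eq, phi_eq]
  refine mul_le_mul_of_nonneg_left (Real.exp_le_exp.2 ?_) (by positivity)
  have := sq_le_sq.2 hx; linarith

lemma Phi_diff_lower {a b c : ℝ} (hab : a ≤ b) (h : ∀ t ∈ Icc a b, |t| ≤ |c|) :
    phi c * (b - a) ≤ Phi b - Phi a := by
  rw [Phi_sub]
  have : ∫ _t in a..b, phi c ≤ ∫ t in a..b, phi t :=
    intervalIntegral.integral_mono_on hab (continuous_const.intervalIntegrable _ _)
    (phi_cont.intervalIntegrable _ _) (fun t ht => phi_anti (h t ht))
  rw [intervalIntegral.integral_const, smul_eq_mul] at this; linarith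

lemma Phi_neg_one_lower : 1 / 32 ≤ Phi (-1) := by
  have h := Phi_diff_lower (a := -2) (b := -1) (c := 2) (by norm_num) (by
    intro t ht; rw [abs_le]; norm_num; constructor <;> linarith [ht.1, ht.2])
  have h2 := phi_lower 2 2 (by norm_num)
  have h3 := Phi_pos (-2)
  norm_num at h h2 ⊢
  linarith

lemma Phi_neg_two : Phi (-2) ≤ Phi (-1) / 2 := by
  have h := Phi_shift (x := -1) (c := 1) (by norm_num)
  have he : Real.exp (1 * -1 - 1 ^ 2 / 2) ≤ 1 / 2 := by
    have h1 : Real.exp (1 * -1 - 1 ^ 2 / 2) ≤ Real.exp (-1) := Real.exp_le_exp.2 (by norm_num)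
    have h2 : Real.exp (-1) ≤ 1 / 2 := by
      rw [Real.exp_neg, one_div]
      exact inv_anti₀ (by norm_num) (by have := Real.exp_one_gt_d9; linarith)
    linarith
  norm_num at h he ⊢
  nlinarith [Phi_pos (-1)]

lemma U_zero_lower {l : ℝ} (hl : -1 ≤ l) : -2 ≤ U l 0 := by
  rw [← Phi_strictMono.le_iff_le, Phi_U, Phi_zero]
  have := Phi_strictMono.monotone hl
  have := Phi_neg_two
  linarith

/-- even part of `U` -/
def S (l z : ℝ) : ℝ := U l z + U l (-z)

lemma S_hasDerivAt (l z : ℝ) : HasDerivAt (S l) (U' l z - U' l (-z)) z := by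
  have h := (U_hasDerivAt l z).add ((U_hasDerivAt l (-z)).comp z (hasDerivAt_neg z))
  refine h.congr_deriv ?_
  ring

lemma S_anti {l : ℝ} (hl : l ≤ 0) : AntitoneOn (S l) (Ici 0) := by
  refine antitoneOn_of_deriv_nonpos (convex_Ici 0)
    (fun z _ => (S_hasDerivAt l z).continuousAt.continuousWithinAt)
    (fun z _ => (S_hasDerivAt l z).differentiableAt.differentiableWithinAt) ?_
  intro z hz
  rw [interior_Ici] at hz
  have hz : 0 < z := hz
  rw [(S_hasDerivAt l z).deriv]
  unfold U'
  rw [phi_neg, sub_nonpos]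
  refine div_le_div_of_nonneg_left (mul_pos (Phi_pos _) (phi_pos _)).le (phi_pos _) (phi_anti ?_)
  have h1 := U_lt l z
  have h2 := U_lt l (-z)
  have h3 := (U_strictMono l).monotone (show -z ≤ z by linarith)
  rw [abs_of_neg (by linarith), abs_of_neg (by linarith)]; linarith

lemma S_gap {l : ℝ} (hl : l ≤ 0) (hl1 : -1 ≤ l) : S l 4 - S l 1 ≤ -(1 / 64) := by
  obtain ⟨x, hx, he⟩ := exists_hasDerivAt_eq_slope (S l) (fun z => U' l z - U' l (-z))
    (show (3:ℝ) < 4 by norm_num)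
    (fun z _ => (S_hasDerivAt l z).continuousAt.continuousWithinAt)
    (fun z _ => S_hasDerivAt l z)
  have h31 : S l 3 ≤ S l 1 := S_anti hl (by norm_num) (by norm_num) (by norm_num)
  have hp : 1 / 32 ≤ Phi l := Phi_neg_one_lower.trans (Phi_strictMono.monotone hl1)
  have hA : Phi l ≤ U' l (-x) := by
    unfold U'
    rw [le_div_iff₀ (phi_pos _)]
    refine mul_le_mul_of_nonneg_left (phi_anti ?_) (Phi_pos l).le
    have h1 := U_lt_self l (-x)
    rw [abs_neg, abs_of_pos (by linarith [hx.1]), abs_of_neg (by linarith [hx.1])]; linarith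
  have hB : U' l x ≤ Phi l / 2 := by
    unfold U'
    rw [div_le_iff₀ (phi_pos _)]
    have h1 : phi 2 ≤ phi (U l x) := by
      apply phi_anti
      have h1 := U_lt l x
      have h2 := (U_strictMono l).monotone (show 0 ≤ x by linarith [hx.1])
      have h3 := U_zero_lower hl1
      rw [abs_of_neg (by linarith), abs_of_pos (by norm_num)]; linarith
    have h2 : phi x ≤ phi 3 := by
      apply phi_anti
      rw [abs_of_pos (by norm_num), abs_of_pos (by linarith [hx.1])]; linarith [hx.1]
    have h3 : phi 3 ≤ phi 2 / 2 := by
      rw [phi_eq, phi_eq, mul_div_assoc]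
      refine mul_le_mul_of_nonneg_left ?_ (by positivity)
      have : Real.exp (-3 ^ 2 / 2) = Real.exp (-2 ^ 2 / 2) * Real.exp (-(5 / 2)) := by
        rw [← Real.exp_add]; norm_num
      rw [this]
      have : Real.exp (-(5 / 2)) ≤ 1 / 2 := by
        rw [Real.exp_neg, one_div]
        refine inv_anti₀ (by norm_num) ?_
        have := Real.add_one_le_exp (5 / 2 : ℝ)
        linarith
      have := Real.exp_pos (-2 ^ 2 / 2)
      nlinarith
    have := Phi_pos l
    nlinarith
  norm_num at he
  linarith

lemma U_int (l : ℝ) {f : ℝ → ℝ} (k : ℕ) (hf : Continuous f) (hb : ∀ z, |f z| ≤ 1 + |z| ^ k) :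
    Integrable (fun z => U l z * f z) (gaussianReal 0 1) := by
  obtain ⟨c, hc0, hc⟩ := U_lower l
  have hU := U_cont l
  have hi : Integrable (fun z : ℝ => |z| ^ (k + 1) + |z| ^ 1 + c * (1 + |z| ^ k)) (gaussianReal 0 1) :=
    ((int_abs_pow _).add (int_abs_pow _)).add (((integrable_const _).add (int_abs_pow _)).const_mul c)
  refine hi.mono' (by fun_prop) (ae_of_all _ fun z => ?_)
  rw [Real.norm_eq_abs, abs_mul]
  have := mul_le_mul (hc z) (hb z) (abs_nonneg _) (by positivity)
  refine this.trans (le_of_eq ?_)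
  ring

/-- second Hermite coefficient of `U`. -/
def aH (l : ℝ) : ℝ := ∫ z, U l z * (z ^ 2 - 1) ∂(gaussianReal 0 1)

lemma U_int2 (l : ℝ) : Integrable (fun z => U l z * (z ^ 2 - 1)) (gaussianReal 0 1) := by
  refine U_int l 2 (by fun_prop) fun z => ?_
  rw [sq_abs]
  exact (abs_sub _ _).trans (by rw [abs_of_nonneg (sq_nonneg z)]; norm_num [add_comm])

lemma aH_upper {l : ℝ} (hl : l ≤ 0) (hl1 : -1 ≤ l) : aH l ≤ -(1 / 2 ^ 24) := by
  have hneg : ∫ z, U l (-z) * (z ^ 2 - 1) ∂(gaussianReal 0 1) = aH l := by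
    have h := gaussianReal_map_neg (μ := 0) (v := 1)
    rw [neg_zero] at h
    unfold aH
    conv_rhs => rw [← h]
    rw [integral_map (by fun_prop)]
    · simp
    · have := U_cont l; exact Continuous.aestronglyMeasurable (by fun_prop)
  have hint2 : Integrable (fun z => U l (-z) * (z ^ 2 - 1)) (gaussianReal 0 1) := by
    have h := gaussianReal_map_neg (μ := 0) (v := 1)
    rw [neg_zero] at h
    have h2 := U_int2 l
    rw [← h, integrable_map_measure _ (by fun_prop)] at h2
    · refine h2.congr (ae_of_all _ fun z => ?_); simp
    · have := U_cont l; exact Continuous.aestronglyMeasurable (by fun_prop)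
  have hint3 : Integrable (fun z : ℝ => S l 1 * (z ^ 2 - 1)) (gaussianReal 0 1) :=
    ((int_pow 2).sub (integrable_const _)).const_mul _
  have hI : Integrable (fun z => (S l z - S l 1) * (z ^ 2 - 1)) (gaussianReal 0 1) := by
    refine (((U_int2 l).add hint2).sub hint3).congr (ae_of_all _ fun z => ?_)
    simp only [Pi.add_apply, Pi.sub_apply, S]; ring
  have h1 : 2 * aH l = ∫ z, (S l z - S l 1) * (z ^ 2 - 1) ∂(gaussianReal 0 1) := by
    have : ∀ z, (S l z - S l 1) * (z ^ 2 - 1)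
      = U l z * (z ^ 2 - 1) + U l (-z) * (z ^ 2 - 1) - S l 1 * (z ^ 2 - 1) := by
      intro z; unfold S; ring
    have hadd : Integrable (fun z => U l z * (z ^ 2 - 1) + U l (-z) * (z ^ 2 - 1)) (gaussianReal 0 1) :=
      (U_int2 l).add hint2
    simp_rw [this]
    rw [integral_sub hadd hint3, integral_add (U_int2 l) hint2, hneg,
      integral_const_mul, integral_sub (int_pow 2) (integrable_const _), m2]
    simp [aH]; ring
  have hSe : ∀ z, S l |z| = S l z := by
    intro z
    rcases abs_cases z with ⟨h, _⟩ | ⟨h, _⟩ <;> rw [h]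
    unfold S; rw [neg_neg, add_comm]
  have hpt : ∀ z, (S l z - S l 1) * (z ^ 2 - 1) ≤ (Icc (4:ℝ) 5).indicator (fun _ => -(15 / 64 : ℝ)) z := by
    intro z
    by_cases hz : z ∈ Icc (4:ℝ) 5
    · rw [indicator_of_mem hz]
      have h4 : S l z ≤ S l 4 := S_anti hl (by norm_num) (by simp; linarith [hz.1]) hz.1
      have h5 := S_gap hl hl1
      have h6 : 15 ≤ z ^ 2 - 1 := by nlinarith [hz.1]
      have h7 : S l z - S l 1 ≤ -1 / 64 := by linarith
      nlinarith
    · rw [indicator_of_notMem hz, ← hSe z]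
      rcases le_total |z| 1 with h | h
      · have : S l 1 ≤ S l |z| := S_anti hl (by simp) (by norm_num) h
        have h3 : z ^ 2 ≤ 1 := by rw [← sq_abs]; nlinarith [abs_nonneg z]
        nlinarith
      · have : S l |z| ≤ S l 1 := S_anti hl (by norm_num) (by simp) h
        have h3 : 1 ≤ z ^ 2 := by rw [← sq_abs]; nlinarith [abs_nonneg z]
        nlinarith
  have h2 := integral_mono hI ((integrable_const _).indicator measurableSet_Icc) hpt
  rw [← h1, integral_indicator measurableSet_Icc, setIntegral_const, smul_eq_mul] at h2
  have h3 : phi 5 ≤ (gaussianReal 0 1).real (Icc 4 5) := by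
    have h := Phi_diff_lower (a := 4) (b := 5) (c := 5) (by norm_num) (by
      intro t ht; rw [abs_le]; norm_num; constructor <;> linarith [ht.1, ht.2])
    have h6 : Phi 5 ≤ Phi 4 + (gaussianReal 0 1).real (Icc 4 5) := by
      unfold Phi
      refine (measureReal_mono (s₂ := Iic 4 ∪ Icc 4 5) ?_).trans (measureReal_union_le _ _)
      intro t ht
      rcases le_total t 4 with h | h
      · exact Or.inl h
      · exact Or.inr ⟨h, ht⟩
    linarith
  have h4 := phi_lower 5 13 (by norm_num)
  norm_num at h4 h2 h3 ⊢
  linarith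

end JMW

namespace JMW

open ProbabilityTheory Filter Topology

section gauss

set_option linter.unusedSectionVars false

variable {F : Type*} [NormedAddCommGroup F] [InnerProductSpace ℝ F] [FiniteDimensional ℝ F]
  [MeasurableSpace F] [BorelSpace F]

lemma gMarg (v : F) (hv : ‖v‖ = 1) :
    (stdGaussian F).map (fun y => ⟪v, y⟫) = gaussianReal 0 1 := by
  have h : HasGaussianLaw (fun y : F => innerSL ℝ v y) (stdGaussian F) :=
    (IsGaussian.hasGaussianLaw_id (μ := stdGaussian F)).map_fun (innerSL ℝ v)
  have h2 := h.map_eq_gaussianReal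
  have h3 := variance_dual_stdGaussian (E := F) (innerSL ℝ v)
  have h4 := integral_strongDual_stdGaussian (E := F) (innerSL ℝ v)
  rw [h3, h4] at h2
  simpa [hv] using h2

lemma g_memLp (v : F) (p : ℝ≥0∞) (hp : p ≠ ∞) : MemLp (fun y => ⟪v, y⟫) p (stdGaussian F) :=
  IsGaussian.memLp_dual _ (innerSL ℝ v) p hp

lemma g_mean (v : F) : ∫ y, ⟪v, y⟫ ∂(stdGaussian F) = 0 :=
  integral_strongDual_stdGaussian (E := F) (innerSL ℝ v)

lemma g_sq (v : F) : ∫ y, ⟪v, y⟫ ^ 2 ∂(stdGaussian F) = ‖v‖ ^ 2 := by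
  have h3 := variance_dual_stdGaussian (E := F) (innerSL ℝ v)
  rw [variance_of_integral_eq_zero (by fun_prop)
    (integral_strongDual_stdGaussian (E := F) (innerSL ℝ v))] at h3
  simpa using h3

lemma g_sq_int (v : F) : Integrable (fun y => ⟪v, y⟫ ^ 2) (stdGaussian F) :=
  (g_memLp v 2 (by simp)).integrable_sq

lemma g_int (v : F) : Integrable (fun y => ⟪v, y⟫) (stdGaussian F) :=
  (g_memLp v 1 (by simp)).integrable (le_refl _)

lemma g_norm_int : Integrable (fun y : F => ‖y‖) (stdGaussian F) :=
  (IsGaussian.integrable_id (μ := stdGaussian F)).norm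

lemma g_indep (v r : F) (h : ⟪v, r⟫ = 0) :
    IndepFun (fun y => ⟪v, y⟫) (fun y => ⟪r, y⟫) (stdGaussian F) := by
  refine HasGaussianLaw.indepFun_of_covariance_eq_zero ?_ ?_
  · exact (IsGaussian.hasGaussianLaw_id (μ := stdGaussian F)).map_fun
      ((innerSL ℝ v).prod (innerSL ℝ r))
  · rw [← covarianceBilin_apply_eq_cov IsGaussian.memLp_two_id, covarianceBilin_stdGaussian]
    exact h

/-- transfer of an integral to one dimension -/
lemma g_integral1 (v : F) (hv : ‖v‖ = 1) (f : ℝ → ℝ) (hf : AEStronglyMeasurable f (gaussianReal 0 1)) :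
    ∫ y, f ⟪v, y⟫ ∂(stdGaussian F) = ∫ z, f z ∂(gaussianReal 0 1) := by
  rw [← gMarg v hv] at hf ⊢
  rw [integral_map (by fun_prop) hf]

lemma g_integrable1 (v : F) (hv : ‖v‖ = 1) (f : ℝ → ℝ) (hf : Integrable f (gaussianReal 0 1)) :
    Integrable (fun y => f ⟪v, y⟫) (stdGaussian F) := by
  rw [← gMarg v hv] at hf
  exact (integrable_map_measure hf.1 (by fun_prop)).1 hf

lemma U_intk (l : ℝ) (k : ℕ) : Integrable (fun z => U l z * z ^ k) (gaussianReal 0 1) := by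
  obtain ⟨c, hc, h⟩ := U_lower l
  refine Integrable.mono' ((int_abs_pow (k + 1)).add ((int_abs_pow k).const_mul c)) ?_ ?_
  · have := U_cont l; exact Continuous.aestronglyMeasurable (by fun_prop)
  · refine ae_of_all _ fun z => ?_
    simp only [Real.norm_eq_abs, abs_mul, abs_pow, Pi.add_apply]
    nlinarith [mul_le_mul_of_nonneg_right (h z) (pow_nonneg (abs_nonneg z) k), pow_succ |z| k]

lemma U_intsq (l : ℝ) : Integrable (fun z => U l z ^ 2) (gaussianReal 0 1) := by
  obtain ⟨c, hc, h⟩ := U_lower l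
  refine Integrable.mono' (((int_abs_pow 2).const_mul 2).add (integrable_const (2 * c ^ 2))) ?_ ?_
  · have := U_cont l; exact Continuous.aestronglyMeasurable (by fun_prop)
  · refine ae_of_all _ fun z => ?_
    simp only [Real.norm_eq_abs, abs_pow, Pi.add_apply]
    have := h z
    nlinarith [abs_nonneg (U l z), sq_nonneg (|z| - c), abs_nonneg z]

lemma g_U2 (l : ℝ) (u v : F) (hu : ‖u‖ = 1) (hv : ‖v‖ = 1) :
    Integrable (fun y => U l ⟪v, y⟫ * (⟪u, y⟫ ^ 2 - 1)) (stdGaussian F) ∧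
    ∫ y, U l ⟪v, y⟫ * (⟪u, y⟫ ^ 2 - 1) ∂(stdGaussian F) = aH l * ⟪v, u⟫ ^ 2 := by
  set c := ⟪v, u⟫ with hc
  set r := u - c • v with hr
  have hvv : ⟪v, v⟫ = 1 := by rw [real_inner_self_eq_norm_sq, hv]; norm_num
  have huu : ⟪u, u⟫ = 1 := by rw [real_inner_self_eq_norm_sq, hu]; norm_num
  have hvr : ⟪v, r⟫ = 0 := by
    rw [hr, inner_sub_right, inner_smul_right, hvv, ← hc]; ring
  have hrr : ‖r‖ ^ 2 = 1 - c ^ 2 := by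
    rw [← real_inner_self_eq_norm_sq, hr, inner_sub_left, ← hr, inner_smul_left, hvr, hr,
      inner_sub_right, inner_smul_right, huu, real_inner_comm, ← hc]; simp; ring
  have hsplit : ∀ y, ⟪u, y⟫ = c * ⟪v, y⟫ + ⟪r, y⟫ := by
    intro y; rw [hr, inner_sub_left, inner_smul_left]; simp
  have hind := g_indep v r hvr
  have hmU : Measurable (U l) := (U_cont l).measurable
  have i0 := g_integrable1 v hv _ (U_intk l 0)
  have i1 := g_integrable1 v hv _ (U_intk l 1)
  have i2 := g_integrable1 v hv _ (U_intk l 2)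
  have ind1 : IndepFun (fun y => U l ⟪v, y⟫ * ⟪v, y⟫ ^ 1) (fun y => ⟪r, y⟫) (stdGaussian F) :=
    hind.comp (φ := fun x => U l x * x ^ 1) (ψ := id) (by fun_prop) measurable_id
  have ind2 : IndepFun (fun y => U l ⟪v, y⟫ * ⟪v, y⟫ ^ 0) (fun y => ⟪r, y⟫ ^ 2) (stdGaussian F) :=
    hind.comp (φ := fun x => U l x * x ^ 0) (ψ := fun x => x ^ 2) (by fun_prop) (by fun_prop)
  have j1 := ind1.integrable_mul i1 (g_int r)
  have j2 : Integrable (fun y => U l ⟪v, y⟫ * ⟪v, y⟫ ^ 0 * ⟪r, y⟫ ^ 2) (stdGaussian F) :=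
    ind2.integrable_mul i0 (g_sq_int r)
  have e1 := ind1.integral_fun_mul_eq_mul_integral i1.1 (g_int r).1
  have e2 := ind2.integral_fun_mul_eq_mul_integral i0.1 (g_sq_int r).1
  rw [g_mean, mul_zero] at e1
  rw [g_sq, hrr] at e2
  have hfun : (fun y => U l ⟪v, y⟫ * (⟪u, y⟫ ^ 2 - 1)) = fun y =>
      c ^ 2 * (U l ⟪v, y⟫ * ⟪v, y⟫ ^ 2) + 2 * c * (U l ⟪v, y⟫ * ⟪v, y⟫ ^ 1 * ⟪r, y⟫)
       + (U l ⟪v, y⟫ * ⟪v, y⟫ ^ 0 * ⟪r, y⟫ ^ 2) - U l ⟪v, y⟫ * ⟪v, y⟫ ^ 0 := by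
    funext y; rw [hsplit]; ring
  have k1 : Integrable (fun y => c ^ 2 * (U l ⟪v, y⟫ * ⟪v, y⟫ ^ 2)) (stdGaussian F) := i2.const_mul _
  have k2 : Integrable (fun y => 2 * c * (U l ⟪v, y⟫ * ⟪v, y⟫ ^ 1 * ⟪r, y⟫)) (stdGaussian F) :=
    j1.const_mul _
  have k12 : Integrable (fun y => c ^ 2 * (U l ⟪v, y⟫ * ⟪v, y⟫ ^ 2) +
    2 * c * (U l ⟪v, y⟫ * ⟪v, y⟫ ^ 1 * ⟪r, y⟫)) (stdGaussian F) := k1.add k2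
  have k123 : Integrable (fun y => c ^ 2 * (U l ⟪v, y⟫ * ⟪v, y⟫ ^ 2) +
    2 * c * (U l ⟪v, y⟫ * ⟪v, y⟫ ^ 1 * ⟪r, y⟫) + (U l ⟪v, y⟫ * ⟪v, y⟫ ^ 0 * ⟪r, y⟫ ^ 2))
    (stdGaussian F) := k12.add j2
  rw [hfun]
  refine ⟨k123.sub i0, ?_⟩
  rw [integral_sub k123 i0, integral_add k12 j2, integral_add k1 k2, integral_const_mul,
    integral_const_mul, e1, e2, g_integral1 v hv _ (U_intk l 0).1, g_integral1 v hv _ (U_intk l 2).1]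
  have : aH l = ∫ z, U l z * z ^ 2 ∂(gaussianReal 0 1) - ∫ z, U l z * z ^ 0 ∂(gaussianReal 0 1) := by
    rw [← integral_sub (U_intk l 2) (U_intk l 0)]
    unfold aH
    congr 1; funext z; ring
  rw [this]; ring

lemma g_h4 (v : F) (hv : ‖v‖ = 1) :
    Integrable (fun y => (⟪v, y⟫ ^ 2 - 1) ^ 2) (stdGaussian F) ∧
    ∫ y, (⟪v, y⟫ ^ 2 - 1) ^ 2 ∂(stdGaussian F) ≤ 80 := by
  have h : Integrable (fun z : ℝ => (z ^ 2 - 1) ^ 2) (gaussianReal 0 1) := by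
    have : (fun z : ℝ => (z ^ 2 - 1) ^ 2) = fun z => z ^ 4 - 2 * z ^ 2 + 1 := by funext z; ring
    rw [this]
    exact ((int_pow 4).sub ((int_pow 2).const_mul 2)).add (integrable_const _)
  refine ⟨g_integrable1 v hv _ h, ?_⟩
  rw [g_integral1 v hv (fun z => (z ^ 2 - 1) ^ 2) h.1]
  exact m4

lemma g_basis_event {ι : Type*} [Fintype ι] (b : OrthonormalBasis ι ℝ F) (A : ι → Set ℝ)
    (hA : ∀ i, MeasurableSet (A i)) :
    (stdGaussian F).real {y | ∀ i, ⟪b i, y⟫ ∈ A i} = ∏ i, (gaussianReal 0 1).real (A i) := by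
  classical
  rw [stdGaussian_eq_map_pi_orthonormalBasis b, map_measureReal_apply (by fun_prop)]
  · have : (fun x : ι → ℝ => ∑ i, x i • b i) ⁻¹' {y | ∀ i, ⟪b i, y⟫ ∈ A i} = Set.univ.pi A := by
      ext x
      simp [inner_sum, inner_smul_right, OrthonormalBasis.inner_eq_ite]
    rw [this, measureReal_def, Measure.pi_pi, ENNReal.toReal_prod]; rfl
  · rw [Set.ofPred_forall]
    exact MeasurableSet.iInter fun i => (measurable_const.inner measurable_id) (hA i)

/-- normalising constant -/
def gc (d : ℕ) : ℝ := (2 * Real.pi) ^ (-(d : ℝ) / 2)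

lemma gc_pos (d : ℕ) : 0 < gc d := by unfold gc; positivity

/-- density function -/
def gd (F : Type*) [NormedAddCommGroup F] [InnerProductSpace ℝ F] (y : F) : ℝ :=
  gc (Module.finrank ℝ F) * Real.exp (-‖y‖ ^ 2 / 2)

lemma gd_pos (y : F) : 0 < gd F y := mul_pos (gc_pos _) (Real.exp_pos _)

lemma gd_cont : Continuous (gd F) := by unfold gd; fun_prop

lemma gd_integral : ∫ y : F, gd F y = 1 ∧ Integrable (gd F) := by
  have h := GaussianFourier.integral_rexp_neg_mul_sq_norm (V := F) (b := 1/2) (by norm_num)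
  have h1 : ∫ y : F, gd F y = 1 := by
    unfold gd
    rw [integral_const_mul]
    have : ∀ y : F, Real.exp (-‖y‖ ^ 2 / 2) = Real.exp (-(1/2) * ‖y‖ ^ 2) := by
      intro y; congr 1; ring
    simp_rw [this, h]
    unfold gc
    rw [neg_div, Real.rpow_neg (by positivity), show Real.pi / (1/2) = 2 * Real.pi by ring]
    exact inv_mul_cancel₀ (by positivity)
  refine ⟨h1, ?_⟩
  by_contra hn
  rw [integral_undef hn] at h1; norm_num at h1

lemma gauss_density : stdGaussian F = volume.withDensity fun y => ENNReal.ofReal (gd F y) := by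
  have hfin : IsFiniteMeasure ((volume : Measure F).withDensity fun y => ENNReal.ofReal (gd F y)) :=
    isFiniteMeasure_withDensity_ofReal gd_integral.2.2
  apply Measure.ext_of_charFun
  ext t
  rw [charFun_stdGaussian, charFun_apply, integral_withDensity_eq_integral_toReal_smul
    (by have := gd_cont (F := F); fun_prop) (by simp)]
  have h := GaussianFourier.integral_cexp_neg_mul_sq_norm_add (V := F) (b := 1/2) (by norm_num)
    Complex.I t
  have : ∀ y : F, (ENNReal.ofReal (gd F y)).toReal • Complex.exp (⟪y, t⟫ * Complex.I) =
     (gc (Module.finrank ℝ F) : ℂ) * Complex.exp (-(1/2) * ‖y‖ ^ 2 + Complex.I * ⟪t, y⟫) := by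
    intro y
    rw [ENNReal.toReal_ofReal (gd_pos y).le, gd, Complex.exp_add, Complex.real_smul,
      real_inner_comm]
    push_cast
    rw [mul_assoc]
    congr 3 
    · ring
    · ring
  simp_rw [this]
  rw [integral_const_mul, h]
  have h2 : (gc (Module.finrank ℝ F) : ℂ) * (Real.pi / (1/2) : ℂ) ^ ((Module.finrank ℝ F : ℂ) / 2) = 1 := by
    unfold gc
    rw [show (Real.pi / (1/2) : ℂ) = ((2 * Real.pi : ℝ) : ℂ) by push_cast; ring,
      show ((Module.finrank ℝ F : ℂ) / 2) = (((Module.finrank ℝ F : ℝ) / 2 : ℝ) : ℂ) by push_cast; ring,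
      ← Complex.ofReal_cpow (by positivity), ← Complex.ofReal_mul, neg_div,
      Real.rpow_neg (by positivity), inv_mul_cancel₀ (by positivity)]
    simp
  rw [← mul_assoc, h2, one_mul]
  congr 1
  rw [Complex.I_sq]; ring

end gauss

end JMW

namespace JMW

open ProbabilityTheory Filter Topology

section barthe

set_option linter.unusedSectionVars false

variable {F : Type*} [NormedAddCommGroup F] [InnerProductSpace ℝ F]
  {ι : Type*} [Fintype ι]

/-- tight frame -/
structure Frame (v : ι → F) (d : ι → ℝ) : Prop where
  unit : ∀ i, ‖v i‖ = 1
  nonneg : ∀ i, 0 ≤ d i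
  id : ∀ x, ∑ i, (d i * ⟪v i, x⟫) • v i = x
  sum : ∑ i, d i = Module.finrank ℝ F

variable {v : ι → F} {d : ι → ℝ}

lemma Frame.inner (h : Frame v d) (x y : F) : ∑ i, d i * ⟪v i, x⟫ * ⟪v i, y⟫ = ⟪x, y⟫ := by
  conv_rhs => rw [← h.id x]
  simp [sum_inner, inner_smul_left]

lemma Frame.sq (h : Frame v d) (x : F) : ∑ i, d i * ⟪v i, x⟫ ^ 2 = ‖x‖ ^ 2 := by
  rw [← real_inner_self_eq_norm_sq, ← h.inner x x]
  exact Finset.sum_congr rfl fun i _ => by ring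

/-- the transport-type map -/
def Th (v : ι → F) (d : ι → ℝ) (l : ℝ) (z : F) : F := ∑ i, (d i * U l ⟪v i, z⟫) • v i

lemma Th_inj (h : Frame v d) (l : ℝ) : Function.Injective (Th v d l) := by
  intro x y hxy
  have h0 : ∑ i, d i * ((U l ⟪v i, x⟫ - U l ⟪v i, y⟫) * (⟪v i, x⟫ - ⟪v i, y⟫)) = 0 := by
    have : ⟪Th v d l x - Th v d l y, x - y⟫ = 0 := by rw [hxy]; simp
    rw [← this, Th, Th, ← Finset.sum_sub_distrib, sum_inner]
    refine Finset.sum_congr rfl fun i _ => ?_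
    rw [← sub_smul, inner_smul_left, inner_sub_right]; simp; ring
  have hnn : ∀ a b : ℝ, 0 ≤ (U l a - U l b) * (a - b) := by
    intro a b
    rcases le_total a b with hab | hab
    · have := (U_strictMono l).monotone hab; nlinarith
    · have := (U_strictMono l).monotone hab; nlinarith
  rw [Finset.sum_eq_zero_iff_of_nonneg (fun i _ => mul_nonneg (h.nonneg i) (hnn _ _))] at h0
  have h2 : ∑ i, d i * ⟪v i, x - y⟫ ^ 2 = 0 := by
    refine Finset.sum_eq_zero fun i hi => ?_
    rcases mul_eq_zero.1 (h0 i hi) with h3 | h3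
    · rw [h3, zero_mul]
    · rcases mul_eq_zero.1 h3 with h4 | h4
      · have := (U_strictMono l).injective (sub_eq_zero.1 h4)
        rw [inner_sub_right, this]; simp
      · rw [inner_sub_right, h4]; simp
  rw [h.sq] at h2
  have := pow_eq_zero_iff (two_ne_zero) |>.1 h2
  exact sub_eq_zero.1 (norm_eq_zero.1 this)

/-- weighted frame operator -/
def FrOp (v : ι → F) (d c : ι → ℝ) : F →L[ℝ] F :=
  ∑ i, (d i * c i) • ((innerSL ℝ (v i)).smulRight (v i))

lemma FrOp_apply (c : ι → ℝ) (x : F) : FrOp v d c x = ∑ i, (d i * c i * ⟪v i, x⟫) • v i := by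
  simp [FrOp, smul_smul]

lemma Th_deriv (l : ℝ) (z : F) :
    HasFDerivAt (Th v d l) (FrOp v d fun i => U' l ⟪v i, z⟫) z := by
  unfold Th FrOp
  refine HasFDerivAt.fun_sum fun i _ => ?_
  have h1 : HasFDerivAt (fun z : F => ⟪v i, z⟫) (innerSL ℝ (v i)) z := (innerSL ℝ (v i)).hasFDerivAt
  have h2 := (((U_hasDerivAt l ⟪v i, z⟫).comp_hasFDerivAt z h1).const_mul (d i)).smul_const (v i)
  refine h2.congr_fderiv ?_
  ext x; simp [smul_smul, mul_assoc]

variable [FiniteDimensional ℝ F] [MeasurableSpace F] [BorelSpace F]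

lemma det_lower (h : Frame v d) (c : ι → ℝ) (hc : ∀ i, 0 < c i) :
    Real.exp (∑ i, d i * Real.log (c i)) ≤ (FrOp v d c).det := by
  have hsym : ((FrOp v d c) : F →ₗ[ℝ] F).IsSymmetric := by
    intro x y
    simp only [ContinuousLinearMap.coe_coe, FrOp_apply, sum_inner, inner_sum, inner_smul_left,
      inner_smul_right]
    refine Finset.sum_congr rfl fun i _ => ?_
    simp [real_inner_comm]; ring
  have hdet := hsym.det_eq_prod_eigenvalues rfl
  have hd2 : (FrOp v d c).det = ∏ i, hsym.eigenvalues rfl i := by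
    rw [ContinuousLinearMap.det]; simpa using hdet
  set b := hsym.eigenvectorBasis rfl with hb
  have hmu : ∀ k, hsym.eigenvalues rfl k = ∑ i, (d i * ⟪v i, b k⟫ ^ 2) • c i := by
    intro k
    have h1 := hsym.apply_eigenvectorBasis rfl k
    have h2 : ⟪b k, FrOp v d c (b k)⟫ = hsym.eigenvalues rfl k := by
      have h1' : FrOp v d c (b k) = hsym.eigenvalues rfl k • b k := h1
      rw [h1', inner_smul_right, real_inner_self_eq_norm_sq, b.norm_eq_one]; simp
    rw [← h2, FrOp_apply, inner_sum]
    refine Finset.sum_congr rfl fun i _ => ?_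
    rw [inner_smul_right, real_inner_comm, smul_eq_mul]; ring
  have hw : ∀ k, ∑ i, d i * ⟪v i, b k⟫ ^ 2 = 1 := by
    intro k; rw [h.sq, b.norm_eq_one]; norm_num
  have hmupos : ∀ k, 0 < hsym.eigenvalues rfl k := by
    intro k
    rw [hmu]
    obtain ⟨i, hi, hi0⟩ := Finset.exists_ne_zero_of_sum_ne_zero (s := Finset.univ)
      (f := fun i => d i * ⟪v i, b k⟫ ^ 2) (by rw [hw]; norm_num)
    refine Finset.sum_pos' (fun j _ => ?_) ⟨i, hi, ?_⟩
    · exact mul_nonneg (mul_nonneg (h.nonneg j) (sq_nonneg _)) (hc j).le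
    · exact mul_pos (lt_of_le_of_ne (mul_nonneg (h.nonneg i) (sq_nonneg _)) (Ne.symm hi0)) (hc i)
  have hlog : ∀ k, ∑ i, (d i * ⟪v i, b k⟫ ^ 2) * Real.log (c i)
      ≤ Real.log (hsym.eigenvalues rfl k) := by
    intro k
    rw [hmu]
    have := strictConcaveOn_log_Ioi.concaveOn.le_map_sum (t := Finset.univ)
      (w := fun i => d i * ⟪v i, b k⟫ ^ 2) (p := c)
      (fun i _ => mul_nonneg (h.nonneg i) (sq_nonneg _)) (hw k) (fun i _ => hc i)
    simpa using this
  rw [hd2, ← Real.le_log_iff_exp_le (Finset.prod_pos fun k _ => hmupos k),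
    Real.log_prod (fun k _ => (hmupos k).ne')]
  refine le_trans (le_of_eq ?_) (Finset.sum_le_sum fun k _ => hlog k)
  rw [Finset.sum_comm]
  refine Finset.sum_congr rfl fun i _ => ?_
  rw [← Finset.sum_mul, ← Finset.mul_sum]
  have : ∑ k, ⟪v i, b k⟫ ^ 2 = 1 := by
    rw [b.sum_sq_inner_left, h.unit]; norm_num
  rw [this, mul_one]

/-- defect -/
def Df (v : ι → F) (d : ι → ℝ) (l : ℝ) (z : F) : ℝ :=
  ∑ i, d i * (U l ⟪v i, z⟫ - ⟪v i, Th v d l z⟫) ^ 2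

lemma Df_eq (h : Frame v d) (l : ℝ) (z : F) :
    ‖Th v d l z‖ ^ 2 = ∑ i, d i * U l ⟪v i, z⟫ ^ 2 - Df v d l z := by
  have h1 : ∑ i, d i * U l ⟪v i, z⟫ * ⟪v i, Th v d l z⟫ = ‖Th v d l z‖ ^ 2 := by
    rw [← real_inner_self_eq_norm_sq]
    have : ⟪Th v d l z, Th v d l z⟫ = ⟪∑ i, (d i * U l ⟪v i, z⟫) • v i, Th v d l z⟫ := rfl
    rw [this, sum_inner]
    simp [inner_smul_left]
  have h2 := h.sq (Th v d l z)
  have : Df v d l z = ∑ i, d i * U l ⟪v i, z⟫ ^ 2 - 2 * ∑ i, d i * U l ⟪v i, z⟫ * ⟪v i, Th v d l z⟫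
      + ∑ i, d i * ⟪v i, Th v d l z⟫ ^ 2 := by
    rw [Df, Finset.mul_sum, ← Finset.sum_sub_distrib, ← Finset.sum_add_distrib]
    exact Finset.sum_congr rfl fun i _ => by ring
  rw [this, h1, h2]; ring

lemma det_gd (h : Frame v d) (l : ℝ) (z : F) :
    Phi l ^ (Module.finrank ℝ F) * (1 + Df v d l z / 2) * gd F z ≤
      (FrOp v d fun i => U' l ⟪v i, z⟫).det * gd F (Th v d l z) := by
  have h1 := det_lower h (fun i => U' l ⟪v i, z⟫) (fun i => U'_pos _ _)
  have h2 : ∑ i, d i * Real.log (U' l ⟪v i, z⟫) = Module.finrank ℝ F * Real.log (Phi l)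
      - ‖z‖ ^ 2 / 2 + (∑ i, d i * U l ⟪v i, z⟫ ^ 2) / 2 := by
    simp_rw [log_U']
    rw [← h.sq z, ← h.sum, Finset.sum_mul, Finset.sum_div, Finset.sum_div, ← Finset.sum_sub_distrib,
      ← Finset.sum_add_distrib]
    exact Finset.sum_congr rfl fun i _ => by ring
  refine le_trans ?_ (mul_le_mul_of_nonneg_right h1 (gd_pos _).le)
  rw [h2]
  unfold gd
  rw [Df_eq h]
  have h3 : Real.exp (Module.finrank ℝ F * Real.log (Phi l)) = Phi l ^ (Module.finrank ℝ F) := by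
    rw [← Real.log_pow, Real.exp_log (pow_pos (Phi_pos l) _)]
  have h4 : Real.exp (Module.finrank ℝ F * Real.log (Phi l) - ‖z‖ ^ 2 / 2
      + (∑ i, d i * U l ⟪v i, z⟫ ^ 2) / 2) * (gc (Module.finrank ℝ F) *
      Real.exp (-(∑ i, d i * U l ⟪v i, z⟫ ^ 2 - Df v d l z) / 2)) =
      Phi l ^ (Module.finrank ℝ F) * Real.exp (Df v d l z / 2) *
      (gc (Module.finrank ℝ F) * Real.exp (-‖z‖ ^ 2 / 2)) := by
    rw [← h3]
    have e : ∀ a b c e g : ℝ, a + b = c + e + g → Real.exp a * (gc (Module.finrank ℝ F) * Real.exp b)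
      = Real.exp c * Real.exp e * (gc (Module.finrank ℝ F) * Real.exp g) := by
      intro a b c e g hh
      have : Real.exp a * Real.exp b = Real.exp c * Real.exp e * Real.exp g := by
        rw [← Real.exp_add, ← Real.exp_add, ← Real.exp_add, hh]
      linear_combination gc (Module.finrank ℝ F) * this
    apply e; ring
  rw [h4]
  refine mul_le_mul_of_nonneg_right (mul_le_mul_of_nonneg_left ?_ (pow_pos (Phi_pos l) _).le)
    (mul_pos (gc_pos _) (Real.exp_pos _)).le
  linarith [Real.add_one_le_exp (Df v d l z / 2)]


lemma Th_cont (l : ℝ) : Continuous (Th v d l) := by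
  have := U_cont l; unfold Th; fun_prop

lemma inner_Th (l : ℝ) (i : ι) (z : F) :
    ⟪v i, Th v d l z⟫ = ∑ j, d j * ⟪v i, v j⟫ * U l ⟪v j, z⟫ := by
  rw [Th, inner_sum]
  exact Finset.sum_congr rfl fun j _ => by rw [inner_smul_right]; ring

lemma r_memLp (h : Frame v d) (l : ℝ) (i : ι) :
    MemLp (fun z => U l ⟪v i, z⟫ - ⟪v i, Th v d l z⟫) 2 (stdGaussian F) := by
  have hU : ∀ j, MemLp (fun z => U l ⟪v j, z⟫) 2 (stdGaussian F) := by
    intro j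
    rw [memLp_two_iff_integrable_sq]
    · exact g_integrable1 (v j) (h.unit j) _ (U_intsq l)
    · have := U_cont l; exact Continuous.aestronglyMeasurable (by fun_prop)
  refine (hU i).sub ?_
  simp_rw [inner_Th]
  exact memLp_finsetSum _ fun j _ => (hU j).const_mul _

lemma Df_int (h : Frame v d) (l : ℝ) : Integrable (Df v d l) (stdGaussian F) := by
  unfold Df
  exact integrable_finsetSum _ fun i _ => (r_memLp h l i).integrable_sq.const_mul _

lemma Df_nonneg (h : Frame v d) (l : ℝ) (z : F) : 0 ≤ Df v d l z :=
  Finset.sum_nonneg fun i _ => mul_nonneg (h.nonneg i) (sq_nonneg _)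

lemma barthe (h : Frame v d) (l : ℝ) :
    Phi l ^ (Module.finrank ℝ F) * (1 + (∫ z, Df v d l z ∂(stdGaussian F)) / 2) ≤
      (stdGaussian F).real (range (Th v d l)) := by
  have hcont := Th_cont (v := v) (d := d) l
  have hmeas : MeasurableSet (range (Th v d l)) :=
    (hcont.measurableEmbedding (Th_inj h l)).measurableSet_range
  have hgd : Continuous (gd F) := gd_cont
  set N := Module.finrank ℝ F
  have hint : Integrable (fun z => Phi l ^ N * (1 + Df v d l z / 2)) (stdGaussian F) :=
    ((integrable_const _).add ((Df_int h l).div_const 2)).const_mul _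
  have hnn : ∀ z, 0 ≤ Phi l ^ N * (1 + Df v d l z / 2) := fun z =>
    mul_nonneg (pow_pos (Phi_pos l) _).le (by linarith [Df_nonneg h l z])
  have key : ENNReal.ofReal (∫ z, Phi l ^ N * (1 + Df v d l z / 2) ∂(stdGaussian F)) ≤
      stdGaussian F (range (Th v d l)) := by
    rw [ofReal_integral_eq_lintegral_ofReal hint (ae_of_all _ hnn)]
    conv_rhs => rw [gauss_density, withDensity_apply _ hmeas, ← image_univ]
    rw [lintegral_image_eq_lintegral_abs_det_fderiv_mul volume MeasurableSet.univ
      (fun z _ => (Th_deriv l z).hasFDerivWithinAt) (Th_inj h l).injOn, Measure.restrict_univ]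
    conv_lhs => rw [gauss_density]
    have hm : Measurable fun z : F => ENNReal.ofReal (gd F z) := by fun_prop
    rw [lintegral_withDensity_eq_lintegral_mul_non_measurable _ hm (by simp)]
    refine lintegral_mono fun z => ?_
    simp only [Pi.mul_apply]
    rw [← ENNReal.ofReal_mul (gd_pos z).le, ← ENNReal.ofReal_mul (abs_nonneg _)]
    refine ENNReal.ofReal_le_ofReal ?_
    have := det_gd h l z
    rw [mul_comm]
    exact this.trans (mul_le_mul_of_nonneg_right (le_abs_self _) (gd_pos _).le)
  have e : ∫ z, Phi l ^ N * (1 + Df v d l z / 2) ∂(stdGaussian F) =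
      Phi l ^ N * (1 + (∫ z, Df v d l z ∂(stdGaussian F)) / 2) := by
    rw [integral_const_mul, integral_add (integrable_const _) ((Df_int h l).div_const 2),
      integral_div]; simp
  rw [e] at key
  exact (ENNReal.ofReal_le_iff_le_toReal (measure_ne_top _ _)).1 key

/-- frame defect -/
def Ed (v : ι → F) (d : ι → ℝ) : ℝ :=
  ∑ i, d i * ∑ j, d j * (⟪v i, v j⟫ ^ 2 * (1 - ⟪v i, v j⟫))

lemma Df_lower (h : Frame v d) (l : ℝ) (hN : 0 < Module.finrank ℝ F) :
    aH l ^ 2 * Ed v d ^ 2 / (80 * Module.finrank ℝ F) ≤ ∫ z, Df v d l z ∂(stdGaussian F) := by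
  set r : ι → F → ℝ := fun i z => U l ⟪v i, z⟫ - ⟪v i, Th v d l z⟫ with hr
  set g : ι → F → ℝ := fun i z => ⟪v i, z⟫ ^ 2 - 1 with hg
  have hrg : ∀ i, Integrable (fun z => r i z * g i z) (stdGaussian F) ∧
      ∫ z, r i z * g i z ∂(stdGaussian F) =
        aH l * ∑ j, d j * (⟪v i, v j⟫ ^ 2 * (1 - ⟪v i, v j⟫)) := by
    intro i
    have e : ∀ z, r i z * g i z = U l ⟪v i, z⟫ * (⟪v i, z⟫ ^ 2 - 1) -
        ∑ j, (d j * ⟪v i, v j⟫) * (U l ⟪v j, z⟫ * (⟪v i, z⟫ ^ 2 - 1)) := by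
      intro z
      simp only [hr, hg]
      rw [inner_Th, sub_mul, Finset.sum_mul]
      congr 1
      exact Finset.sum_congr rfl fun j _ => by ring
    have i1 := g_U2 l (v i) (v i) (h.unit i) (h.unit i)
    have i2 := fun j => g_U2 l (v i) (v j) (h.unit i) (h.unit j)
    have i3 : Integrable (fun z => ∑ j, (d j * ⟪v i, v j⟫) * (U l ⟪v j, z⟫ * (⟪v i, z⟫ ^ 2 - 1)))
      (stdGaussian F) := integrable_finsetSum _ fun j _ => (i2 j).1.const_mul _
    simp_rw [e]
    refine ⟨i1.1.sub i3, ?_⟩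
    rw [integral_sub i1.1 i3, integral_finsetSum _ (fun j _ => (i2 j).1.const_mul _), i1.2]
    simp_rw [integral_const_mul, (i2 _).2]
    have h1 := h.sq (v i)
    have h3 : ⟪v i, v i⟫ = 1 := by rw [real_inner_self_eq_norm_sq, h.unit]; norm_num
    rw [h.unit] at h1
    have h4 : ∑ j, d j * (⟪v i, v j⟫ ^ 2 * (1 - ⟪v i, v j⟫)) =
      ∑ j, d j * ⟪v j, v i⟫ ^ 2 - ∑ j, d j * ⟪v i, v j⟫ ^ 3 := by
      rw [← Finset.sum_sub_distrib]
      exact Finset.sum_congr rfl fun j _ => by rw [real_inner_comm (v j)]; ring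
    have h5 : ∑ j, d j * ⟪v i, v j⟫ * (aH l * ⟪v j, v i⟫ ^ 2) = aH l * ∑ j, d j * ⟪v i, v j⟫ ^ 3 := by
      rw [Finset.mul_sum]
      exact Finset.sum_congr rfl fun j _ => by rw [real_inner_comm (v j)]; ring
    rw [h4, h1, h5, h3]; ring
  have hg2 := fun i => g_h4 (v i) (h.unit i)
  have main : ∀ t : ℝ, 2 * t * (aH l * Ed v d) - t ^ 2 * (80 * Module.finrank ℝ F) ≤
      ∫ z, Df v d l z ∂(stdGaussian F) := by
    intro t
    have hi : ∀ i, Integrable (fun z => d i * (2 * t * (r i z * g i z) - t ^ 2 * g i z ^ 2))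
      (stdGaussian F) := fun i =>
        (((hrg i).1.const_mul _).sub ((hg2 i).1.const_mul _)).const_mul _
    have h1 : ∫ z, ∑ i, d i * (2 * t * (r i z * g i z) - t ^ 2 * g i z ^ 2) ∂(stdGaussian F) ≤
      ∫ z, Df v d l z ∂(stdGaussian F) := by
      refine integral_mono (integrable_finsetSum _ fun i _ => hi i) (Df_int h l) fun z => ?_
      refine Finset.sum_le_sum fun i _ => mul_le_mul_of_nonneg_left ?_ (h.nonneg i)
      change _ ≤ (r i z) ^ 2
      nlinarith [sq_nonneg (r i z - t * g i z)]
    refine le_trans ?_ h1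
    rw [integral_finsetSum _ fun i _ => hi i, ← h.sum, Ed, Finset.mul_sum, Finset.mul_sum,
      Finset.mul_sum, Finset.mul_sum, ← Finset.sum_sub_distrib]
    refine Finset.sum_le_sum fun i _ => ?_
    rw [integral_const_mul, integral_sub ((hrg i).1.const_mul _) ((hg2 i).1.const_mul _),
      integral_const_mul, integral_const_mul, (hrg i).2]
    have := mul_le_mul_of_nonneg_left (hg2 i).2 (mul_nonneg (h.nonneg i) (sq_nonneg t))
    nlinarith
  have hN' : (0:ℝ) < 80 * Module.finrank ℝ F := by positivity
  refine le_trans (le_of_eq ?_) (main (aH l * Ed v d / (80 * Module.finrank ℝ F)))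
  field_simp; ring

end barthe

end JMW

namespace JMW

open ProbabilityTheory Filter Topology

section compare

lemma compare {Ω : Type*} [MeasurableSpace Ω] (μ : Measure Ω) [IsProbabilityMeasure μ] (f g : Ω → ℝ)
    (hf : Integrable f μ) (hg : Integrable g μ) (hfm : Measurable f) (hgm : Measurable g)
    (κ : ℝ) (hκ : 0 ≤ κ)
    (h1 : ∀ l : ℝ, μ.real {x | g x ≤ l} ≤ μ.real {x | f x ≤ l})
    (h2 : ∀ l ∈ Icc (-1:ℝ) 0, μ.real {x | g x ≤ l} + κ ≤ μ.real {x | f x ≤ l}) :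
    ∫ x, f x ∂μ + κ ≤ ∫ x, g x ∂μ := by
  have toE : ∀ (l c : ℝ), 0 ≤ c → μ.real {x | g x ≤ l} + c ≤ μ.real {x | f x ≤ l} →
      μ {x | g x ≤ l} + ENNReal.ofReal c ≤ μ {x | f x ≤ l} := by
    intro l c hc h
    rw [measureReal_def, measureReal_def] at h
    rw [← ENNReal.ofReal_toReal (measure_ne_top μ {x | g x ≤ l}),
      ← ENNReal.ofReal_toReal (measure_ne_top μ {x | f x ≤ l}),
      ← ENNReal.ofReal_add ENNReal.toReal_nonneg hc]
    exact ENNReal.ofReal_le_ofReal h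
  have nn : ∀ k : Ω → ℝ, 0 ≤ fun x => max (k x) 0 := fun k x => le_max_right _ _
  have nn' : ∀ k : Ω → ℝ, 0 ≤ fun x => max (-k x) 0 := fun k x => le_max_right _ _
  have hp : ∫ x, max (f x) 0 ∂μ ≤ ∫ x, max (g x) 0 ∂μ := by
    rw [integral_eq_lintegral_of_nonneg_ae (ae_of_all _ (nn f))
      (by fun_prop), integral_eq_lintegral_of_nonneg_ae (ae_of_all _ (nn g))
      (by fun_prop)]
    refine ENNReal.toReal_mono ?_ ?_
    · exact (hg.pos_part).lintegral_lt_top.ne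
    · rw [lintegral_eq_lintegral_meas_lt μ (ae_of_all _ (nn f))
        (by fun_prop), lintegral_eq_lintegral_meas_lt μ (ae_of_all _ (nn g))
        (by fun_prop)]
      refine setLIntegral_mono' measurableSet_Ioi fun t ht => ?_
      have e : ∀ k : Ω → ℝ, {a | t < max (k a) 0} = {a | k a ≤ t}ᶜ := by
        intro k; ext a
        have : ¬ (t < 0) := not_lt.2 (le_of_lt ht)
        simp [lt_max_iff, this]
      rw [e, e, prob_compl_eq_one_sub (measurableSet_le hfm measurable_const),
        prob_compl_eq_one_sub (measurableSet_le hgm measurable_const)]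
      refine tsub_le_tsub_left ?_ _
      have := toE t 0 le_rfl (by simpa using h1 t)
      simpa using this
  have hn : ∫ x, max (-g x) 0 ∂μ + κ ≤ ∫ x, max (-f x) 0 ∂μ := by
    have hgi := hg.neg_part
    have hfi := hf.neg_part
    have : ENNReal.ofReal (∫ x, max (-g x) 0 ∂μ + κ) ≤ ENNReal.ofReal (∫ x, max (-f x) 0 ∂μ) := by
      rw [ENNReal.ofReal_add (integral_nonneg (nn' g)) hκ,
        ofReal_integral_eq_lintegral_ofReal hgi (ae_of_all _ (nn' g)),
        ofReal_integral_eq_lintegral_ofReal hfi (ae_of_all _ (nn' f)),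
        lintegral_eq_lintegral_meas_le μ (ae_of_all _ (nn' g))
        (by fun_prop), lintegral_eq_lintegral_meas_le μ (ae_of_all _ (nn' f))
        (by fun_prop)]
      have hk : ENNReal.ofReal κ = ∫⁻ t in Ioi (0:ℝ), (Ioc (0:ℝ) 1).indicator
          (fun _ => ENNReal.ofReal κ) t := by
        rw [lintegral_indicator measurableSet_Ioc, Measure.restrict_restrict measurableSet_Ioc,
          inter_eq_left.2 Ioc_subset_Ioi_self]
        simp
      rw [hk, ← lintegral_add_right _ (measurable_const.indicator measurableSet_Ioc)]
      refine setLIntegral_mono' measurableSet_Ioi fun t ht => ?_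
      have e : ∀ k : Ω → ℝ, {a | t ≤ max (-k a) 0} = {a | k a ≤ -t} := by
        intro k; ext a
        have : ¬ (t ≤ 0) := not_le.2 ht
        simp [le_max_iff, this]
        constructor <;> intro h <;> linarith
      rw [e, e]
      by_cases h : t ∈ Ioc (0:ℝ) 1
      · rw [indicator_of_mem h]
        exact toE _ _ hκ (h2 _ ⟨by linarith [h.2], by linarith [h.1]⟩)
      · rw [indicator_of_notMem h]
        have := toE (-t) 0 le_rfl (by simpa using h1 (-t))
        simpa using this
    rwa [ENNReal.ofReal_le_ofReal_iff (integral_nonneg (nn' f))] at this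
  have e : ∀ k : Ω → ℝ, Integrable k μ →
      ∫ x, k x ∂μ = ∫ x, max (k x) 0 ∂μ - ∫ x, max (-k x) 0 ∂μ := by
    intro k hk
    rw [← integral_sub hk.pos_part hk.neg_part]
    congr 1; funext x
    rcases le_total (k x) 0 with h | h
    · rw [max_eq_right h, max_eq_left (by linarith)]; ring
    · rw [max_eq_left h, max_eq_right (by linarith)]; ring
  rw [e f hf, e g hg]; linarith

end compare

section supp

variable {n : ℕ} {K : Set (EuclideanSpace ℝ (Fin n))} {R : ℝ}

lemma suppFn_le (hne : K.Nonempty) {x : EuclideanSpace ℝ (Fin n)} {c : ℝ}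
    (h : ∀ y ∈ K, ⟪x, y⟫ ≤ c) : suppFn K x ≤ c :=
  csSup_le (hne.image _) (by rintro _ ⟨y, hy, rfl⟩; exact h y hy)

lemma inner_le_R (hK : K ⊆ closedBall 0 R) (x : EuclideanSpace ℝ (Fin n)) {y} (hy : y ∈ K) :
    ⟪x, y⟫ ≤ R * ‖x‖ := by
  have := hK hy
  rw [mem_closedBall_zero_iff] at this
  calc ⟪x, y⟫ ≤ ‖x‖ * ‖y‖ := real_inner_le_norm _ _
    _ ≤ R * ‖x‖ := by nlinarith [norm_nonneg x]

lemma le_suppFn (hK : K ⊆ closedBall 0 R) {x y : EuclideanSpace ℝ (Fin n)} (hy : y ∈ K) :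
    ⟪x, y⟫ ≤ suppFn K x :=
  le_csSup ⟨R * ‖x‖, by rintro _ ⟨z, hz, rfl⟩; exact inner_le_R hK x hz⟩ ⟨y, hy, rfl⟩

lemma suppFn_le_R (hne : K.Nonempty) (hK : K ⊆ closedBall 0 R) (x : EuclideanSpace ℝ (Fin n)) :
    suppFn K x ≤ R * ‖x‖ := suppFn_le hne fun _ hy => inner_le_R hK x hy

lemma suppFn_add_le (hne : K.Nonempty) (hK : K ⊆ closedBall 0 R) (x y : EuclideanSpace ℝ (Fin n)) :
    suppFn K (x + y) ≤ suppFn K x + suppFn K y :=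
  suppFn_le hne fun z hz => by
    rw [inner_add_left]; exact add_le_add (le_suppFn hK hz) (le_suppFn hK hz)

lemma suppFn_sub_le (hne : K.Nonempty) (hK : K ⊆ closedBall 0 R) (x y : EuclideanSpace ℝ (Fin n)) :
    suppFn K x - suppFn K y ≤ R * ‖x - y‖ := by
  have h := suppFn_add_le hne hK (x - y) y
  rw [sub_add_cancel] at h
  linarith [suppFn_le_R hne hK (x - y)]

lemma R_nonneg (hne : K.Nonempty) (hK : K ⊆ closedBall 0 R) : 0 ≤ R := by
  obtain ⟨y, hy⟩ := hne
  have := hK hy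
  rw [mem_closedBall_zero_iff] at this
  exact (norm_nonneg _).trans this

lemma suppFn_cont (hne : K.Nonempty) (hK : K ⊆ closedBall 0 R) : Continuous (suppFn K) := by
  refine LipschitzWith.continuous (K := ⟨R, R_nonneg hne hK⟩) (LipschitzWith.of_dist_le_mul ?_)
  intro x y
  rw [Real.dist_eq, dist_eq_norm, abs_le]
  have h1 := suppFn_sub_le hne hK x y
  have h2 := suppFn_sub_le hne hK y x
  rw [norm_sub_rev] at h2
  change -(R * _) ≤ _ ∧ _ ≤ R * _
  constructor <;> linarith

lemma suppFn_zero (hne : K.Nonempty) : suppFn K 0 = 0 := by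
  unfold suppFn
  have : (fun y : EuclideanSpace ℝ (Fin n) => ⟪(0:EuclideanSpace ℝ (Fin n)), y⟫) '' K = {0} := by
    ext t; simp [hne.image_const]
  rw [this, csSup_singleton]

lemma suppFn_abs (hne : K.Nonempty) (hK : K ⊆ closedBall 0 R) (x : EuclideanSpace ℝ (Fin n)) :
    |suppFn K x| ≤ R * ‖x‖ := by
  have h1 := suppFn_sub_le hne hK x 0
  have h2 := suppFn_sub_le hne hK 0 x
  rw [suppFn_zero hne] at h1 h2
  simp at h1 h2
  rw [abs_le]; constructor <;> linarith

lemma suppFn_int (hne : K.Nonempty) (hK : K ⊆ closedBall 0 R) :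
    Integrable (suppFn K) (stdGaussian (EuclideanSpace ℝ (Fin n))) :=
  Integrable.mono' (g_norm_int.const_mul R) (suppFn_cont hne hK).aestronglyMeasurable
    (ae_of_all _ fun x => suppFn_abs hne hK x)

lemma suppFn_smul {c : ℝ} (hc : 0 ≤ c) (x : EuclideanSpace ℝ (Fin n)) :
    suppFn K (c • x) = c * suppFn K x := by
  unfold suppFn
  rw [← smul_eq_mul, ← Real.sSup_smul_of_nonneg hc]
  congr 1
  ext t; simp [Set.mem_smul_set, inner_smul_left]

/-- Gaussian mean of the support function -/
def bG (K : Set (EuclideanSpace ℝ (Fin n))) : ℝ :=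
  ∫ x, suppFn K x ∂(stdGaussian (EuclideanSpace ℝ (Fin n)))

lemma bG_iso (T : EuclideanSpace ℝ (Fin n) ≃ₗᵢ[ℝ] EuclideanSpace ℝ (Fin n)) :
    ∫ x, suppFn K (T x) ∂(stdGaussian (EuclideanSpace ℝ (Fin n))) = bG K := by
  have h := stdGaussian_map T
  unfold bG
  conv_rhs => rw [← h]
  rw [MeasurableEmbedding.integral_map]
  exact T.toHomeomorph.measurableEmbedding

lemma norm_mean : ∫ x, ‖x‖ ∂(stdGaussian (EuclideanSpace ℝ (Fin n))) ≤ Real.sqrt n := by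
  have hs : ∀ x : EuclideanSpace ℝ (Fin n), ‖x‖ ^ 2 = ∑ i, ⟪EuclideanSpace.basisFun (Fin n) ℝ i, x⟫ ^ 2 := by
    intro x; rw [OrthonormalBasis.sum_sq_inner_right]
  have hi : Integrable (fun x : EuclideanSpace ℝ (Fin n) => ‖x‖ ^ 2) (stdGaussian (EuclideanSpace ℝ (Fin n))) := by
    simp_rw [hs]; exact integrable_finsetSum _ fun i _ => g_sq_int _
  have h2 : ∫ x, ‖x‖ ^ 2 ∂(stdGaussian (EuclideanSpace ℝ (Fin n))) = n := by
    simp_rw [hs]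
    rw [integral_finsetSum _ fun i _ => g_sq_int _]
    simp_rw [g_sq, OrthonormalBasis.norm_eq_one]; simp
  refine Real.le_sqrt_of_sq_le ?_
  set m := ∫ x, ‖x‖ ∂(stdGaussian (EuclideanSpace ℝ (Fin n))) with hm
  have h3 : 0 ≤ ∫ x, (‖x‖ - m) ^ 2 ∂(stdGaussian (EuclideanSpace ℝ (Fin n))) :=
    integral_nonneg fun x => sq_nonneg _
  have e : ∀ x : EuclideanSpace ℝ (Fin n), (‖x‖ - m) ^ 2 = ‖x‖ ^ 2 - 2 * m * ‖x‖ + m ^ 2 := by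
    intro x; ring
  simp_rw [e] at h3
  have i1 : Integrable (fun x : EuclideanSpace ℝ (Fin n) => 2 * m * ‖x‖) (stdGaussian (EuclideanSpace ℝ (Fin n))) :=
    g_norm_int.const_mul _
  have i2 : Integrable (fun x : EuclideanSpace ℝ (Fin n) => ‖x‖ ^ 2 - 2 * m * ‖x‖) (stdGaussian (EuclideanSpace ℝ (Fin n))) :=
    hi.sub i1
  rw [integral_add i2 (integrable_const _), integral_sub hi i1, integral_const_mul, h2, ← hm] at h3
  simp at h3
  nlinarith

lemma bG_le (hne : K.Nonempty) (hK : K ⊆ closedBall 0 R) : bG K ≤ R * Real.sqrt n := by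
  have h0 := R_nonneg hne hK
  calc bG K ≤ ∫ x, R * ‖x‖ ∂(stdGaussian (EuclideanSpace ℝ (Fin n))) :=
        integral_mono (suppFn_int hne hK) (g_norm_int.const_mul R) fun x => suppFn_le_R hne hK x
    _ ≤ _ := by rw [integral_const_mul]; exact mul_le_mul_of_nonneg_left norm_mean h0

end supp

end JMW

namespace JMW

open ProbabilityTheory Filter Topology

section lift

abbrev FF (n : ℕ) := WithLp 2 (EuclideanSpace ℝ (Fin n) × ℝ)

variable {n : ℕ}

lemma FF_finrank : Module.finrank ℝ (FF n) = n + 1 := by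
  rw [(WithLp.linearEquiv 2 ℝ (EuclideanSpace ℝ (Fin n) × ℝ)).finrank_eq, Module.finrank_prod]
  simp

def lift (u : EuclideanSpace ℝ (Fin n)) : FF n :=
  WithLp.toLp 2 (Real.sqrt (n / (n + 1)) • u, 1 / Real.sqrt (n + 1))

lemma inner_lift (u : EuclideanSpace ℝ (Fin n)) (y : FF n) :
    ⟪lift u, y⟫ = Real.sqrt (n / (n + 1)) * ⟪u, y.fst⟫ + 1 / Real.sqrt (n + 1) * y.snd := by
  rw [WithLp.prod_inner_apply]
  simp [lift, inner_smul_left]; ring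

lemma inner_lift_lift (u v : EuclideanSpace ℝ (Fin n)) :
    ⟪lift u, lift v⟫ = (n * ⟪u, v⟫ + 1) / (n + 1) := by
  rw [inner_lift]
  have h1 : Real.sqrt (n / (n + 1)) * Real.sqrt (n / (n + 1)) = (n:ℝ) / (n + 1) :=
    Real.mul_self_sqrt (by positivity)
  have h2 : 1 / Real.sqrt ((n:ℝ) + 1) * (1 / Real.sqrt (n + 1)) = 1 / (n + 1) := by
    rw [div_mul_div_comm, Real.mul_self_sqrt (by positivity)]; ring
  have : (lift v).fst = Real.sqrt (n / (n + 1)) • v := rfl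
  rw [this, inner_smul_right]
  have : (lift v).snd = 1 / Real.sqrt (n + 1) := rfl
  rw [this, h2, ← mul_assoc, h1]; field_simp

lemma norm_lift {u : EuclideanSpace ℝ (Fin n)} (hu : ‖u‖ = 1) : ‖lift u‖ = 1 := by
  have h := real_inner_self_eq_norm_sq (lift u)
  rw [inner_lift_lift, real_inner_self_eq_norm_sq, hu] at h
  have h3 : ‖lift u‖ ^ 2 = 1 := by rw [← h]; field_simp
  nlinarith [norm_nonneg (lift u)]

lemma map_fst : (stdGaussian (FF n)).map (fun y => y.fst) = stdGaussian (EuclideanSpace ℝ (Fin n)) := by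
  have hm : Measurable (fun y : FF n => y.fst) := (WithLp.fstL 2 ℝ _ _).continuous.measurable
  have : IsProbabilityMeasure ((stdGaussian (FF n)).map (fun y => y.fst)) :=
    Measure.isProbabilityMeasure_map hm.aemeasurable
  refine Measure.ext_of_charFun ?_
  funext t
  have h : charFun ((stdGaussian (FF n)).map (fun y => y.fst)) t
      = charFun (stdGaussian (FF n)) (WithLp.toLp 2 (t, 0)) := by
    rw [charFun_apply, charFun_apply, integral_map hm.aemeasurable (by fun_prop)]
    congr 1; funext y
    rw [WithLp.prod_inner_apply]; simp
  rw [h, charFun_stdGaussian, charFun_stdGaussian]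
  simp

lemma snd_mean : ∫ y : FF n, y.snd ∂(stdGaussian (FF n)) = 0 := by
  have := g_mean (F := FF n) (WithLp.toLp 2 (0, 1))
  simpa [WithLp.prod_inner_apply] using this

lemma snd_int : Integrable (fun y : FF n => y.snd) (stdGaussian (FF n)) := by
  have := g_int (F := FF n) (WithLp.toLp 2 (0, 1))
  simpa [WithLp.prod_inner_apply] using this

variable {K : Set (EuclideanSpace ℝ (Fin n))} {R : ℝ}

def HH (K : Set (EuclideanSpace ℝ (Fin n))) (y : FF n) : ℝ :=
  1 / (n + 1) * (Real.sqrt ((n + 1) / n) * suppFn K (-y.fst) + Real.sqrt (n + 1) * y.snd)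

lemma fst_cont : Continuous (fun y : FF n => y.fst) := (WithLp.fstL 2 ℝ _ _).continuous
lemma snd_cont : Continuous (fun y : FF n => y.snd) := (WithLp.sndL 2 ℝ _ _).continuous

lemma supp_neg_fst_int (hne : K.Nonempty) (hK : K ⊆ closedBall 0 R) :
    Integrable (fun y : FF n => suppFn K (-y.fst)) (stdGaussian (FF n)) ∧
    ∫ y : FF n, suppFn K (-y.fst) ∂(stdGaussian (FF n)) = bG K := by
  have hc := suppFn_cont hne hK
  have hc2 : Continuous (fun x => suppFn K (-x)) := hc.comp continuous_neg
  have hb := bG_iso (K := K) (LinearIsometryEquiv.neg ℝ)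
  have hi : Integrable (fun x => suppFn K (-x)) (stdGaussian (EuclideanSpace ℝ (Fin n))) :=
    Integrable.mono' (g_norm_int.const_mul R) hc2.aestronglyMeasurable
      (ae_of_all _ fun x => by simpa using suppFn_abs hne hK (-x))
  constructor
  · rw [← map_fst] at hi
    exact (integrable_map_measure hc2.aestronglyMeasurable fst_cont.measurable.aemeasurable).1 hi
  · rw [← hb, ← map_fst, integral_map fst_cont.measurable.aemeasurable]
    · rfl
    · exact hc2.aestronglyMeasurable

lemma HH_int (hne : K.Nonempty) (hK : K ⊆ closedBall 0 R) :
    Integrable (HH K) (stdGaussian (FF n)) :=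
  (((supp_neg_fst_int hne hK).1.const_mul _).add (snd_int.const_mul _)).const_mul _

lemma HH_mean (hne : K.Nonempty) (hK : K ⊆ closedBall 0 R) :
    ∫ y, HH K y ∂(stdGaussian (FF n)) = 1 / (n + 1) * Real.sqrt ((n + 1) / n) * bG K := by
  unfold HH
  rw [integral_const_mul, integral_add ((supp_neg_fst_int hne hK).1.const_mul _) (snd_int.const_mul _),
    integral_const_mul, integral_const_mul, snd_mean, (supp_neg_fst_int hne hK).2]
  ring

lemma HH_meas (hne : K.Nonempty) (hK : K ⊆ closedBall 0 R) : Measurable (HH K) := by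
  have h1 : Continuous (fun y : FF n => suppFn K (-y.fst)) :=
    (suppFn_cont hne hK).comp fst_cont.neg
  exact (continuous_const.mul ((continuous_const.mul h1).add (continuous_const.mul snd_cont))).measurable

variable {ι : Type*} [Fintype ι]

/-- John decomposition data -/
structure JD (K : Set (EuclideanSpace ℝ (Fin n))) (u : ι → EuclideanSpace ℝ (Fin n)) (p : ι → ℝ) : Prop where
  unit : ∀ i, ‖u i‖ = 1
  nonneg : ∀ i, 0 ≤ p i
  sum : ∑ i, p i = 1
  cent : ∑ i, p i • u i = 0
  id : ∀ x, ∑ i, (p i * ⟪u i, x⟫) • u i = (1 / (n:ℝ)) • x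
  le : ∀ i, ∀ x ∈ K, ⟪u i, x⟫ ≤ 1

variable {u : ι → EuclideanSpace ℝ (Fin n)} {p : ι → ℝ}

lemma JD.cent' (h : JD K u p) (x : EuclideanSpace ℝ (Fin n)) : ∑ i, p i * ⟪u i, x⟫ = 0 := by
  have := congrArg (fun y => ⟪y, x⟫) h.cent
  simpa [sum_inner, inner_smul_left] using this

lemma JD.sq (h : JD K u p) (x : EuclideanSpace ℝ (Fin n)) :
    ∑ i, p i * ⟪u i, x⟫ ^ 2 = 1 / (n:ℝ) * ‖x‖ ^ 2 := by
  have := congrArg (fun y => ⟪y, x⟫) (h.id x)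
  simp only [sum_inner, inner_smul_left, real_inner_self_eq_norm_sq] at this
  simp at this
  rw [one_div, ← this]
  refine Finset.sum_congr rfl fun i _ => by ring

lemma JD.sub (h : JD K u p) (hn : 1 ≤ n) : K ⊆ closedBall 0 n := by
  intro x hx
  rw [mem_closedBall_zero_iff]
  have hn' : (0:ℝ) < n := by exact_mod_cast hn
  have h0 : 0 ≤ ∑ i, p i * ((1 - ⟪u i, x⟫) * (‖x‖ + ⟪u i, x⟫)) := by
    refine Finset.sum_nonneg fun i _ => mul_nonneg (h.nonneg i) (mul_nonneg ?_ ?_)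
    · linarith [h.le i x hx]
    · have := neg_le_of_abs_le (abs_real_inner_le_norm (u i) x)
      rw [h.unit i, one_mul] at this; linarith
  have e : ∑ i, p i * ((1 - ⟪u i, x⟫) * (‖x‖ + ⟪u i, x⟫)) = ‖x‖ - 1 / n * ‖x‖ ^ 2 := by
    rw [← h.sq x]
    calc _ = (∑ i, p i) * ‖x‖ + (1 - ‖x‖) * ∑ i, p i * ⟪u i, x⟫ - ∑ i, p i * ⟪u i, x⟫ ^ 2 := by
          rw [Finset.sum_mul, Finset.mul_sum, ← Finset.sum_add_distrib, ← Finset.sum_sub_distrib]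
          refine Finset.sum_congr rfl fun i _ => by ring
      _ = _ := by rw [h.sum, h.cent']; ring
  rw [e] at h0
  by_contra hc
  push Not at hc
  have hx0 : 0 < ‖x‖ := hn'.trans hc
  have : ‖x‖ < 1 / n * ‖x‖ ^ 2 := by
    rw [one_div, inv_mul_eq_div, lt_div_iff₀ hn']; nlinarith
  linarith

lemma JD.frame (h : JD K u p) (hn : 1 ≤ n) :
    Frame (fun i => lift (u i)) (fun i => (n + 1) * p i) := by
  have hn' : (0:ℝ) < n := by exact_mod_cast hn
  refine ⟨fun i => norm_lift (h.unit i), fun i => mul_nonneg (by positivity) (h.nonneg i), ?_, ?_⟩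
  · intro y
    have h1 : Real.sqrt (n / (n + 1)) * Real.sqrt (n / (n + 1)) = (n:ℝ) / (n + 1) :=
      Real.mul_self_sqrt (by positivity)
    have h2 : 1 / Real.sqrt ((n:ℝ) + 1) * (1 / Real.sqrt (n + 1)) = 1 / (n + 1) := by
      rw [div_mul_div_comm, Real.mul_self_sqrt (by positivity)]; ring
    refine ext_inner_right ℝ fun z => ?_
    rw [sum_inner]
    simp only [inner_smul_left, inner_lift]
    rw [WithLp.prod_inner_apply y z]
    have hin : ∑ i, p i * ⟪u i, y.fst⟫ * ⟪u i, z.fst⟫ = 1 / n * ⟪y.fst, z.fst⟫ := by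
      have := congrArg (fun t => ⟪t, z.fst⟫) (h.id y.fst)
      simpa [sum_inner, inner_smul_left] using this
    set a := Real.sqrt ((n:ℝ) / (n + 1))
    set b := 1 / Real.sqrt ((n:ℝ) + 1)
    have e : ∑ i, (starRingEnd ℝ) ((n + 1) * p i * (a * ⟪u i, y.fst⟫ + b * y.snd)) * (a * ⟪u i, z.fst⟫ + b * z.snd)
        = (n + 1) * ((a * a) * (∑ i, p i * ⟪u i, y.fst⟫ * ⟪u i, z.fst⟫)
          + a * b * z.snd * ∑ i, p i * ⟪u i, y.fst⟫ + a * b * y.snd * ∑ i, p i * ⟪u i, z.fst⟫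
          + (b * b) * y.snd * z.snd * ∑ i, p i) := by
      simp only [Finset.mul_sum, ← Finset.sum_add_distrib]
      refine Finset.sum_congr rfl fun i _ => ?_
      simp only [conj_trivial]; ring
    rw [e, hin, h.cent', h.cent', h.sum, h1, h2]
    have : ⟪y.ofLp.snd, z.ofLp.snd⟫ = y.snd * z.snd := by
      rw [real_inner_comm]; rfl
    rw [this]
    have e2 : ⟪y.ofLp.fst, z.ofLp.fst⟫ = ⟪y.fst, z.fst⟫ := rfl
    rw [e2]
    field_simp; ring
  · rw [← Finset.mul_sum, h.sum, FF_finrank]; push_cast; ring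

lemma HH_Th (h : JD K u p) (hn : 1 ≤ n) (hne : K.Nonempty) (l : ℝ) (z : FF n) :
    HH K (Th (fun i => lift (u i)) (fun i => (n + 1) * p i) l z) ≤ l := by
  have hn' : (0:ℝ) < n := by exact_mod_cast hn
  set s : ι → ℝ := fun i => U l ⟪lift (u i), z⟫ with hs
  have hsl : ∀ i, s i < l := fun i => U_lt _ _
  set y := Th (fun i => lift (u i)) (fun i => (n + 1) * p i) l z with hy
  have hy' : y = ∑ i, ((n + 1) * p i * s i) • lift (u i) := rfl
  have hf : y.fst = ∑ i, ((n + 1) * p i * s i * Real.sqrt (n / (n + 1))) • u i := by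
    have := map_sum (WithLp.fstL 2 ℝ (EuclideanSpace ℝ (Fin n)) ℝ) (fun i => ((n + 1) * p i * s i) • lift (u i)) Finset.univ
    rw [← hy'] at this
    refine this.trans (Finset.sum_congr rfl fun i _ => ?_)
    rw [map_smul, ← smul_smul ((n + 1) * p i * s i)]; rfl
  have hsn : y.snd = Real.sqrt (n + 1) * ∑ i, p i * s i := by
    have := map_sum (WithLp.sndL 2 ℝ (EuclideanSpace ℝ (Fin n)) ℝ) (fun i => ((n + 1) * p i * s i) • lift (u i)) Finset.univ
    rw [← hy'] at this
    refine this.trans ?_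
    rw [Finset.mul_sum]
    refine Finset.sum_congr rfl fun i _ => ?_
    rw [map_smul]
    change ((n + 1) * p i * s i) * (1 / Real.sqrt (n + 1)) = _
    have := Real.mul_self_sqrt (show (0:ℝ) ≤ n + 1 by positivity)
    have h0 : 0 < Real.sqrt ((n:ℝ) + 1) := by positivity
    field_simp
    rw [pow_two, this]; ring
  have hsup : suppFn K (-y.fst) ≤ (n + 1) * Real.sqrt (n / (n + 1)) * (l - ∑ i, p i * s i) := by
    refine suppFn_le hne fun k hk => ?_
    rw [hf, inner_neg_left, sum_inner]
    simp only [inner_smul_left, conj_trivial]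
    have e : -∑ i, ((n + 1) * p i * s i * Real.sqrt (n / (n + 1))) * ⟪u i, k⟫
        = (n + 1) * Real.sqrt (n / (n + 1)) * ∑ i, p i * ((l - s i) * ⟪u i, k⟫) := by
      have e2 : ∑ i, p i * ((l - s i) * ⟪u i, k⟫) = l * ∑ i, p i * ⟪u i, k⟫ - ∑ i, p i * s i * ⟪u i, k⟫ := by
        rw [Finset.mul_sum, ← Finset.sum_sub_distrib]
        refine Finset.sum_congr rfl fun i _ => by ring
      rw [e2, h.cent', mul_zero, zero_sub, mul_neg, Finset.mul_sum]
      congr 1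
      refine Finset.sum_congr rfl fun i _ => by ring
    rw [e]
    refine mul_le_mul_of_nonneg_left ?_ (by positivity)
    have e3 : l - ∑ i, p i * s i = ∑ i, p i * (l - s i) := by
      simp only [mul_sub, Finset.sum_sub_distrib, ← Finset.sum_mul, h.sum, one_mul]
    rw [e3]
    refine Finset.sum_le_sum fun i _ => mul_le_mul_of_nonneg_left ?_ (h.nonneg i)
    have := h.le i k hk
    nlinarith [hsl i]
  unfold HH
  rw [hsn]
  have hq : Real.sqrt ((n + 1) / n) * Real.sqrt (n / (n + 1)) = (1:ℝ) := by
    rw [← Real.sqrt_mul (by positivity)]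
    rw [show ((n:ℝ) + 1) / n * (n / (n + 1)) = 1 by field_simp, Real.sqrt_one]
  have hq2 := Real.mul_self_sqrt (show (0:ℝ) ≤ n + 1 by positivity)
  have h1 : Real.sqrt ((n + 1) / n) * suppFn K (-y.fst) ≤ (n + 1) * (l - ∑ i, p i * s i) := by
    calc _ ≤ Real.sqrt ((n + 1) / n) * ((n + 1) * Real.sqrt (n / (n + 1)) * (l - ∑ i, p i * s i)) :=
          mul_le_mul_of_nonneg_left hsup (Real.sqrt_nonneg _)
      _ = (Real.sqrt ((n + 1) / n) * Real.sqrt (n / (n + 1))) * ((n + 1) * (l - ∑ i, p i * s i)) := by ring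
      _ = _ := by rw [hq, one_mul]
  rw [← mul_assoc (Real.sqrt ((n:ℝ) + 1)), hq2]
  calc _ ≤ 1 / ((n:ℝ) + 1) * ((n + 1) * (l - ∑ i, p i * s i) + (n + 1) * ∑ i, p i * s i) := by
        gcongr
    _ = l := by field_simp; ring

end lift

end JMW

namespace JMW

open ProbabilityTheory Filter Topology

section simplex

variable {n : ℕ} {w : Fin (n + 1) → EuclideanSpace ℝ (Fin n)}

lemma simplex_basis (hw : IsRegVerts w) (hn : 1 ≤ n) :
    ∃ b : OrthonormalBasis (Fin (n + 1)) ℝ (FF n), ∀ i, b i = lift (w i) := by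
  have hn' : (0:ℝ) < n := by exact_mod_cast hn
  have ho : Orthonormal ℝ (fun i => lift (w i)) := by
    refine ⟨fun i => norm_lift (hw.1 i), fun i j hij => ?_⟩
    change ⟪lift (w i), lift (w j)⟫ = 0
    rw [inner_lift_lift, hw.2 i j hij]; field_simp; simp
  have hc : Fintype.card (Fin (n + 1)) = Module.finrank ℝ (FF n) := by
    rw [FF_finrank, Fintype.card_fin]
  refine ⟨(basisOfOrthonormalOfCardEqFinrank ho hc).toOrthonormalBasis (by simpa using ho), fun i => ?_⟩
  simp

lemma simplex_id (hw : IsRegVerts w) (hn : 1 ≤ n) (x : EuclideanSpace ℝ (Fin n)) :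
    ∑ i, ⟪w i, x⟫ = 0 ∧ ∑ i, ⟪w i, x⟫ • w i = (((n:ℝ) + 1) / n) • x := by
  have hn' : (0:ℝ) < n := by exact_mod_cast hn
  obtain ⟨b, hb⟩ := simplex_basis hw hn
  set y : FF n := WithLp.toLp 2 (x, 0) with hy
  have h := b.sum_repr' y
  have e : ∀ i, ⟪b i, y⟫ = Real.sqrt (n / (n + 1)) * ⟪w i, x⟫ := by
    intro i; rw [hb, inner_lift, hy]; simp
  simp only [e] at h
  simp only [hb] at h
  have h1 : Real.sqrt (n / (n + 1)) * Real.sqrt (n / (n + 1)) = (n:ℝ) / (n + 1) :=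
      Real.mul_self_sqrt (by positivity)
  have hp : 0 < Real.sqrt ((n:ℝ) / (n + 1)) := by positivity
  constructor
  · have h2 := congrArg (WithLp.sndL 2 ℝ (EuclideanSpace ℝ (Fin n)) ℝ) h
    rw [map_sum] at h2
    simp only [map_smul] at h2
    have h3 : ∑ i, (Real.sqrt (n / (n + 1)) * ⟪w i, x⟫) * (1 / Real.sqrt (n + 1)) = 0 := h2
    rw [← Finset.sum_mul, ← Finset.mul_sum] at h3
    have hq : 0 < 1 / Real.sqrt ((n:ℝ) + 1) := by positivity
    rcases mul_eq_zero.1 h3 with h4 | h4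
    · rcases mul_eq_zero.1 h4 with h5 | h5
      · exact absurd h5 hp.ne'
      · exact h5
    · exact absurd h4 hq.ne'
  · have h2 := congrArg (WithLp.fstL 2 ℝ (EuclideanSpace ℝ (Fin n)) ℝ) h
    rw [map_sum] at h2
    simp only [map_smul] at h2
    have h3 : ∑ i, (Real.sqrt (n / (n + 1)) * ⟪w i, x⟫) • (Real.sqrt (n / (n + 1)) • w i) = x := h2
    have h4 : ∑ i, (Real.sqrt (n / (n + 1)) * ⟪w i, x⟫) • (Real.sqrt (n / (n + 1)) • w i)
        = ((n:ℝ) / (n + 1)) • ∑ i, ⟪w i, x⟫ • w i := by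
      rw [Finset.smul_sum]
      refine Finset.sum_congr rfl fun i _ => ?_
      rw [smul_smul, smul_smul]; congr 1; linear_combination ⟪w i, x⟫ * h1
    rw [h4] at h3
    nth_rewrite 2 [← h3]
    rw [smul_smul]
    rw [show ((n:ℝ) + 1) / n * (n / (n + 1)) = 1 by field_simp, one_smul]

def Dl (w : Fin (n + 1) → EuclideanSpace ℝ (Fin n)) : Set (EuclideanSpace ℝ (Fin n)) :=
  polarSet (convexHull ℝ (range w))

lemma mem_Dl {x : EuclideanSpace ℝ (Fin n)} : x ∈ Dl w ↔ ∀ i, ⟪w i, x⟫ ≤ 1 := by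
  constructor
  · intro h i
    rw [real_inner_comm]
    exact h _ (subset_convexHull ℝ _ ⟨i, rfl⟩)
  · intro h y hy
    have hc : Convex ℝ {y : EuclideanSpace ℝ (Fin n) | ⟪x, y⟫ ≤ 1} := by
      intro a ha b hb s t hs ht hst
      simp only [mem_ofPred_eq, inner_add_right, inner_smul_right] at *
      nlinarith
    exact convexHull_min (by rintro _ ⟨i, rfl⟩; simpa [real_inner_comm] using h i) hc hy

lemma simplex_JD (hw : IsRegVerts w) (hn : 1 ≤ n) :
    JD (Dl w) w (fun _ => 1 / ((n:ℝ) + 1)) := by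
  have hn' : (0:ℝ) < n := by exact_mod_cast hn
  refine ⟨hw.1, fun i => by positivity, ?_, ?_, ?_, fun i x hx => mem_Dl.1 hx i⟩
  · simp; field_simp
  · refine ext_inner_right ℝ fun x => ?_
    rw [sum_inner]
    simp only [inner_smul_left, ← Finset.mul_sum, (simplex_id hw hn x).1]
    simp
  · intro x
    have := (simplex_id hw hn x).2
    simp only [← smul_smul, ← Finset.smul_sum, this]
    rw [smul_smul]; congr 1; field_simp

lemma vert_mem (hw : IsRegVerts w) (hn : 1 ≤ n) (i : Fin (n + 1)) : (-(n:ℝ)) • w i ∈ Dl w := by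
  have hn' : (0:ℝ) < n := by exact_mod_cast hn
  rw [mem_Dl]; intro j
  rw [inner_smul_right]
  by_cases h : j = i
  · subst h; rw [real_inner_self_eq_norm_sq, hw.1]; nlinarith
  · rw [hw.2 j i h]; field_simp; simp

lemma Dl_ne (hw : IsRegVerts w) (hn : 1 ≤ n) : (Dl w).Nonempty := ⟨_, vert_mem hw hn 0⟩

lemma Dl_sub (hw : IsRegVerts w) (hn : 1 ≤ n) : Dl w ⊆ closedBall 0 n := (simplex_JD hw hn).sub hn

lemma HH_Dl (hw : IsRegVerts w) (hn : 1 ≤ n) (i : Fin (n + 1)) (y : FF n) :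
    ⟪lift (w i), y⟫ ≤ HH (Dl w) y := by
  have hn' : (0:ℝ) < n := by exact_mod_cast hn
  have h := le_suppFn (Dl_sub hw hn) (x := -y.fst) (vert_mem hw hn i)
  rw [inner_neg_left, inner_smul_right, real_inner_comm] at h
  rw [inner_lift]; unfold HH
  have e1 : Real.sqrt (n / (n + 1)) = 1 / (n + 1) * (Real.sqrt ((n + 1) / n) * n) := by
    rw [Real.sqrt_div (by positivity), Real.sqrt_div (by positivity)]
    have ha := Real.mul_self_sqrt (show (0:ℝ) ≤ n + 1 by positivity)
    have hb := Real.mul_self_sqrt hn'.le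
    have ha' : 0 < Real.sqrt ((n:ℝ) + 1) := by positivity
    have hb' : 0 < Real.sqrt (n:ℝ) := by positivity
    rw [one_div_mul_eq_div, div_mul_eq_mul_div, div_div, div_eq_div_iff (by positivity) (by positivity)]
    linear_combination ((n:ℝ) + 1) * hb - (n:ℝ) * ha
  have e2 : 1 / Real.sqrt ((n:ℝ) + 1) = 1 / (n + 1) * Real.sqrt (n + 1) := by
    have ha := Real.mul_self_sqrt (show (0:ℝ) ≤ n + 1 by positivity)
    have ha' : 0 < Real.sqrt ((n:ℝ) + 1) := by positivity
    rw [one_div_mul_eq_div, div_eq_div_iff (by positivity) (by positivity)]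
    linarith
  rw [e1, e2]
  have : 0 ≤ 1 / ((n:ℝ) + 1) * Real.sqrt ((n + 1) / n) := by positivity
  nlinarith

variable {ι : Type*} [Fintype ι] {K : Set (EuclideanSpace ℝ (Fin n))}
  {u : ι → EuclideanSpace ℝ (Fin n)} {p : ι → ℝ}

def EK (n : ℕ) (u : ι → EuclideanSpace ℝ (Fin n)) (p : ι → ℝ) : ℝ :=
  Ed (fun i => lift (u i)) (fun i => ((n:ℝ) + 1) * p i)

lemma prob_Dl (hw : IsRegVerts w) (hn : 1 ≤ n) (l : ℝ) :
    (stdGaussian (FF n)).real {y | HH (Dl w) y ≤ l} ≤ Phi l ^ (n + 1) := by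
  obtain ⟨b, hb⟩ := simplex_basis hw hn
  have h := g_basis_event b (fun _ => Iic l) (fun _ => measurableSet_Iic)
  have e : Phi l ^ (n + 1) = ∏ _i : Fin (n + 1), (gaussianReal 0 1).real (Iic l) := by
    simp [Phi]
  rw [e, ← h]
  refine measureReal_mono ?_ (measure_ne_top _ _)
  intro y hy i
  rw [hb]
  exact (HH_Dl hw hn i y).trans hy

lemma prob_K (h : JD K u p) (hn : 1 ≤ n) (hne : K.Nonempty) (l : ℝ) :
    Phi l ^ (n + 1) * (1 + (∫ z, Df (fun i => lift (u i)) (fun i => ((n:ℝ) + 1) * p i) l z ∂(stdGaussian (FF n))) / 2)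
      ≤ (stdGaussian (FF n)).real {y | HH K y ≤ l} := by
  have := barthe (h.frame hn) l
  rw [FF_finrank] at this
  refine this.trans (measureReal_mono ?_ (measure_ne_top _ _))
  rintro _ ⟨z, rfl⟩
  exact HH_Th h hn hne l z

lemma gap (h : JD K u p) (hw : IsRegVerts w) (hn : 1 ≤ n) (hne : K.Nonempty) :
    1 / ((n:ℝ) + 1) * Real.sqrt ((n + 1) / n) * bG K +
      (1 / 32) ^ (n + 1) * ((1 / 2 ^ 24) ^ 2 * EK n u p ^ 2 / (80 * (n + 1)) / 2)
      ≤ 1 / ((n:ℝ) + 1) * Real.sqrt ((n + 1) / n) * bG (Dl w) := by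
  rw [← HH_mean hne (h.sub hn), ← HH_mean (Dl_ne hw hn) (Dl_sub hw hn)]
  refine compare _ _ _ (HH_int hne (h.sub hn)) (HH_int (Dl_ne hw hn) (Dl_sub hw hn))
    (HH_meas hne (h.sub hn)) (HH_meas (Dl_ne hw hn) (Dl_sub hw hn)) _ (by positivity) ?_ ?_
  · intro l
    refine (prob_Dl hw hn l).trans (le_trans ?_ (prob_K h hn hne l))
    refine le_mul_of_one_le_right (pow_nonneg (Phi_pos l).le _) ?_
    have : 0 ≤ ∫ z, Df (fun i => lift (u i)) (fun i => ((n:ℝ) + 1) * p i) l z ∂(stdGaussian (FF n)) :=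
      integral_nonneg fun z => Df_nonneg (h.frame hn) l z
    linarith
  · intro l hl
    refine le_trans ?_ (prob_K h hn hne l)
    have h1 := prob_Dl hw hn l
    have h2 := Df_lower (h.frame hn) l (by rw [FF_finrank]; omega)
    rw [FF_finrank] at h2
    push_cast at h2
    have ha := aH_upper hl.2 hl.1
    have h3 : (1 / 2 ^ 24 : ℝ) ^ 2 ≤ aH l ^ 2 := by
      rw [← neg_sq (aH l)]
      exact pow_le_pow_left₀ (by positivity) (by linarith) 2
    have hP : (1 / 32 : ℝ) ^ (n + 1) ≤ Phi l ^ (n + 1) :=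
      pow_le_pow_left₀ (by norm_num) (Phi_neg_one_lower.trans (Phi_strictMono.monotone hl.1)) _
    have h4 : (1 / 2 ^ 24 : ℝ) ^ 2 * EK n u p ^ 2 / (80 * (n + 1)) / 2 ≤
      (∫ z, Df (fun i => lift (u i)) (fun i => ((n:ℝ) + 1) * p i) l z ∂(stdGaussian (FF n))) / 2 := by
      refine div_le_div_of_nonneg_right (le_trans ?_ h2) (by norm_num)
      unfold EK
      gcongr
    have h5 := mul_le_mul hP h4 (by positivity) (pow_nonneg (Phi_pos l).le _)
    rw [mul_add (Phi l ^ (n + 1)), mul_one]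
    exact add_le_add h1 h5

lemma bG_zero_le (hne : K.Nonempty) {R : ℝ} (hK : K ⊆ closedBall 0 R) : 0 ≤ bG K := by
  have hb := bG_iso (K := K) (LinearIsometryEquiv.neg ℝ)
  have hc2 : Continuous (fun x => suppFn K (-x)) := (suppFn_cont hne hK).comp continuous_neg
  have hi : Integrable (fun x => suppFn K (-x)) (stdGaussian (EuclideanSpace ℝ (Fin n))) :=
    Integrable.mono' (g_norm_int.const_mul R) hc2.aestronglyMeasurable
      (ae_of_all _ fun x => by simpa using suppFn_abs hne hK (-x))
  have h2 : 0 ≤ ∫ x, (suppFn K x + suppFn K (-x)) ∂(stdGaussian (EuclideanSpace ℝ (Fin n))) := by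
    refine integral_nonneg fun x => ?_
    have := suppFn_add_le hne hK x (-x)
    rw [add_neg_cancel, suppFn_zero hne] at this
    exact this
  rw [integral_add (suppFn_int hne hK) hi] at h2
  have hb' : ∫ x, suppFn K (-x) ∂(stdGaussian (EuclideanSpace ℝ (Fin n))) = bG K := hb
  rw [hb'] at h2
  change 0 ≤ bG K + bG K at h2
  linarith

/-- the energy estimate -/
lemma energy (h : JD K u p) (hw : IsRegVerts w) (hn : 1 ≤ n) (hne : K.Nonempty) {ε : ℝ} (hε : 0 < ε)
    (hb : (1 - ε) * bG (Dl w) ≤ bG K) :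
    EK n u p ^ 2 ≤ ε * (n * (160 * (n + 1)) * 32 ^ (n + 1) * 2 ^ 48) := by
  have hn' : (0:ℝ) < n := by exact_mod_cast hn
  have h1 := gap h hw hn hne
  have h2 := bG_le (Dl_ne hw hn) (Dl_sub hw hn)
  set c := 1 / ((n:ℝ) + 1) * Real.sqrt ((n + 1) / n) with hc
  have hc0 : 0 ≤ c := by positivity
  have h3 : (1 / 32 : ℝ) ^ (n + 1) * ((1 / 2 ^ 24) ^ 2 * EK n u p ^ 2 / (80 * (n + 1)) / 2) ≤
      c * (ε * (n * Real.sqrt n)) := by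
    have : bG (Dl w) - bG K ≤ ε * (n * Real.sqrt n) := by nlinarith
    nlinarith
  have h4 : c * (n * Real.sqrt n) ≤ n := by
    rw [hc, Real.sqrt_div (by positivity)]
    have ha : Real.sqrt ((n:ℝ) + 1) ≤ n + 1 := by
      rw [Real.sqrt_le_left (by positivity)]; nlinarith
    have hb' : 0 < Real.sqrt (n:ℝ) := by positivity
    calc 1 / ((n:ℝ) + 1) * (Real.sqrt (n + 1) / Real.sqrt n) * (n * Real.sqrt n)
        = n * (Real.sqrt (n + 1) / (n + 1)) := by field_simp
      _ ≤ n * 1 := by gcongr; rw [div_le_one (by positivity)]; exact ha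
      _ = n := mul_one _
  have h5 : (1 / 32 : ℝ) ^ (n + 1) * ((1 / 2 ^ 24) ^ 2 * EK n u p ^ 2 / (80 * (n + 1)) / 2) ≤ ε * n := by
    nlinarith
  have h6 : (1 / 32 : ℝ) ^ (n + 1) * ((1 / 2 ^ 24) ^ 2 * EK n u p ^ 2 / (80 * (n + 1)) / 2)
      = EK n u p ^ 2 / (160 * (n + 1) * 32 ^ (n + 1) * 2 ^ 48) := by
    rw [one_div_pow]; field_simp; ring
  rw [h6, div_le_iff₀ (by positivity)] at h5
  nlinarith

end simplex

end JMW

namespace JMW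

open ProbabilityTheory Filter Topology

section john

lemma hull_compact {V : Type*} [NormedAddCommGroup V] [NormedSpace ℝ V] [FiniteDimensional ℝ V]
    {S : Set V} (hS : IsCompact S) : IsCompact (convexHull ℝ S) := by
  rcases S.eq_empty_or_nonempty with h0 | ⟨z0, hz0⟩
  · subst h0; simp
  set d := Module.finrank ℝ V + 1 with hd
  have hc : IsCompact ((stdSimplex ℝ (Fin d)) ×ˢ (Set.pi univ fun _ : Fin d => S)) :=
    (isCompact_stdSimplex ℝ (Fin d)).prod (isCompact_univ_pi fun _ => hS)
  have he : convexHull ℝ S = (fun q : (Fin d → ℝ) × (Fin d → V) => ∑ i, q.1 i • q.2 i) ''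
      ((stdSimplex ℝ (Fin d)) ×ˢ (Set.pi univ fun _ : Fin d => S)) := by
    apply Subset.antisymm
    · intro x hx
      obtain ⟨ι, hι, z, w, hz, haff, hw, hw1, hx⟩ := eq_pos_convex_span_of_mem_convexHull hx
      have hcard : Fintype.card ι ≤ Fintype.card (Fin d) := by
        rw [Fintype.card_fin, hd]
        exact haff.card_le_finrank_succ.trans (Nat.succ_le_succ (Submodule.finrank_le _))
      obtain ⟨f⟩ := Function.Embedding.nonempty_of_card_le hcard
      have fi := f.injective
      refine ⟨(Function.extend f w 0, Function.extend f z (fun _ => z0)), ⟨⟨?_, ?_⟩, ?_⟩, ?_⟩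
      · intro j
        by_cases hj : ∃ i, f i = j
        · obtain ⟨i, rfl⟩ := hj
          simp only [fi.extend_apply]; exact (hw i).le
        · simp [Function.extend_apply' _ _ _ hj]
      · rw [← hw1]; symm
        refine Finset.sum_of_injOn f (fi.injOn) (by simp) ?_ ?_
        · intro j _ hj
          refine Function.extend_apply' _ _ _ ?_
          rintro ⟨i, rfl⟩; exact hj (by simp)
        · intro i _; simp [fi.extend_apply]
      · intro j _
        by_cases hj : ∃ i, f i = j
        · obtain ⟨i, rfl⟩ := hj
          simp only [fi.extend_apply]; exact hz ⟨i, rfl⟩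
        · simpa [Function.extend_apply' _ _ _ hj] using hz0
      · rw [← hx]; symm
        refine Finset.sum_of_injOn f (fi.injOn) (by simp) ?_ ?_
        · intro j _ hj
          have : ¬ ∃ i, f i = j := by
            rintro ⟨i, rfl⟩; exact hj (by simp)
          simp [Function.extend_apply' _ _ _ this]
        · intro i _; simp [fi.extend_apply]
    · rintro _ ⟨⟨w, z⟩, ⟨⟨hw0, hw1⟩, hz⟩, rfl⟩
      exact (convex_convexHull ℝ S).sum_mem (fun i _ => hw0 i) hw1
        fun i _ => subset_convexHull ℝ S (hz i (mem_univ i))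
  rw [he]
  exact hc.image (by fun_prop)

variable {n : ℕ}

/-- contact points -/
def Ct (K : Set (EuclideanSpace ℝ (Fin n))) : Set (EuclideanSpace ℝ (Fin n)) :=
  {u | ‖u‖ = 1 ∧ ∀ x ∈ K, ⟪u, x⟫ ≤ 1}

lemma Ct_compact (K : Set (EuclideanSpace ℝ (Fin n))) : IsCompact (Ct K) := by
  have : Ct K = sphere 0 1 ∩ ⋂ x ∈ K, {u | ⟪u, x⟫ ≤ 1} := by
    ext u; simp [Ct]
  rw [this]
  refine (isCompact_sphere 0 1).inter_right (isClosed_biInter fun x _ => ?_)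
  exact isClosed_le (by fun_prop) continuous_const

variable {K : Set (EuclideanSpace ℝ (Fin n))}

/-- perturbed ellipsoids stay inside -/
lemma pert_sub (hK : IsCompact K) (hKc : Convex ℝ K) (hB : closedBall 0 1 ⊆ K)
    (M : EuclideanSpace ℝ (Fin n) →L[ℝ] EuclideanSpace ℝ (Fin n)) (b : EuclideanSpace ℝ (Fin n))
    (hneg : ∀ u ∈ Ct K, ⟪u, M u + b⟫ < 0) :
    ∀ᶠ t in 𝓝[>] (0:ℝ), ∀ z ∈ closedBall (0 : EuclideanSpace ℝ (Fin n)) 1, z + t • (M z + b) ∈ K := by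
  by_contra hcon
  rw [not_eventually] at hcon
  obtain ⟨t, ht, hbad⟩ := exists_seq_forall_of_frequently hcon
  push Not at hbad
  choose z hz hzK using hbad
  have hsep : ∀ k, ∃ v : EuclideanSpace ℝ (Fin n), ‖v‖ = 1 ∧
      ∀ x ∈ K, ⟪v, x⟫ < ⟪v, z k + t k • (M (z k) + b)⟫ := by
    intro k
    obtain ⟨f, s, h1, h2⟩ := geometric_hahn_banach_closed_point hKc hK.isClosed (hzK k)
    set a := (InnerProductSpace.toDual ℝ (EuclideanSpace ℝ (Fin n))).symm f with ha
    have ha' : ∀ x, ⟪a, x⟫ = f x := fun x => InnerProductSpace.toDual_symm_apply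
    have ha0 : 0 < ‖a‖ := by
      rw [norm_pos_iff]; rintro h0
      have e1 := ha' 0
      have e2 := ha' (z k + t k • (M (z k) + b))
      have := h1 0 (hB (by simp))
      rw [h0] at e1 e2
      simp only [inner_zero_left] at e1 e2
      rw [← e1] at this; rw [← e2] at h2; linarith
    refine ⟨‖a‖⁻¹ • a, ?_, fun x hx => ?_⟩
    · rw [norm_smul, norm_inv, norm_norm, inv_mul_cancel₀ ha0.ne']
    · rw [real_inner_smul_left, real_inner_smul_left]
      refine mul_lt_mul_of_pos_left ?_ (inv_pos.2 ha0)
      rw [ha', ha']; exact (h1 x hx).trans h2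
  choose v hv hvK using hsep
  have hcomp : IsCompact ((sphere (0 : EuclideanSpace ℝ (Fin n)) 1) ×ˢ closedBall (0 : EuclideanSpace ℝ (Fin n)) 1) :=
    (isCompact_sphere 0 1).prod (isCompact_closedBall 0 1)
  obtain ⟨⟨v0, z0⟩, ⟨hv0, hz0⟩, φ, hφ, hlim⟩ := hcomp.tendsto_subseq (x := fun k => (v k, z k))
    (fun k => ⟨by simpa using hv k, hz k⟩)
  have hlv : Tendsto (fun k => v (φ k)) atTop (𝓝 v0) := (continuous_fst.tendsto _).comp hlim
  have hlz : Tendsto (fun k => z (φ k)) atTop (𝓝 z0) := (continuous_snd.tendsto _).comp hlim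
  have ht' := (tendsto_nhdsWithin_iff.1 ht)
  have hlt : Tendsto (fun k => t (φ k)) atTop (𝓝 0) := ht'.1.comp hφ.tendsto_atTop
  have hpos : ∀ᶠ k in atTop, 0 < t (φ k) := hφ.tendsto_atTop.eventually ht'.2
  have hly : Tendsto (fun k => z (φ k) + t (φ k) • (M (z (φ k)) + b)) atTop (𝓝 (z0 + (0:ℝ) • (M z0 + b))) :=
    hlz.add (hlt.smul (((M.continuous.tendsto _).comp hlz).add tendsto_const_nhds))
  rw [zero_smul, add_zero] at hly
  have hv0n : ‖v0‖ = 1 := by simpa using hv0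
  have hz0n : ‖z0‖ ≤ 1 := by simpa using hz0
  have hle : ∀ x ∈ K, ⟪v0, x⟫ ≤ ⟪v0, z0⟫ := fun x hx =>
    le_of_tendsto_of_tendsto' (hlv.inner tendsto_const_nhds) (hlv.inner hly) fun k => (hvK (φ k) x hx).le
  have h1 : 1 ≤ ⟪v0, z0⟫ := by
    have := hle v0 (hB (by simp [hv0n]))
    rwa [real_inner_self_eq_norm_sq, hv0n, one_pow] at this
  have hzv : z0 = v0 := by
    have : ‖v0 - z0‖ ^ 2 ≤ 0 := by
      rw [norm_sub_sq_real, hv0n]; nlinarith [norm_nonneg z0]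
    have h2 : ‖v0 - z0‖ = 0 := by nlinarith [norm_nonneg (v0 - z0)]
    exact (sub_eq_zero.1 (norm_eq_zero.1 h2)).symm
  have hCt : v0 ∈ Ct K := by
    refine ⟨hv0n, fun x hx => (hle x hx).trans ?_⟩
    rw [hzv, real_inner_self_eq_norm_sq, hv0n, one_pow]
  have hge : 0 ≤ ⟪v0, M v0 + b⟫ := by
    have hl : Tendsto (fun k => ⟪v (φ k), M (z (φ k)) + b⟫) atTop (𝓝 ⟪v0, M z0 + b⟫) :=
      hlv.inner (((M.continuous.tendsto _).comp hlz).add tendsto_const_nhds)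
    rw [hzv] at hl
    refine ge_of_tendsto hl ?_
    filter_upwards [hpos] with k hk
    have h3 := hvK (φ k) (v (φ k)) (hB (by simp [hv]))
    rw [real_inner_self_eq_norm_sq, hv, inner_add_right, real_inner_smul_right] at h3
    have h4 := real_inner_le_norm (v (φ k)) (z (φ k))
    have h5 : ‖z (φ k)‖ ≤ 1 := by simpa using hz (φ k)
    rw [hv] at h4
    by_contra hc
    push Not at hc
    nlinarith
  linarith [hneg v0 hCt]

lemma det_pert (M : EuclideanSpace ℝ (Fin n) →ₗ[ℝ] EuclideanSpace ℝ (Fin n))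
    (hM : 0 < LinearMap.trace ℝ _ M) :
    ∀ᶠ t in 𝓝[>] (0:ℝ), 1 < LinearMap.det (1 + t • M) := by
  set b := (EuclideanSpace.basisFun (Fin n) ℝ).toBasis
  set A := LinearMap.toMatrix b b M with hA
  have htr : 0 < A.trace := by rwa [hA, ← LinearMap.trace_eq_matrix_trace]
  have hdet : ∀ t : ℝ, LinearMap.det (1 + t • M) = (1 + t • A).det := by
    intro t
    rw [← LinearMap.det_toMatrix b, map_add, map_smul, LinearMap.toMatrix_one]
  set P := (1 + (Polynomial.X : Polynomial ℝ) • A.map Polynomial.C).det.divX.divX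
  have hlim : Tendsto (fun t : ℝ => A.trace + P.eval t * t) (𝓝[>] 0) (𝓝 (A.trace + P.eval 0 * 0)) :=
    ((continuous_const.add (P.continuous.mul continuous_id)).tendsto 0).mono_left nhdsWithin_le_nhds
  have hev : ∀ᶠ t in 𝓝[>] (0:ℝ), 0 < A.trace + P.eval t * t :=
    hlim.eventually (lt_mem_nhds (by simpa using htr))
  filter_upwards [hev, self_mem_nhdsWithin] with t h1 h2
  rw [hdet, Matrix.det_one_add_smul]
  have h3 : 0 < t := h2
  have : 0 < t * (A.trace + P.eval t * t) := mul_pos h3 h1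
  change 1 < 1 + A.trace * t + P.eval t * t ^ 2
  linarith

/-- John: no improving direction -/
lemma no_dir (hK : IsCompact K) (hKc : Convex ℝ K) (hJ : IsJohnEllipsoid (closedBall 0 1) K)
    (M : EuclideanSpace ℝ (Fin n) →ₗ[ℝ] EuclideanSpace ℝ (Fin n)) (b : EuclideanSpace ℝ (Fin n))
    (hneg : ∀ u ∈ Ct K, ⟪u, M u + b⟫ < 0) (hM : 0 < LinearMap.trace ℝ _ M) : False := by
  obtain ⟨-, hB, hmax⟩ := hJ
  have h1 := pert_sub hK hKc hB (LinearMap.toContinuousLinearMap M) b hneg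
  obtain ⟨t, ht1, ht2⟩ := (h1.and (det_pert M hM)).exists
  set L := LinearMap.equivOfDetNeZero (1 + t • M) (by linarith) with hL
  have hLx : ∀ x, L x = x + t • M x := fun x => rfl
  set f : EuclideanSpace ℝ (Fin n) ≃ᵃ[ℝ] EuclideanSpace ℝ (Fin n) :=
    L.toAffineEquiv.trans (AffineEquiv.constVAdd ℝ _ (t • b)) with hf
  have hfx : ∀ x, f x = t • b + (1 + t • M) x := fun x => rfl
  have h2 := hmax (f '' closedBall 0 1) ⟨f, rfl⟩ (by
    rintro _ ⟨z, hz, rfl⟩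
    have := ht1 z hz
    rw [hfx]
    convert this using 1
    simp only [LinearMap.add_apply, Module.End.one_apply, LinearMap.smul_apply, smul_add,
      LinearMap.coe_toContinuousLinearMap']
    abel)
  have himg : f '' closedBall 0 1 = (fun x => t • b + x) '' (⇑(1 + t • M : EuclideanSpace ℝ (Fin n) →ₗ[ℝ] EuclideanSpace ℝ (Fin n)) '' closedBall 0 1) := by
    rw [image_image]; exact image_congr fun x _ => hfx x
  rw [himg, image_add_left, measure_preimage_add, Measure.addHaar_image_linearMap,
    abs_of_pos (by linarith)] at h2
  have hv0 : volume (closedBall (0 : EuclideanSpace ℝ (Fin n)) 1) ≠ 0 :=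
    (measure_closedBall_pos _ _ one_pos).ne'
  have hvt : volume (closedBall (0 : EuclideanSpace ℝ (Fin n)) 1) ≠ ∞ :=
    (isCompact_closedBall _ _).measure_lt_top.ne
  have h3 : ENNReal.ofReal (LinearMap.det (1 + t • M)) ≤ 1 := by
    have h4 : ENNReal.ofReal (LinearMap.det (1 + t • M)) * volume (closedBall (0 : EuclideanSpace ℝ (Fin n)) 1)
      ≤ 1 * volume (closedBall (0 : EuclideanSpace ℝ (Fin n)) 1) := by rwa [one_mul]
    exact (ENNReal.mul_le_mul_iff_left hv0 hvt).1 h4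
  rw [ENNReal.ofReal_le_one] at h3
  linarith

lemma john (hn : 1 ≤ n) (hK : IsCompact K) (hKc : Convex ℝ K) (hJ : IsJohnEllipsoid (closedBall 0 1) K) :
    ∃ (ι : Type) (_ : Fintype ι) (u : ι → EuclideanSpace ℝ (Fin n)) (p : ι → ℝ), JD K u p := by
  have hn' : (0:ℝ) < n := by exact_mod_cast hn
  set Ψ : EuclideanSpace ℝ (Fin n) →
      (EuclideanSpace ℝ (Fin n) →L[ℝ] EuclideanSpace ℝ (Fin n)) × EuclideanSpace ℝ (Fin n) :=
    fun u => ((innerSL ℝ u).smulRight u, u) with hΨ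
  have hΨc : Continuous Ψ := by
    refine Continuous.prodMk ?_ continuous_id
    exact ((ContinuousLinearMap.smulRightL ℝ (EuclideanSpace ℝ (Fin n)) (EuclideanSpace ℝ (Fin n))).continuous.comp
      (innerSL ℝ).continuous).clm_apply continuous_id
  have hmem : (((1 / (n:ℝ)) • ContinuousLinearMap.id ℝ (EuclideanSpace ℝ (Fin n)), 0) :
      (EuclideanSpace ℝ (Fin n) →L[ℝ] EuclideanSpace ℝ (Fin n)) × EuclideanSpace ℝ (Fin n))
      ∈ convexHull ℝ (Ψ '' Ct K) := by
    by_contra hnot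
    obtain ⟨f, s, h1, h2⟩ := geometric_hahn_banach_closed_point (convex_convexHull ℝ _)
      (hull_compact ((Ct_compact K).image hΨc)).isClosed hnot
    set f1 : (EuclideanSpace ℝ (Fin n) →L[ℝ] EuclideanSpace ℝ (Fin n)) →L[ℝ] ℝ :=
      f.comp (ContinuousLinearMap.inl ℝ _ _) with hf1
    set f2 : EuclideanSpace ℝ (Fin n) →L[ℝ] ℝ := f.comp (ContinuousLinearMap.inr ℝ _ _) with hf2
    have hf : ∀ A b, f (A, b) = f1 A + f2 b := by
      intro A b
      rw [hf1, hf2, ContinuousLinearMap.comp_apply, ContinuousLinearMap.comp_apply, ← map_add]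
      simp
    set e := EuclideanSpace.basisFun (Fin n) ℝ
    set M0 : EuclideanSpace ℝ (Fin n) →ₗ[ℝ] EuclideanSpace ℝ (Fin n) :=
      { toFun := fun x => ∑ j, f1 ((innerSL ℝ (e j)).smulRight x) • e j
        map_add' := by
          intro x y
          rw [← Finset.sum_add_distrib]
          refine Finset.sum_congr rfl fun j _ => ?_
          have : (innerSL ℝ (e j)).smulRight (x + y) = (innerSL ℝ (e j)).smulRight x + (innerSL ℝ (e j)).smulRight y := by
            ext1 z; simp
          rw [this, map_add, add_smul]
        map_smul' := by
          intro c x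
          rw [Finset.smul_sum]
          refine Finset.sum_congr rfl fun j _ => ?_
          have : (innerSL ℝ (e j)).smulRight (c • x) = c • (innerSL ℝ (e j)).smulRight x := by
            ext1 z; exact smul_comm (⟪e j, z⟫ : ℝ) c x
          rw [this, map_smul, smul_assoc]; rfl } with hM0
    have hM0x : ∀ x, M0 x = ∑ j, f1 ((innerSL ℝ (e j)).smulRight x) • e j := fun x => rfl
    have hq : ∀ x, ⟪x, M0 x⟫ = f1 ((innerSL ℝ x).smulRight x) := by
      intro x
      rw [hM0x, inner_sum]
      have : (innerSL ℝ x).smulRight x = ∑ j, ⟪x, e j⟫ • (innerSL ℝ (e j)).smulRight x := by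
        ext1 y
        simp only [_root_.sum_apply, _root_.smul_apply,
          ContinuousLinearMap.smulRight_apply, innerSL_apply_apply, smul_smul, ← Finset.sum_smul]
        rw [e.sum_inner_mul_inner]
      rw [this, map_sum]
      refine Finset.sum_congr rfl fun j _ => ?_
      rw [map_smul, real_inner_smul_right, smul_eq_mul, mul_comm]
    have htr0 : LinearMap.trace ℝ _ M0 = f1 (ContinuousLinearMap.id ℝ _) := by
      rw [LinearMap.trace_eq_sum_inner M0 e]
      simp only [hq]
      rw [← map_sum]
      congr 1
      ext1 y
      simp only [_root_.sum_apply,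
          ContinuousLinearMap.smulRight_apply, innerSL_apply_apply]
      exact e.sum_repr' y
    set b := (InnerProductSpace.toDual ℝ (EuclideanSpace ℝ (Fin n))).symm f2 with hb
    have hb' : ∀ x, ⟪x, b⟫ = f2 x := fun x => by
      rw [real_inner_comm]; exact InnerProductSpace.toDual_symm_apply
    refine no_dir hK hKc hJ (M0 - s • 1) b ?_ ?_
    · intro u hu
      have h3 := h1 (Ψ u) (subset_convexHull ℝ _ ⟨u, hu, rfl⟩)
      rw [hΨ] at h3
      simp only [hf] at h3
      rw [LinearMap.sub_apply, inner_add_right, inner_sub_right, hq, hb', LinearMap.smul_apply,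
        Module.End.one_apply, real_inner_smul_right, real_inner_self_eq_norm_sq, hu.1]
      linarith
    · rw [map_sub, map_smul, htr0, LinearMap.trace_one]
      rw [hf, map_smul, map_zero, add_zero, smul_eq_mul, one_div_mul_eq_div, lt_div_iff₀ hn'] at h2
      simp; linarith
  obtain ⟨ι, hι, p, z, hp0, hp1, hz, hsum⟩ := mem_convexHull_iff_exists_fintype.1 hmem
  choose u hu huz using hz
  have hc := congrArg Prod.snd hsum
  have hi := congrArg Prod.fst hsum
  simp only [← huz, hΨ, Prod.snd_sum, Prod.smul_snd, Prod.fst_sum, Prod.smul_fst] at hc hi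
  refine ⟨ι, hι, u, p, fun i => (hu i).1, hp0, hp1, hc, fun x => ?_, fun i => (hu i).2⟩
  have := congrArg (fun A : EuclideanSpace ℝ (Fin n) →L[ℝ] EuclideanSpace ℝ (Fin n) => A x) hi
  simpa [_root_.sum_apply, smul_smul] using this

end john

end JMW

namespace JMW

open ProbabilityTheory Filter Topology

section select

variable {F : Type*} [NormedAddCommGroup F] [InnerProductSpace ℝ F]
  {ι : Type*} [Fintype ι] {v : ι → F} {d : ι → ℝ}

/-- row energy -/
def er (v : ι → F) (d : ι → ℝ) (i : ι) : ℝ := ∑ j, d j * (⟪v i, v j⟫ ^ 2 * (1 - ⟪v i, v j⟫))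

lemma inner_abs (h : Frame v d) (i j : ι) : |⟪v i, v j⟫| ≤ 1 := by
  have := abs_real_inner_le_norm (v i) (v j)
  rwa [h.unit, h.unit, one_mul] at this

lemma er_nonneg (h : Frame v d) (i : ι) : 0 ≤ er v d i := by
  refine Finset.sum_nonneg fun j _ => mul_nonneg (h.nonneg j) (mul_nonneg (sq_nonneg _) ?_)
  linarith [(abs_le.1 (inner_abs h i j)).2]

lemma Ed_eq : Ed v d = ∑ i, d i * er v d i := rfl

lemma Ed_nonneg (h : Frame v d) : 0 ≤ Ed v d := by
  rw [Ed_eq]; exact Finset.sum_nonneg fun i _ => mul_nonneg (h.nonneg i) (er_nonneg h i)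

lemma select_step (h : Frame v d) (k : ℕ) (hk : k < Module.finrank ℝ F) (f : ℕ → ι) :
    ∃ i, er v d i + ∑ l ∈ Finset.range k, ⟪v i, v (f l)⟫ ^ 2 ≤
      Ed v d + 2 * ∑ l ∈ Finset.range k, er v d (f l) := by
  by_contra hcon
  push Not at hcon
  set C := Ed v d + 2 * ∑ l ∈ Finset.range k, er v d (f l) with hC
  set W : ι → ℝ := fun i => max (1 - ∑ l ∈ Finset.range k, ⟪v i, v (f l)⟫ ^ 2) 0 with hW
  have hW0 : ∀ i, 0 ≤ W i := fun i => le_max_right _ _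
  have hW1 : ∀ i, W i ≤ 1 := fun i => max_le (by
    have : 0 ≤ ∑ l ∈ Finset.range k, ⟪v i, v (f l)⟫ ^ 2 := Finset.sum_nonneg fun l _ => sq_nonneg _
    linarith) zero_le_one
  have hC0 : 0 ≤ C := by
    have : 0 ≤ ∑ l ∈ Finset.range k, er v d (f l) := Finset.sum_nonneg fun l _ => er_nonneg h _
    linarith [Ed_nonneg h]
  have hsumW : 1 ≤ ∑ i, d i * W i := by
    have h1 : ∑ i, d i * (1 - ∑ l ∈ Finset.range k, ⟪v i, v (f l)⟫ ^ 2) ≤ ∑ i, d i * W i :=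
      Finset.sum_le_sum fun i _ => mul_le_mul_of_nonneg_left (le_max_left _ _) (h.nonneg i)
    have h2 : ∑ i, d i * (1 - ∑ l ∈ Finset.range k, ⟪v i, v (f l)⟫ ^ 2) = Module.finrank ℝ F - k := by
      simp only [mul_sub, mul_one, Finset.sum_sub_distrib, h.sum, Finset.mul_sum]
      rw [Finset.sum_comm]
      congr 1
      have : ∀ l ∈ Finset.range k, ∑ i, d i * ⟪v i, v (f l)⟫ ^ 2 = 1 := by
        intro l _; rw [h.sq, h.unit, one_pow]
      rw [Finset.sum_congr rfl this]; simp
    have h3 : (k:ℝ) + 1 ≤ Module.finrank ℝ F := by exact_mod_cast hk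
    linarith
  have hup : ∑ i, d i * W i * (er v d i + ∑ l ∈ Finset.range k, ⟪v i, v (f l)⟫ ^ 2) ≤ C := by
    simp only [mul_add, Finset.sum_add_distrib, hC, Finset.mul_sum]
    refine add_le_add ?_ ?_
    · rw [Ed_eq]
      refine Finset.sum_le_sum fun i _ => ?_
      exact mul_le_mul_of_nonneg_right (mul_le_of_le_one_right (h.nonneg i) (hW1 i)) (er_nonneg h i)
    · rw [Finset.sum_comm]
      refine Finset.sum_le_sum fun l hl => ?_
      unfold er
      rw [Finset.mul_sum]
      refine Finset.sum_le_sum fun i _ => ?_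
      have hr := inner_abs h i (f l)
      rw [real_inner_comm (v i) (v (f l))]
      set r := ⟪v i, v (f l)⟫ with hrd
      have hWr : W i ≤ 1 - r ^ 2 := by
        refine max_le ?_ ?_
        · have := Finset.single_le_sum (f := fun l => ⟪v i, v (f l)⟫ ^ 2) (fun l _ => sq_nonneg _) hl
          linarith
        · have := (sq_le_one_iff_abs_le_one r).2 hr; linarith
      have hr1 := (abs_le.1 hr)
      have h5 : W i * r ^ 2 ≤ 2 * (r ^ 2 * (1 - r)) := by
        calc W i * r ^ 2 ≤ (1 - r ^ 2) * r ^ 2 := mul_le_mul_of_nonneg_right hWr (sq_nonneg _)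
          _ = (1 + r) * (r ^ 2 * (1 - r)) := by ring
          _ ≤ _ := mul_le_mul_of_nonneg_right (by linarith) (mul_nonneg (sq_nonneg _) (by linarith))
      have := mul_le_mul_of_nonneg_left h5 (h.nonneg i)
      have e : r = ⟪v (f l), v i⟫ := real_inner_comm _ _
      nlinarith
  have hpos : 0 ≤ ∑ i, d i * W i * (er v d i + ∑ l ∈ Finset.range k, ⟪v i, v (f l)⟫ ^ 2 - C) :=
    Finset.sum_nonneg fun i _ => mul_nonneg (mul_nonneg (h.nonneg i) (hW0 i)) (by linarith [hcon i])
  have hle : ∑ i, d i * W i * (er v d i + ∑ l ∈ Finset.range k, ⟪v i, v (f l)⟫ ^ 2 - C) ≤ 0 := by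
    simp only [mul_sub, Finset.sum_sub_distrib, ← Finset.sum_mul]
    nlinarith
  have hz := (Finset.sum_eq_zero_iff_of_nonneg (fun i _ => mul_nonneg (mul_nonneg (h.nonneg i) (hW0 i))
    (by linarith [hcon i]))).1 (le_antisymm hle hpos)
  have : ∑ i, d i * W i = 0 := Finset.sum_eq_zero fun i hi => by
    rcases mul_eq_zero.1 (hz i hi) with h1 | h1
    · exact h1
    · linarith [hcon i]
  linarith

lemma select (h : Frame v d) (hN : 0 < Module.finrank ℝ F) (k : ℕ) (hk : k ≤ Module.finrank ℝ F) :
    ∃ f : ℕ → ι, ∀ m < k, er v d (f m) ≤ 3 ^ m * Ed v d ∧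
      ∀ l < m, ⟪v (f m), v (f l)⟫ ^ 2 ≤ 3 ^ m * Ed v d := by
  induction k with
  | zero =>
    have : Nonempty ι := by
      by_contra hne
      rw [not_nonempty_iff] at hne
      have := h.sum
      rw [Finset.univ_eq_empty, Finset.sum_empty] at this
      have h2 : Module.finrank ℝ F = 0 := by exact_mod_cast this.symm
      omega
    exact ⟨fun _ => this.some, by simp⟩
  | succ k ih =>
    obtain ⟨f, hf⟩ := ih (by omega)
    obtain ⟨i, hi⟩ := select_step h k hk f
    have hgeom : ∀ k : ℕ, ∑ l ∈ Finset.range k, (3:ℝ) ^ l * Ed v d = (3 ^ k - 1) / 2 * Ed v d := by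
      intro k; induction k with
      | zero => simp
      | succ k ih => rw [Finset.sum_range_succ, ih]; ring
    have hb : Ed v d + 2 * ∑ l ∈ Finset.range k, er v d (f l) ≤ 3 ^ k * Ed v d := by
      have := Finset.sum_le_sum (s := Finset.range k) fun l hl => (hf l (Finset.mem_range.1 hl)).1
      rw [hgeom] at this
      linarith
    refine ⟨Function.update f k i, fun m hm => ?_⟩
    rcases Nat.lt_succ_iff_lt_or_eq.1 hm with hm | hm
    · rw [Function.update_of_ne hm.ne]
      refine ⟨(hf m hm).1, fun l hl => ?_⟩
      rw [Function.update_of_ne (hl.trans hm).ne]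
      exact (hf m hm).2 l hl
    · subst hm
      rw [Function.update_self]
      have hs : 0 ≤ ∑ l ∈ Finset.range m, ⟪v i, v (f l)⟫ ^ 2 := Finset.sum_nonneg fun l _ => sq_nonneg _
      refine ⟨by linarith, fun l hl => ?_⟩
      rw [Function.update_of_ne hl.ne]
      have := Finset.single_le_sum (f := fun l => ⟪v i, v (f l)⟫ ^ 2) (fun l _ => sq_nonneg _) (Finset.mem_range.2 hl)
      linarith [er_nonneg h i]

variable {n : ℕ} {K : Set (EuclideanSpace ℝ (Fin n))}
  {u : ι → EuclideanSpace ℝ (Fin n)} {p : ι → ℝ}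

lemma select' (h : JD K u p) (hn : 1 ≤ n) :
    ∃ c : Fin (n + 1) → ι, ∀ k l, k ≠ l →
      ⟪lift (u (c k)), lift (u (c l))⟫ ^ 2 ≤ 3 ^ n * EK n u p := by
  obtain ⟨f, hf⟩ := select (h.frame hn) (by rw [FF_finrank]; omega) (n + 1) (by rw [FF_finrank])
  have h0 : 0 ≤ EK n u p := Ed_nonneg (h.frame hn)
  have key : ∀ m < n + 1, ∀ l < m, ⟪lift (u (f m)), lift (u (f l))⟫ ^ 2 ≤ 3 ^ n * EK n u p := by
    intro m hm l hl
    refine ((hf m hm).2 l hl).trans ?_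
    exact mul_le_mul_of_nonneg_right (pow_le_pow_right₀ (by norm_num) (by omega)) h0
  refine ⟨fun k => f k, fun k l hkl => ?_⟩
  rcases lt_trichotomy k l with hlt | heq | hlt
  · rw [real_inner_comm]; exact key l l.2 k hlt
  · exact absurd heq hkl
  · exact key k k.2 l hlt

/-- polar decomposition estimate -/
lemma polar (A : EuclideanSpace ℝ (Fin n) →ₗ[ℝ] EuclideanSpace ℝ (Fin n)) {η : ℝ} (hη : η ≤ 1 / 2)
    (hA : ∀ x, |‖A x‖ ^ 2 - ‖x‖ ^ 2| ≤ η * ‖x‖ ^ 2) :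
    ∃ T : EuclideanSpace ℝ (Fin n) ≃ₗᵢ[ℝ] EuclideanSpace ℝ (Fin n), ∀ x, ‖A x - T x‖ ≤ η * ‖x‖ := by
  set G := LinearMap.adjoint A ∘ₗ A with hG
  have hGs : G.IsSymmetric := by
    intro x y
    simp only [hG, LinearMap.comp_apply, LinearMap.adjoint_inner_left, LinearMap.adjoint_inner_right]
  have hfr : Module.finrank ℝ (EuclideanSpace ℝ (Fin n)) = n := by simp
  set e := hGs.eigenvectorBasis hfr with he
  set lam := hGs.eigenvalues hfr with hlam
  have hee : ∀ i, G (e i) = lam i • e i := fun i => by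
    have := hGs.apply_eigenvectorBasis hfr i
    exact this
  have hin : ∀ i j, ⟪A (e i), A (e j)⟫ = if i = j then lam i else 0 := by
    intro i j
    rw [← LinearMap.adjoint_inner_left]
    change ⟪G (e i), e j⟫ = _
    rw [hee, real_inner_smul_left, orthonormal_iff_ite.1 e.orthonormal]
    simp
  have hl : ∀ i, |lam i - 1| ≤ η := by
    intro i
    have := hA (e i)
    rw [← real_inner_self_eq_norm_sq, hin, if_pos rfl, e.norm_eq_one] at this
    simpa using this
  have hlpos : ∀ i, 0 < lam i := fun i => by linarith [(abs_le.1 (hl i)).1]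
  set g : Fin n → EuclideanSpace ℝ (Fin n) := fun i => (Real.sqrt (lam i))⁻¹ • A (e i) with hg
  have hgo : Orthonormal ℝ g := by
    rw [orthonormal_iff_ite]
    intro i j
    simp only [hg]
    rw [real_inner_smul_left, real_inner_smul_right, hin]
    by_cases hij : i = j
    · subst hij
      simp only [if_pos]
      have := Real.mul_self_sqrt (hlpos i).le
      have h0 : 0 < Real.sqrt (lam i) := Real.sqrt_pos.2 (hlpos i)
      field_simp; nlinarith
    · simp [hij]
  have hc : Fintype.card (Fin n) = Module.finrank ℝ (EuclideanSpace ℝ (Fin n)) := by simp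
  rcases Nat.eq_zero_or_pos n with h0 | hpos
  · refine ⟨LinearIsometryEquiv.refl ℝ _, fun x => ?_⟩
    have hs : Subsingleton (EuclideanSpace ℝ (Fin n)) := by
      subst h0; infer_instance
    rw [Subsingleton.elim x 0]; simp
  have : Nonempty (Fin n) := ⟨⟨0, hpos⟩⟩
  set f : OrthonormalBasis (Fin n) ℝ (EuclideanSpace ℝ (Fin n)) :=
    (basisOfOrthonormalOfCardEqFinrank hgo hc).toOrthonormalBasis (by simpa using hgo) with hf
  have hfg : ∀ i, f i = g i := fun i => by simp [hf]
  have hη0 : 0 ≤ η := (abs_nonneg _).trans (hl ⟨0, hpos⟩)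
  set T := e.equiv f (Equiv.refl _) with hT
  have hTe : ∀ i, T (e i) = g i := fun i => by rw [hT, OrthonormalBasis.equiv_apply_basis]; exact hfg i
  refine ⟨T, fun x => ?_⟩
  have hx := e.sum_repr' x
  have hAT : A x - T x = ∑ i, (⟪e i, x⟫ * (Real.sqrt (lam i) - 1)) • f i := by
    conv_lhs => rw [← hx]
    rw [map_sum, map_sum, ← Finset.sum_sub_distrib]
    refine Finset.sum_congr rfl fun i _ => ?_
    rw [map_smul, map_smul, hTe, ← smul_sub, ← smul_smul, hfg, sub_smul, one_smul]
    congr 2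
    rw [hg]; simp only
    rw [smul_smul, mul_inv_cancel₀ (Real.sqrt_pos.2 (hlpos i)).ne', one_smul]
  have h2 : ‖A x - T x‖ ^ 2 ≤ (η * ‖x‖) ^ 2 := by
    rw [hAT, ← OrthonormalBasis.sum_sq_inner_right f, mul_pow, ← OrthonormalBasis.sum_sq_inner_right e x, Finset.mul_sum]
    refine Finset.sum_le_sum fun i _ => ?_
    have : ⟪f i, ∑ j, (⟪e j, x⟫ * (Real.sqrt (lam j) - 1)) • f j⟫ = ⟪e i, x⟫ * (Real.sqrt (lam i) - 1) :=
      f.orthonormal.inner_right_fintype _ i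
    rw [this, mul_pow, mul_comm]
    refine mul_le_mul_of_nonneg_right ?_ (sq_nonneg _)
    have hq := Real.mul_self_sqrt (hlpos i).le
    have hq0 := Real.sqrt_nonneg (lam i)
    have h3 : |Real.sqrt (lam i) - 1| ≤ |lam i - 1| := by
      have : lam i - 1 = (Real.sqrt (lam i) - 1) * (Real.sqrt (lam i) + 1) := by linarith
      rw [this, abs_mul]
      refine le_mul_of_one_le_right (abs_nonneg _) ?_
      rw [abs_of_nonneg (by linarith)]; linarith
    rw [← sq_abs]
    exact pow_le_pow_left₀ (abs_nonneg _) (h3.trans (hl i)) 2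
  exact le_of_sq_le_sq h2 (by positivity)

end select

end JMW

namespace JMW
open ProbabilityTheory Filter Topology
section Rot
variable {n : ℕ}

lemma rot {w U : Fin (n + 1) → EuclideanSpace ℝ (Fin n)} (hw : IsRegVerts w) (hn : 1 ≤ n)
    (hU : ∀ k, ‖U k‖ = 1) {δ : ℝ} (hδ0 : 0 ≤ δ)
    (hδ : ∀ k l, k ≠ l → |⟪lift (U k), lift (U l)⟫| ≤ δ) (hs : ((n:ℝ) + 1) * δ ≤ 1 / 2) :
    ∃ T : EuclideanSpace ℝ (Fin n) ≃ₗᵢ[ℝ] EuclideanSpace ℝ (Fin n),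
      ∀ k, ‖T (w k) - U k‖ ≤ 3 * ((n:ℝ) + 1) * δ := by
  have hn0 : (1:ℝ) ≤ n := by exact_mod_cast hn
  have hnp : (0:ℝ) < n := by linarith
  set N : ℝ := (n:ℝ) + 1 with hN
  have hNp : 0 < N := by linarith
  set q : Fin (n + 1) → Fin (n + 1) → ℝ := fun k l =>
    ⟪lift (U k), lift (U l)⟫ - if k = l then 1 else 0 with hq
  have hUU : ∀ k l, ⟪U k, U l⟫ = (N * (q k l + if k = l then 1 else 0) - 1) / n := by
    intro k l
    simp only [hq, sub_add_cancel, inner_lift_lift]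
    field_simp; ring
  have hql : ∀ k l, |q k l| ≤ δ := by
    intro k l
    by_cases hkl : k = l
    · subst hkl
      have : q k k = 0 := by
        simp only [hq, inner_lift_lift, if_true, real_inner_self_eq_norm_sq, hU]
        rw [one_pow, mul_one, div_self hNp.ne', sub_self]
      rw [this, abs_zero]; exact hδ0
    · have := hδ k l hkl
      simpa [hq, hkl] using this
  have hc0 : ∀ x, ∑ k, ⟪w k, x⟫ = 0 := fun x => (simplex_id hw hn x).1
  have hc2 : ∀ x, ∑ k, ⟪w k, x⟫ ^ 2 = N / n * ‖x‖ ^ 2 := by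
    intro x
    have := congrArg (fun z => ⟪z, x⟫) (simplex_id hw hn x).2
    simp only [sum_inner, real_inner_smul_left, real_inner_self_eq_norm_sq] at this
    rw [← this]
    exact Finset.sum_congr rfl fun k _ => by ring
  have hcs : ∀ x, (∑ k, |⟪w k, x⟫|) ^ 2 ≤ N * (N / n * ‖x‖ ^ 2) := by
    intro x
    have := sq_sum_le_card_mul_sum_sq (s := (Finset.univ : Finset (Fin (n + 1)))) (f := fun k => |⟪w k, x⟫|)
    simp only [sq_abs, hc2, Finset.card_univ, Fintype.card_fin] at this
    push_cast at this
    exact this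
  have hcN : ∀ x, (∑ k, |⟪w k, x⟫|) ≤ N * ‖x‖ := by
    intro x
    refine le_of_sq_le_sq ?_ (by positivity) 
    refine (hcs x).trans ?_
    have : N / n ≤ N := div_le_self hNp.le hn0
    nlinarith [mul_le_mul_of_nonneg_right this (mul_nonneg hNp.le (sq_nonneg ‖x‖))]
  set A : EuclideanSpace ℝ (Fin n) →ₗ[ℝ] EuclideanSpace ℝ (Fin n) :=
    (n / N) • ∑ k, (innerₛₗ ℝ (w k)).smulRight (U k) with hA
  have hAx : ∀ x, A x = (n / N) • ∑ k, ⟪w k, x⟫ • U k := by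
    intro x; simp [hA]
  have hAn : ∀ x, ‖A x‖ ^ 2 - ‖x‖ ^ 2 = n / N * ∑ k, ∑ l, ⟪w k, x⟫ * ⟪w l, x⟫ * q k l := by
    intro x
    have h1 : ‖A x‖ ^ 2 = (n / N) ^ 2 * ∑ k, ∑ l, ⟪w k, x⟫ * ⟪w l, x⟫ * ⟪U k, U l⟫ := by
      rw [hAx, norm_smul, mul_pow, Real.norm_eq_abs, sq_abs, ← real_inner_self_eq_norm_sq, sum_inner]
      congr 1
      refine Finset.sum_congr rfl fun k _ => ?_
      rw [inner_sum]
      refine Finset.sum_congr rfl fun l _ => ?_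
      rw [real_inner_smul_left, real_inner_smul_right]; ring
    have h2 : ∑ k, ∑ l, ⟪w k, x⟫ * ⟪w l, x⟫ * ⟪U k, U l⟫ =
        N / n * (∑ k, ∑ l, ⟪w k, x⟫ * ⟪w l, x⟫ * q k l) + N / n * (∑ k, ⟪w k, x⟫ ^ 2)
          - 1 / n * ((∑ k, ⟪w k, x⟫) * ∑ l, ⟪w l, x⟫) := by
      have h3 : ∑ k, ⟪w k, x⟫ ^ 2 = ∑ k, ∑ l, ⟪w k, x⟫ * ⟪w l, x⟫ * (if k = l then 1 else 0) := by
        refine Finset.sum_congr rfl fun k _ => ?_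
        simp [sq]
      rw [h3, Finset.sum_mul_sum]
      simp only [Finset.mul_sum, ← Finset.sum_add_distrib, ← Finset.sum_sub_distrib]
      refine Finset.sum_congr rfl fun k _ => Finset.sum_congr rfl fun l _ => ?_
      rw [hUU]; field_simp
    rw [h1, h2, hc0, hc2]
    field_simp; ring
  have hAb : ∀ x, |‖A x‖ ^ 2 - ‖x‖ ^ 2| ≤ (N * δ) * ‖x‖ ^ 2 := by
    intro x
    rw [hAn, abs_mul, abs_of_nonneg (by positivity : 0 ≤ (n:ℝ) / N)]
    have : |∑ k, ∑ l, ⟪w k, x⟫ * ⟪w l, x⟫ * q k l| ≤ δ * (∑ k, |⟪w k, x⟫|) ^ 2 := by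
      rw [sq, Finset.sum_mul_sum, Finset.mul_sum]
      refine (Finset.abs_sum_le_sum_abs _ _).trans (Finset.sum_le_sum fun k _ => ?_)
      rw [Finset.mul_sum]
      refine (Finset.abs_sum_le_sum_abs _ _).trans (Finset.sum_le_sum fun l _ => ?_)
      rw [abs_mul, abs_mul, mul_comm δ]
      exact mul_le_mul_of_nonneg_left (hql k l) (by positivity)
    calc n / N * |∑ k, ∑ l, ⟪w k, x⟫ * ⟪w l, x⟫ * q k l| ≤ n / N * (δ * (N * (N / n * ‖x‖ ^ 2))) := by
          refine mul_le_mul_of_nonneg_left (this.trans (mul_le_mul_of_nonneg_left (hcs x) hδ0)) (by positivity)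
      _ = _ := by field_simp
  obtain ⟨T, hT⟩ := polar A hs hAb
  refine ⟨T, fun l => ?_⟩
  set s := ∑ k, U k with hsd
  have hsU : ∀ k, |⟪U k, s⟫| ≤ N / n * (N * δ) := by
    intro k
    have : ⟪U k, s⟫ = N / n * ∑ l, q k l := by
      rw [hsd, inner_sum]
      simp only [hUU, mul_add, add_sub_assoc, add_div, Finset.sum_add_distrib, sub_div,
        Finset.sum_sub_distrib, ← Finset.sum_div, ← Finset.mul_sum]
      simp
      rw [← hN, sub_self, add_zero]; ring
    rw [this, abs_mul, abs_of_nonneg (by positivity : 0 ≤ N / (n:ℝ))]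
    refine mul_le_mul_of_nonneg_left ?_ (by positivity)
    refine (Finset.abs_sum_le_sum_abs _ _).trans ((Finset.sum_le_sum fun l _ => hql k l).trans ?_)
    simp [hN]
  have hsn : ‖s‖ ≤ 2 * N ^ 2 * δ := by
    set y := T.symm s with hy
    have hyn : ‖y‖ = ‖s‖ := T.symm.norm_map s
    have h1 : |⟪A y, s⟫| ≤ N ^ 2 * δ * ‖s‖ := by
      rw [hAx, real_inner_smul_left, sum_inner, abs_mul, abs_of_nonneg (by positivity : 0 ≤ (n:ℝ) / N)]
      have : |∑ k, ⟪⟪w k, y⟫ • U k, s⟫| ≤ (N * ‖y‖) * (N / n * (N * δ)) := by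
        refine (Finset.abs_sum_le_sum_abs _ _).trans ?_
        refine le_trans ?_ (mul_le_mul_of_nonneg_right (hcN y) (by positivity))
        rw [Finset.sum_mul]
        refine Finset.sum_le_sum fun k _ => ?_
        rw [real_inner_smul_left, abs_mul]
        exact mul_le_mul_of_nonneg_left (hsU k) (abs_nonneg _)
      calc _ ≤ n / N * ((N * ‖y‖) * (N / n * (N * δ))) := mul_le_mul_of_nonneg_left this (by positivity)
        _ = _ := by rw [hyn]; field_simp
    have h2 : ‖s‖ ^ 2 = ⟪A y, s⟫ - ⟪A y - T y, s⟫ := by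
      rw [inner_sub_left, hy, T.apply_symm_apply, real_inner_self_eq_norm_sq]; ring
    have h3 : |⟪A y - T y, s⟫| ≤ 1 / 2 * ‖s‖ * ‖s‖ := by
      refine (abs_real_inner_le_norm _ _).trans (mul_le_mul_of_nonneg_right ?_ (norm_nonneg _))
      refine (hT y).trans ?_
      rw [hyn]
      exact mul_le_mul_of_nonneg_right hs (norm_nonneg _)
    by_contra hcon
    push Not at hcon
    have hsp : 0 < ‖s‖ := lt_of_le_of_lt (by positivity) hcon
    have := (abs_le.1 h1).2
    have := (abs_le.1 h3).1
    nlinarith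
  have hAw : A (w l) = U l - (1 / N) • s := by
    rw [hAx]
    have : ∀ k, ⟪w k, w l⟫ • U k = (-1 / (n:ℝ)) • U k + (if k = l then ((N / n) • U k) else 0) := by
      intro k
      by_cases hkl : k = l
      · subst hkl
        rw [if_pos rfl, real_inner_self_eq_norm_sq, hw.1, ← add_smul]
        congr 1
        field_simp; rw [hN]; ring
      · rw [hw.2 k l hkl, if_neg hkl, add_zero]
    simp only [this, Finset.sum_add_distrib, ← Finset.smul_sum, Finset.sum_ite_eq', Finset.mem_univ, if_true]
    rw [← hsd, smul_add, smul_smul, smul_smul]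
    have e1 : (n:ℝ) / N * (N / n) = 1 := by field_simp
    have e2 : (n:ℝ) / N * (-1 / n) = -(1 / N) := by field_simp
    rw [e1, e2, one_smul, neg_smul]; abel
  have e : T (w l) - U l = -(A (w l) - T (w l)) - (1 / N) • s := by rw [hAw]; abel
  rw [e]
  refine (norm_sub_le _ _).trans ?_
  rw [norm_neg, norm_smul, Real.norm_eq_abs, abs_of_nonneg (by positivity : 0 ≤ 1 / N)]
  have h1 := hT (w l)
  rw [hw.1, mul_one] at h1
  have h2 : 1 / N * ‖s‖ ≤ 1 / N * (2 * N ^ 2 * δ) := mul_le_mul_of_nonneg_left hsn (by positivity)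
  have h3 : 1 / N * (2 * N ^ 2 * δ) = 2 * N * δ := by field_simp
  linarith

end Rot
end JMW

namespace JMW
open ProbabilityTheory Filter Topology
section Uniq
variable {n : ℕ}

/-- invariance of measures of balls -/
def BInv (σ : Measure (EuclideanSpace ℝ (Fin n))) : Prop :=
  ∀ (T : EuclideanSpace ℝ (Fin n) ≃ₗᵢ[ℝ] EuclideanSpace ℝ (Fin n)) (u : EuclideanSpace ℝ (Fin n)) (t : ℝ),
    σ (ball (T u) t) = σ (ball u t)

lemma BInv.eq {σ : Measure (EuclideanSpace ℝ (Fin n))} (h : BInv σ) {u v : EuclideanSpace ℝ (Fin n)}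
    (hu : ‖u‖ = 1) (hv : ‖v‖ = 1) (t : ℝ) : σ (ball u t) = σ (ball v t) := by
  have := h (Submodule.reflection (ℝ ∙ (u - v))ᗮ) u t
  rw [Submodule.reflection_sub (hu.trans hv.symm)] at this
  exact this.symm

lemma dbl {σ τ : Measure (EuclideanSpace ℝ (Fin n))} [IsFiniteMeasure σ] [IsFiniteMeasure τ]
    (hσS : ∀ᵐ x ∂σ, ‖x‖ = 1) (hτ : BInv τ) {e : EuclideanSpace ℝ (Fin n)} (he : ‖e‖ = 1) (t : ℝ)
    {f : EuclideanSpace ℝ (Fin n) → ℝ} (hf : Integrable f σ) :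
    ∫ z in {z : EuclideanSpace ℝ (Fin n) × EuclideanSpace ℝ (Fin n) | dist z.1 z.2 < t}, f z.1 ∂(σ.prod τ)
      = τ.real (ball e t) * ∫ x, f x ∂σ := by
  have hD : MeasurableSet {z : EuclideanSpace ℝ (Fin n) × EuclideanSpace ℝ (Fin n) | dist z.1 z.2 < t} :=
    measurableSet_lt (by fun_prop) (by fun_prop)
  rw [← integral_indicator hD, integral_prod _ ((hf.comp_fst τ).indicator hD), ← integral_const_mul]
  refine integral_congr_ae ?_
  filter_upwards [hσS] with x hx
  have : (fun y => indicator {z : EuclideanSpace ℝ (Fin n) × EuclideanSpace ℝ (Fin n) | dist z.1 z.2 < t}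
      (fun z => f z.1) (x, y)) = indicator (ball x t) (fun _ => f x) := by
    ext y
    simp only [indicator, mem_ofPred_eq, mem_ball, dist_comm y x]
  rw [this, integral_indicator measurableSet_ball, setIntegral_const, smul_eq_mul, measureReal_def,
    measureReal_def, hτ.eq hx he]

lemma uniq {σ τ : Measure (EuclideanSpace ℝ (Fin n))} [IsFiniteMeasure σ] [IsFiniteMeasure τ]
    (hσS : ∀ᵐ x ∂σ, ‖x‖ = 1) (hτS : ∀ᵐ x ∂τ, ‖x‖ = 1) (hσ : BInv σ) (hτ : BInv τ)
    {e : EuclideanSpace ℝ (Fin n)} (he : ‖e‖ = 1)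
    {f : EuclideanSpace ℝ (Fin n) → ℝ} (hf : Integrable f σ) (hf' : Integrable f τ) {R : ℝ}
    (hR : ∀ x y, |f x - f y| ≤ R * dist x y) :
    τ.real univ * ∫ x, f x ∂σ = σ.real univ * ∫ x, f x ∂τ := by
  have hR0 : 0 ≤ R := by
    have := (abs_nonneg _).trans (hR e 0)
    rw [dist_zero_right, he, mul_one] at this; exact this
  by_cases hz : ∃ t > 0, τ (ball e t) = 0
  · obtain ⟨t, ht, h0⟩ := hz
    have h1 : τ {x | ‖x‖ = 1} = 0 := by
      refine measure_null_of_locally_null _ fun x hx => ⟨ball x t, mem_nhdsWithin_of_mem_nhds (ball_mem_nhds x ht), ?_⟩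
      rw [hτ.eq hx he, h0]
    have h2 : τ = 0 := by
      rw [← Measure.measure_univ_eq_zero]
      refine le_antisymm ?_ (zero_le)
      have h3 : τ {x | ‖x‖ = 1}ᶜ = 0 := hτS
      calc τ univ = τ ({x | ‖x‖ = 1} ∪ {x | ‖x‖ = 1}ᶜ) := by rw [union_compl_self]
        _ ≤ _ := measure_union_le _ _
        _ = 0 := by rw [h1, h3, add_zero]
    simp [h2]
  push Not at hz
  have key : ∀ t > 0, |τ.real univ * ∫ x, f x ∂σ - σ.real univ * ∫ x, f x ∂τ| ≤
      R * t * (σ.real univ * τ.real univ) := by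
    intro t ht
    set D := {z : EuclideanSpace ℝ (Fin n) × EuclideanSpace ℝ (Fin n) | dist z.1 z.2 < t} with hDd
    have hD : MeasurableSet D := measurableSet_lt (by fun_prop) (by fun_prop)
    have sw : ∀ g : EuclideanSpace ℝ (Fin n) → ℝ, Integrable g τ →
        ∫ z in D, g z.2 ∂(σ.prod τ) = σ.real (ball e t) * ∫ x, g x ∂τ := by
      intro g hg
      rw [← dbl hτS hσ he t hg, ← integral_indicator hD, ← integral_indicator hD, ← integral_prod_swap]
      congr 1
      ext z
      simp [indicator, hDd, dist_comm]
    have i1 := dbl hσS hτ he t hf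
    have i2 := sw f hf'
    have j1 := dbl hσS hτ he t (integrable_const (1:ℝ))
    have j2 := sw (fun _ => 1) (integrable_const (1:ℝ))
    simp only [integral_const, smul_eq_mul, mul_one] at j1 j2
    set a := σ.real (ball e t)
    set b := τ.real (ball e t) with hb
    have hbp : 0 < b := by
      rw [hb, measureReal_def]; exact ENNReal.toReal_pos (hz t ht) (measure_ne_top _ _)
    have hPD : (σ.prod τ).real D = b * σ.real univ := by rw [← j1, measureReal_restrict_apply_univ]
    have hdiff : |b * ∫ x, f x ∂σ - a * ∫ x, f x ∂τ| ≤ R * t * (b * σ.real univ) := by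
      rw [← i1, ← i2, ← integral_sub (hf.comp_fst τ).integrableOn (hf'.comp_snd σ).integrableOn, ← hPD,
        ← Real.norm_eq_abs]
      refine norm_setIntegral_le_of_norm_le_const (measure_lt_top _ _) fun z hz => ?_
      rw [Real.norm_eq_abs]
      exact (hR _ _).trans (mul_le_mul_of_nonneg_left (le_of_lt hz) hR0)
    have hab : b * σ.real univ = a * τ.real univ := by rw [← j1, ← j2]
    have h4 := mul_le_mul_of_nonneg_right hdiff (measureReal_nonneg (μ := τ) (s := univ))
    rw [← abs_of_nonneg (measureReal_nonneg (μ := τ) (s := univ)), ← abs_mul,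
      abs_of_nonneg (measureReal_nonneg (μ := τ) (s := univ))] at h4
    have e1 : (b * ∫ x, f x ∂σ - a * ∫ x, f x ∂τ) * τ.real univ =
        b * (τ.real univ * ∫ x, f x ∂σ - σ.real univ * ∫ x, f x ∂τ) := by
      linear_combination (∫ x, f x ∂τ) * hab
    rw [e1, abs_mul, abs_of_pos hbp] at h4
    refine le_of_mul_le_mul_left ?_ hbp
    calc _ ≤ _ := h4
      _ = _ := by ring
  have lim : Tendsto (fun t : ℝ => R * t * (σ.real univ * τ.real univ)) (𝓝[>] 0) (𝓝 0) := by
    have : Tendsto (fun t : ℝ => R * t * (σ.real univ * τ.real univ)) (𝓝 0) (𝓝 (R * 0 * (σ.real univ * τ.real univ))) :=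
      Continuous.tendsto (by fun_prop) 0
    rw [mul_zero, zero_mul] at this
    exact this.mono_left nhdsWithin_le_nhds
  have h5 := ge_of_tendsto lim (eventually_nhdsWithin_of_forall fun t ht => key t ht)
  have := abs_nonpos_iff.1 h5
  linarith

end Uniq
end JMW

namespace JMW
open ProbabilityTheory Filter Topology
section Sph
variable {n : ℕ}

lemma normz_lip {E : Type*} [NormedAddCommGroup E] [NormedSpace ℝ E] {x y : E} (hx : 1 ≤ ‖x‖) (hy : 1 ≤ ‖y‖) :
    ‖‖x‖⁻¹ • x - ‖y‖⁻¹ • y‖ ≤ 2 * ‖x - y‖ := by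
  have hx0 : 0 < ‖x‖ := by linarith
  have hy0 : 0 < ‖y‖ := by linarith
  have e : ‖x‖⁻¹ • x - ‖y‖⁻¹ • y = ‖x‖⁻¹ • (x - y) + (‖x‖⁻¹ - ‖y‖⁻¹) • y := by
    rw [smul_sub, sub_smul]; abel
  rw [e]
  refine (norm_add_le _ _).trans ?_
  rw [norm_smul, norm_smul, Real.norm_eq_abs, Real.norm_eq_abs, abs_of_pos (inv_pos.2 hx0)]
  have h1 : |‖x‖⁻¹ - ‖y‖⁻¹| * ‖y‖ = ‖x‖⁻¹ * |‖y‖ - ‖x‖| := by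
    rw [← abs_of_pos hy0, ← abs_mul, abs_of_pos hy0, ← abs_of_pos (inv_pos.2 hx0), ← abs_mul, abs_of_pos (inv_pos.2 hx0)]
    congr 1; field_simp
  rw [h1]
  have h2 : ‖x‖⁻¹ ≤ 1 := inv_le_one_of_one_le₀ hx
  have h3 : |‖y‖ - ‖x‖| ≤ ‖x - y‖ := by rw [norm_sub_rev]; exact abs_norm_sub_norm_le _ _
  have := norm_nonneg (x - y)
  have h4 := mul_le_mul_of_nonneg_right h2 this
  have h5 := mul_le_mul_of_nonneg_right h2 (abs_nonneg (‖y‖ - ‖x‖))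
  linarith

/-- face maps of the cube -/
def face (m : ℕ) (i : Fin (m + 1)) (s : ℝ) (y : Fin m → ℝ) : EuclideanSpace ℝ (Fin (m + 1)) :=
  WithLp.toLp 2 (Fin.insertNth i s y)

lemma face_norm {m : ℕ} (i : Fin (m + 1)) {s : ℝ} (hs : |s| = 1) (y : Fin m → ℝ) : 1 ≤ ‖face m i s y‖ := by
  have h := PiLp.norm_apply_le (face m i s y) i
  simpa [face, hs] using h

lemma face_dist {m : ℕ} (i : Fin (m + 1)) (s : ℝ) (y z : Fin m → ℝ) :
    ‖face m i s y - face m i s z‖ ≤ (m + 1) * dist y z := by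
  rw [EuclideanSpace.norm_eq]
  refine Real.sqrt_le_iff.2 ⟨by positivity, ?_⟩
  have hb : ∀ j, ‖(face m i s y - face m i s z) j‖ ^ 2 ≤ dist y z ^ 2 := by
    intro j
    refine pow_le_pow_left₀ (norm_nonneg _) ?_ 2
    refine Fin.succAboveCases i ?_ (fun j => ?_) j
    · simp [face]
    · simp only [face, PiLp.sub_apply, Fin.insertNth_apply_succAbove]
      exact dist_le_pi_dist y z j
  refine (Finset.sum_le_sum fun j _ => hb j).trans ?_
  simp only [Finset.sum_const, Finset.card_univ, Fintype.card_fin, nsmul_eq_mul]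
  push_cast
  have := sq_nonneg (dist y z)
  have hm : (0:ℝ) ≤ m := by positivity
  nlinarith [mul_nonneg hm this]

lemma sphere_fin (m : ℕ) : (μH[(m:ℝ)] : Measure (EuclideanSpace ℝ (Fin (m + 1)))) (sphere 0 1) < ∞ := by
  set G : Fin (m + 1) → ℝ → (Fin m → ℝ) → EuclideanSpace ℝ (Fin (m + 1)) := fun i s y =>
    ‖face m i s y‖⁻¹ • face m i s y with hG
  have hlip : ∀ i, ∀ s : ℝ, |s| = 1 → LipschitzWith (2 * (m + 1)) (G i s) := by
    intro i s hs
    refine LipschitzWith.of_dist_le_mul fun y z => ?_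
    rw [dist_eq_norm]
    refine (normz_lip (face_norm i hs y) (face_norm i hs z)).trans ?_
    have := face_dist i s y z
    push_cast
    linarith
  have hfin : ∀ i, ∀ s : ℝ, |s| = 1 → (μH[(m:ℝ)] : Measure (EuclideanSpace ℝ (Fin (m + 1)))) (G i s '' closedBall 0 1) < ∞ := by
    intro i s hs
    refine lt_of_le_of_lt ((hlip i s hs).hausdorffMeasure_image_le (by positivity) _) ?_
    have : (μH[(m:ℝ)] : Measure (Fin m → ℝ)) = volume := by
      have := hausdorffMeasure_pi_real (ι := Fin m)
      rwa [Fintype.card_fin] at this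
    rw [this]
    refine ENNReal.mul_lt_top ?_ measure_closedBall_lt_top
    exact ENNReal.rpow_lt_top_of_nonneg (by positivity) ENNReal.coe_ne_top
  have hsub : sphere (0:EuclideanSpace ℝ (Fin (m + 1))) 1 ⊆
      ⋃ i : Fin (m + 1), (G i 1 '' closedBall 0 1 ∪ G i (-1) '' closedBall 0 1) := by
    intro x hx
    rw [mem_sphere_zero_iff_norm] at hx
    obtain ⟨i, -, hi⟩ := Finset.exists_max_image Finset.univ (fun i => |x i|) ⟨0, Finset.mem_univ _⟩
    have hxi : 0 < |x i| := by
      by_contra hcon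
      have h0 : ∀ j, x j = 0 := fun j => abs_nonpos_iff.1 ((hi j (Finset.mem_univ _)).trans (not_lt.1 hcon))
      have : x = 0 := by ext j; simpa using h0 j
      rw [this, norm_zero] at hx; norm_num at hx
    set y : Fin m → ℝ := fun j => |x i|⁻¹ * x (i.succAbove j) with hy
    have hyb : y ∈ closedBall (0 : Fin m → ℝ) 1 := by
      rw [mem_closedBall_zero_iff, pi_norm_le_iff_of_nonneg zero_le_one]
      intro j
      rw [Real.norm_eq_abs, hy, abs_mul, abs_inv, abs_abs, inv_mul_le_iff₀ hxi, mul_one]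
      exact hi _ (Finset.mem_univ _)
    have hface : ∀ s : ℝ, x i = s * |x i| → face m i s y = |x i|⁻¹ • x := by
      intro s hs
      ext j
      refine Fin.succAboveCases i ?_ (fun j => ?_) j
      · simp only [face, Fin.insertNth_apply_same, PiLp.smul_apply, smul_eq_mul]
        rw [eq_inv_mul_iff_mul_eq₀ hxi.ne', mul_comm]; exact hs.symm
      · simp only [face, Fin.insertNth_apply_succAbove, PiLp.smul_apply, smul_eq_mul, hy]
    have hGx : ∀ s : ℝ, x i = s * |x i| → G i s y = x := by
      intro s hs
      simp only [hG, hface s hs, norm_smul, hx, norm_inv, Real.norm_eq_abs, abs_abs, mul_one, inv_inv, smul_smul]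
      rw [mul_inv_cancel₀ hxi.ne', one_smul]
    rw [mem_iUnion]
    refine ⟨i, ?_⟩
    rcases le_total 0 (x i) with h | h
    · left; exact ⟨y, hyb, hGx 1 (by rw [abs_of_nonneg h, one_mul])⟩
    · right; exact ⟨y, hyb, hGx (-1) (by rw [abs_of_nonpos h]; ring)⟩
  refine lt_of_le_of_lt (measure_mono hsub) ?_
  refine lt_of_le_of_lt (measure_iUnion_fintype_le _ _) ?_
  refine ENNReal.sum_lt_top.2 fun i _ => ?_
  refine lt_of_le_of_lt (measure_union_le _ _) ?_
  exact ENNReal.add_lt_top.2 ⟨hfin i 1 (by norm_num), hfin i (-1) (by norm_num)⟩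

lemma sphere_pos (m : ℕ) : 0 < (μH[(m:ℝ)] : Measure (EuclideanSpace ℝ (Fin (m + 1)))) (sphere 0 1) := by
  set P : EuclideanSpace ℝ (Fin (m + 1)) → (Fin m → ℝ) := fun x j => x j.succ with hP
  have hl : LipschitzWith 1 P := by
    refine LipschitzWith.of_dist_le_mul fun x y => ?_
    rw [NNReal.coe_one, one_mul, dist_pi_le_iff dist_nonneg]
    intro j
    rw [dist_eq_norm, dist_eq_norm]
    exact PiLp.norm_apply_le (x - y) j.succ
  have h1 := hl.hausdorffMeasure_image_le (d := (m:ℝ)) (by positivity) (sphere 0 1)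
  rw [ENNReal.coe_one, ENNReal.one_rpow, one_mul] at h1
  refine lt_of_lt_of_le ?_ h1
  have h2 : (μH[(m:ℝ)] : Measure (Fin m → ℝ)) = volume := by
    have := hausdorffMeasure_pi_real (ι := Fin m)
    rwa [Fintype.card_fin] at this
  rw [h2]
  have h3 : ball (0 : Fin m → ℝ) (1 / (m + 1)) ⊆ P '' sphere 0 1 := by
    intro y hy
    rw [mem_ball_zero_iff] at hy
    have hs : ∑ j, y j ^ 2 ≤ 1 := by
      have : ∀ j, y j ^ 2 ≤ 1 / (m + 1) := by
        intro j
        have h4 : |y j| < 1 / (m + 1) := lt_of_le_of_lt (norm_le_pi_norm y j) hy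
        have h5 : (1:ℝ) / (m + 1) ≤ 1 := by
          rw [div_le_one (by positivity)]; linarith [(by positivity : (0:ℝ) ≤ m)]
        rw [← sq_abs]
        nlinarith [abs_nonneg (y j)]
      refine (Finset.sum_le_sum fun j _ => this j).trans ?_
      simp only [Finset.sum_const, Finset.card_univ, Fintype.card_fin, nsmul_eq_mul]
      rw [mul_one_div, div_le_one (by positivity)]; linarith
    refine ⟨WithLp.toLp 2 (Fin.cons (Real.sqrt (1 - ∑ j, y j ^ 2)) y), ?_, ?_⟩
    · rw [mem_sphere_zero_iff_norm, EuclideanSpace.norm_eq, Fin.sum_univ_succ]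
      simp only [Fin.cons_zero, Fin.cons_succ, Real.norm_eq_abs, sq_abs]
      rw [Real.sq_sqrt (by linarith), sub_add_cancel, Real.sqrt_one]
    · ext j; simp [hP]
  exact lt_of_lt_of_le (measure_ball_pos _ _ (by positivity)) (measure_mono h3)

end Sph
end JMW

namespace JMW
open ProbabilityTheory Filter Topology
section Tau
variable {n : ℕ} {K : Set (EuclideanSpace ℝ (Fin n))} {R : ℝ}

/-- radial projection -/
def nz (x : EuclideanSpace ℝ (Fin n)) : EuclideanSpace ℝ (Fin n) := ‖x‖⁻¹ • x

lemma nz_meas : Measurable (nz (n := n)) := by unfold nz; fun_prop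

/-- norm-weighted Gaussian -/
def tau0 (n : ℕ) : Measure (EuclideanSpace ℝ (Fin n)) :=
  (stdGaussian (EuclideanSpace ℝ (Fin n))).withDensity (fun x => ENNReal.ofReal ‖x‖)

def tau (n : ℕ) : Measure (EuclideanSpace ℝ (Fin n)) := (tau0 n).map nz

lemma tau0_fin : IsFiniteMeasure (tau0 n) := by
  unfold tau0
  refine isFiniteMeasure_withDensity_ofReal ?_
  exact (g_norm_int (F := EuclideanSpace ℝ (Fin n))).2

instance : IsFiniteMeasure (tau0 n) := tau0_fin

instance : IsFiniteMeasure (tau n) := by unfold tau; infer_instance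

lemma tau_apply {A : Set (EuclideanSpace ℝ (Fin n))} (hA : MeasurableSet A) :
    tau n A = ∫⁻ x, indicator (nz ⁻¹' A) (fun x => ENNReal.ofReal ‖x‖) x ∂(stdGaussian (EuclideanSpace ℝ (Fin n))) := by
  unfold tau tau0
  rw [Measure.map_apply nz_meas hA, withDensity_apply _ (nz_meas hA), lintegral_indicator (nz_meas hA)]

lemma tau_sph : ∀ᵐ x ∂(tau n), ‖x‖ = 1 := by
  have hm : MeasurableSet {x : EuclideanSpace ℝ (Fin n) | ‖x‖ = 1}ᶜ :=
    (measurableSet_eq_fun (by fun_prop) (by fun_prop)).compl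
  change tau n {x | ‖x‖ = 1}ᶜ = 0
  rw [tau_apply hm, lintegral_eq_zero_iff']
  · refine ae_of_all _ fun x => ?_
    simp only [indicator, Pi.zero_apply]
    split_ifs with h
    · by_cases hx : x = 0
      · simp [hx]
      · exfalso; apply h
        simp [nz, norm_smul, hx]
    · rfl
  · exact ((by fun_prop : Measurable fun x : EuclideanSpace ℝ (Fin n) => ENNReal.ofReal ‖x‖).indicator (nz_meas hm)).aemeasurable

lemma tau_inv : BInv (tau n) := by
  intro T u t
  rw [tau_apply measurableSet_ball, tau_apply measurableSet_ball]
  have h := stdGaussian_map T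
  conv_lhs => rw [← h]
  have hme : MeasurableEmbedding T := T.toHomeomorph.measurableEmbedding
  rw [hme.lintegral_map]
  refine lintegral_congr fun x => ?_
  have : nz (T x) ∈ ball (T u) t ↔ nz x ∈ ball u t := by
    have e : nz (T x) = T (nz x) := by simp [nz]
    rw [e, mem_ball, mem_ball, T.dist_map]
  simp only [indicator, mem_preimage]
  simp [this]

lemma tau_supp (hne : K.Nonempty) (hK : K ⊆ closedBall 0 R) :
    ∫ x, suppFn K x ∂(tau n) = bG K := by
  unfold tau
  rw [integral_map nz_meas.aemeasurable (suppFn_cont hne hK).aestronglyMeasurable]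
  unfold tau0
  rw [integral_withDensity_eq_integral_toReal_smul (by fun_prop) (ae_of_all _ fun x => ENNReal.ofReal_lt_top)]
  unfold bG
  refine integral_congr_ae (ae_of_all _ fun x => ?_)
  simp only [nz, smul_eq_mul, ENNReal.toReal_ofReal (norm_nonneg x)]
  rw [suppFn_smul (inv_nonneg.2 (norm_nonneg x))]
  by_cases hx : x = 0
  · simp [hx, suppFn_zero hne]
  · rw [← mul_assoc, mul_inv_cancel₀ (norm_ne_zero_iff.2 hx), one_mul]

lemma supp_int_sph {σ : Measure (EuclideanSpace ℝ (Fin n))} [IsFiniteMeasure σ] (hσ : ∀ᵐ x ∂σ, ‖x‖ = 1)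
    (hne : K.Nonempty) (hK : K ⊆ closedBall 0 R) : Integrable (suppFn K) σ := by
  refine Integrable.mono' (integrable_const R) (suppFn_cont hne hK).aestronglyMeasurable ?_
  filter_upwards [hσ] with x hx
  have := suppFn_abs hne hK x
  rwa [hx, mul_one] at this

lemma tau_pos (hn : 1 ≤ n) : 0 < (tau n).real univ := by
  by_contra hcon
  have h0 : (tau n).real univ = 0 := le_antisymm (not_lt.1 hcon) measureReal_nonneg
  have h1 : tau n = 0 := by
    rw [← Measure.measure_univ_eq_zero]
    exact (measureReal_eq_zero_iff).1 h0
  have h2 := tau_apply (n := n) MeasurableSet.univ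
  rw [h1, preimage_univ, indicator_univ] at h2
  have h3 := (lintegral_eq_zero_iff (by fun_prop)).1 h2.symm
  have h4 := g_sq (F := EuclideanSpace ℝ (Fin n)) (EuclideanSpace.single (⟨0, hn⟩ : Fin n) (1:ℝ))
  have h5 : ∫ x, ⟪EuclideanSpace.single (⟨0, hn⟩ : Fin n) (1:ℝ), x⟫ ^ 2 ∂(stdGaussian (EuclideanSpace ℝ (Fin n))) =
      ∫ x, (0:ℝ) ∂(stdGaussian (EuclideanSpace ℝ (Fin n))) := by
    refine integral_congr_ae ?_
    filter_upwards [h3] with x hx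
    have hx0 : x = 0 := by
      simpa using hx
    simp [hx0]
  rw [h5] at h4
  simp at h4

lemma width_gauss (hn : 1 ≤ n) : ∃ C : ℝ, 0 < C ∧ ∀ (K : Set (EuclideanSpace ℝ (Fin n))) (R : ℝ),
    K.Nonempty → K ⊆ closedBall 0 R → C * meanWidth n K = bG K := by
  obtain ⟨m, rfl⟩ : ∃ m, n = m + 1 := ⟨n - 1, by omega⟩
  set σ : Measure (EuclideanSpace ℝ (Fin (m + 1))) := (μH[(m:ℝ)]).restrict (sphere 0 1) with hσ
  have hsm : MeasurableSet (sphere (0:EuclideanSpace ℝ (Fin (m + 1))) 1) := isClosed_sphere.measurableSet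
  have : IsFiniteMeasure σ := ⟨by rw [hσ, Measure.restrict_apply_univ]; exact sphere_fin m⟩
  have hσp : 0 < σ.real univ := by
    rw [measureReal_def]
    refine ENNReal.toReal_pos ?_ (measure_ne_top _ _)
    rw [hσ, Measure.restrict_apply_univ]; exact (sphere_pos m).ne'
  have hσS : ∀ᵐ x ∂σ, ‖x‖ = 1 := by
    filter_upwards [ae_restrict_mem hsm] with x hx
    simpa using hx
  have hmap : ∀ T : EuclideanSpace ℝ (Fin (m + 1)) ≃ₗᵢ[ℝ] EuclideanSpace ℝ (Fin (m + 1)), MeasurePreserving T σ σ := by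
    intro T
    have h1 := T.toIsometryEquiv.measurePreserving_hausdorffMeasure (m:ℝ)
    have h2 := h1.restrict_preimage hsm
    have h3 : T.toIsometryEquiv ⁻¹' sphere 0 1 = sphere 0 1 := by
      ext x; simp
    rw [h3] at h2
    exact h2
  have hinv : BInv σ := by
    intro T u t
    rw [← (hmap T).measure_preimage measurableSet_ball.nullMeasurableSet]
    congr 1
    ext x; simp
  set τ1 := (tau (m + 1)).real univ with hτ1
  set V := ((m + 1 : ℕ):ℝ) * (volume (closedBall (0 : EuclideanSpace ℝ (Fin (m + 1))) 1)).toReal with hV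
  have hVp : 0 < V := by
    refine mul_pos (by positivity) (ENNReal.toReal_pos ?_ ?_)
    · exact (measure_closedBall_pos _ _ one_pos).ne'
    · exact measure_closedBall_lt_top.ne
  have hτp : 0 < τ1 := tau_pos hn
  refine ⟨V * τ1 / (2 * σ.real univ), by positivity, fun K R hne hK => ?_⟩
  have he : ‖(EuclideanSpace.single (0 : Fin (m + 1)) (1:ℝ))‖ = 1 := by simp
  have hl : ∀ x y, |suppFn K x - suppFn K y| ≤ R * dist x y := by
    intro x y
    rw [dist_eq_norm, abs_le]
    have h1 := suppFn_sub_le hne hK x y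
    have h2 := suppFn_sub_le hne hK y x
    rw [norm_sub_rev] at h2
    constructor <;> linarith
  have hi := supp_int_sph hσS hne hK
  have h := uniq hσS tau_sph hinv tau_inv he hi (supp_int_sph tau_sph hne hK) hl
  rw [tau_supp hne hK, ← hτ1] at h
  have hneg := (hmap (LinearIsometryEquiv.neg ℝ)).integral_comp
    (LinearIsometryEquiv.neg ℝ).toHomeomorph.measurableEmbedding (suppFn K)
  have hnegi : Integrable (fun x => suppFn K (-x)) σ :=
    ((hmap (LinearIsometryEquiv.neg ℝ)).integrable_comp_emb
      (LinearIsometryEquiv.neg ℝ).toHomeomorph.measurableEmbedding).2 hi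
  simp only [LinearIsometryEquiv.coe_neg] at hneg
  have hmw : meanWidth (m + 1) K = 1 / V * (2 * ∫ x, suppFn K x ∂σ) := by
    unfold meanWidth
    have : (((m + 1 : ℕ) : ℝ) - 1) = m := by push_cast; ring
    rw [this, ← hV, ← hσ, integral_add hi hnegi, hneg]
    ring
  rw [hmw]
  field_simp
  linarith

end Tau
end JMW

namespace JMW
open ProbabilityTheory Filter Topology
section Fin
variable {n : ℕ} {w : Fin (n + 1) → EuclideanSpace ℝ (Fin n)} {K : Set (EuclideanSpace ℝ (Fin n))}

lemma bary (hw : IsRegVerts w) (hn : 1 ≤ n) {y : EuclideanSpace ℝ (Fin n)} (hy : y ∈ Dl w) :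
    ∃ l : Fin (n + 1) → ℝ, (∀ j, 0 ≤ l j) ∧ ∑ j, l j = 1 ∧ ∑ j, l j • ((-(n:ℝ)) • w j) = y := by
  have hnp : (0:ℝ) < n := by exact_mod_cast hn
  have hw0 : ∑ j, w j = 0 := by
    have := (simplex_id hw hn (∑ j, w j)).1
    rw [← sum_inner] at this
    exact inner_self_eq_zero.1 this
  obtain ⟨h1, h2⟩ := simplex_id hw hn y
  refine ⟨fun j => (1 - ⟪w j, y⟫) / ((n:ℝ) + 1), fun j => ?_, ?_, ?_⟩
  · have := mem_Dl.1 hy j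
    exact div_nonneg (by linarith) (by positivity)
  · rw [← Finset.sum_div, Finset.sum_sub_distrib, h1]
    have h3 : (n:ℝ) + 1 ≠ 0 := by positivity
    simp [h3]
  · have : ∀ j, ((1 - ⟪w j, y⟫) / ((n:ℝ) + 1)) • ((-(n:ℝ)) • w j) =
        (-(n:ℝ) / (n + 1)) • w j + ((n:ℝ) / (n + 1)) • (⟪w j, y⟫ • w j) := by
      intro j
      rw [smul_smul, smul_smul, ← add_smul]
      congr 1; ring
    simp only [this, Finset.sum_add_distrib, ← Finset.smul_sum, hw0, h2, smul_zero, zero_add]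
    have e : (n:ℝ) / (n + 1) * ((n + 1) / n) = 1 := by field_simp
    rw [smul_smul, e, one_smul]

/-- the good event for a vertex -/
def evt (w : Fin (n + 1) → EuclideanSpace ℝ (Fin n)) (i : Fin (n + 1)) : Set (EuclideanSpace ℝ (Fin n)) :=
  {x | ∀ j, j ≠ i → 1 ≤ ⟪w j - w i, x⟫}

lemma evt_meas (i : Fin (n + 1)) : MeasurableSet (evt w i) := by
  have : evt w i = ⋂ j, ⋂ (_ : j ≠ i), {x | 1 ≤ ⟪w j - w i, x⟫} := by
    ext x; simp [evt]
  rw [this]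
  refine MeasurableSet.iInter fun j => MeasurableSet.iInter fun _ => measurableSet_le (by fun_prop) (by fun_prop)

lemma evt_prob (hw : IsRegVerts w) (hn : 1 ≤ n) (i : Fin (n + 1)) :
    ((1:ℝ) / 32) ^ (n + 1) ≤ (stdGaussian (EuclideanSpace ℝ (Fin n))).real (evt w i) := by
  obtain ⟨b, hb⟩ := simplex_basis hw hn
  set A : Fin (n + 1) → Set ℝ := fun j => if j = i then Iic 0 else Ioi 1 with hA
  have hAm : ∀ j, MeasurableSet (A j) := by
    intro j; simp only [hA]; split_ifs
    · exact measurableSet_Iic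
    · exact measurableSet_Ioi
  have hAp : ∀ j, (1:ℝ) / 32 ≤ (gaussianReal 0 1).real (A j) := by
    intro j; simp only [hA]; split_ifs
    · have := Phi_zero
      unfold Phi at this
      rw [this]; norm_num
    · have h1 : (gaussianReal 0 1).real (Ioi (1:ℝ)) = Phi (-1) := by
        rw [Phi_neg, Phi, ← compl_Iic, measureReal_compl measurableSet_Iic]
        simp
      rw [h1]; exact Phi_neg_one_lower
  have h1 := g_basis_event b A hAm
  have h2 : ((1:ℝ) / 32) ^ (n + 1) ≤ ∏ j, (gaussianReal 0 1).real (A j) := by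
    have := Finset.prod_le_prod (s := (Finset.univ : Finset (Fin (n + 1)))) (f := fun _ => (1:ℝ) / 32)
      (fun j _ => by norm_num) (fun j _ => hAp j)
    simpa using this
  refine h2.trans ?_
  rw [← h1, ← map_fst, measureReal_def, measureReal_def,
    Measure.map_apply fst_cont.measurable (evt_meas i)]
  refine ENNReal.toReal_mono (measure_ne_top _ _) (measure_mono fun y hy => ?_)
  intro j hj
  have hi : ⟪b i, y⟫ ≤ 0 := by
    have := hy i; simpa [hA] using this
  have hjj : 1 < ⟪b j, y⟫ := by
    have := hy j; simpa [hA, hj] using this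
  rw [hb, inner_lift] at hi hjj
  have hs : Real.sqrt (n / (n + 1)) ≤ 1 := by
    rw [Real.sqrt_le_iff, one_pow, div_le_one (by positivity)]; exact ⟨zero_le_one, by linarith⟩
  have hs0 := Real.sqrt_nonneg ((n:ℝ) / (n + 1))
  rw [inner_sub_left]
  by_contra hcon
  push Not at hcon
  nlinarith

lemma vert_dist (hw : IsRegVerts w) (hn : 1 ≤ n) (hKn : K ⊆ closedBall 0 n) (hne : K.Nonempty)
    {θ ε : ℝ} (hθ : 0 ≤ θ) (hε : 0 < ε) (hKw : ∀ i, ∀ x ∈ K, ⟪w i, x⟫ ≤ 1 + θ)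
    (hb : (1 - ε) * bG (Dl w) ≤ bG K) {ρ : ℝ} (i : Fin (n + 1))
    (hρ : ∀ k ∈ K, ρ ≤ ‖(-(n:ℝ)) • w i - k‖) :
    ρ ≤ n * θ + 2 * 32 ^ (n + 1) * n ^ 2 * (θ + ε) := by
  have hn1 : (1:ℝ) ≤ n := by exact_mod_cast hn
  have hnp : (0:ℝ) < n := by linarith
  set c := (ρ - n * θ) / 2 with hc
  by_cases hc0 : c < 0
  · have : 0 ≤ 2 * 32 ^ (n + 1) * (n:ℝ) ^ 2 * (θ + ε) := by positivity
    linarith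
  push Not at hc0
  set s := 1 + θ with hs
  have hs1 : 1 ≤ s := by linarith
  have hDn := Dl_sub hw hn
  have hDne := Dl_ne hw hn
  set P := (stdGaussian (EuclideanSpace ℝ (Fin n))).real (evt w i) with hP
  have hpt : ∀ x, suppFn K x ≤ s * (suppFn (Dl w) x - (evt w i).indicator (fun _ => c) x) := by
    intro x
    refine suppFn_le hne fun k hk => ?_
    have hkD : s⁻¹ • k ∈ Dl w := by
      rw [mem_Dl]; intro j
      rw [real_inner_smul_right, inv_mul_le_iff₀ (by linarith), mul_one]
      exact hKw j k hk
    have ek : k = s • (s⁻¹ • k) := by rw [smul_smul, mul_inv_cancel₀ (by linarith), one_smul]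
    rw [ek, real_inner_smul_right]
    refine mul_le_mul_of_nonneg_left ?_ (by linarith)
    by_cases hx : x ∈ evt w i
    · rw [indicator_of_mem hx]
      obtain ⟨l, hl0, hl1, hly⟩ := bary hw hn hkD
      have hv := le_suppFn hDn (x := x) (vert_mem hw hn i)
      have hli : ∀ z : EuclideanSpace ℝ (Fin n), z = ∑ j, l j • z := fun z => by
        rw [← Finset.sum_smul, hl1, one_smul]
      have hdiff : (-(n:ℝ)) • w i - s⁻¹ • k = ∑ j, l j • ((n:ℝ) • (w j - w i)) := by
        rw [← hly, hli ((-(n:ℝ)) • w i), ← Finset.sum_sub_distrib]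
        refine Finset.sum_congr rfl fun j _ => ?_
        rw [← smul_sub, ← smul_sub]
        congr 1
        rw [neg_smul, smul_sub, smul_sub]; abel
      have hA : ⟪x, (-(n:ℝ)) • w i - s⁻¹ • k⟫ ≥ n * (1 - l i) := by
        rw [hdiff, inner_sum, ← hl1, ← Finset.sum_erase_eq_sub (Finset.mem_univ i),
          ← Finset.sum_erase_add _ _ (Finset.mem_univ i), sub_self, smul_zero, smul_zero, inner_zero_right, add_zero,
          Finset.mul_sum]
        refine Finset.sum_le_sum fun j hj => ?_
        rw [real_inner_smul_right, real_inner_smul_right, real_inner_comm]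
        have := hx j (Finset.ne_of_mem_erase hj)
        nlinarith [mul_nonneg (hl0 j) hnp.le]
      have hB : ‖(-(n:ℝ)) • w i - s⁻¹ • k‖ ≤ 2 * n * (1 - l i) := by
        rw [hdiff, ← hl1, ← Finset.sum_erase_eq_sub (Finset.mem_univ i),
          ← Finset.sum_erase_add _ _ (Finset.mem_univ i), sub_self, smul_zero, smul_zero, add_zero,
          Finset.mul_sum]
        refine (norm_sum_le _ _).trans (Finset.sum_le_sum fun j hj => ?_)
        rw [norm_smul, norm_smul, Real.norm_eq_abs, Real.norm_eq_abs, abs_of_nonneg (hl0 j), abs_of_pos hnp]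
        have h1 : ‖w j - w i‖ ≤ 2 := by
          refine (norm_sub_le _ _).trans ?_
          rw [hw.1, hw.1]; norm_num
        nlinarith [mul_le_mul_of_nonneg_left h1 (mul_nonneg (hl0 j) hnp.le)]
      have hC : ‖s⁻¹ • k - k‖ ≤ n * θ := by
        have : s⁻¹ • k - k = (-(s⁻¹ * θ)) • k := by
          have e : s⁻¹ - 1 = -(s⁻¹ * θ) := by
            have : s ≠ 0 := by linarith
            field_simp; rw [hs]; ring
          rw [← e, sub_smul, one_smul]
        rw [this, norm_smul, norm_neg, Real.norm_eq_abs, abs_of_nonneg (mul_nonneg (inv_nonneg.2 (by linarith)) hθ)]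
        have hkn := hKn hk
        rw [mem_closedBall_zero_iff] at hkn
        have hsi : s⁻¹ ≤ 1 := inv_le_one_of_one_le₀ hs1
        have : s⁻¹ * θ ≤ θ := mul_le_of_le_one_left hθ hsi
        rw [mul_comm]
        exact mul_le_mul hkn this (mul_nonneg (inv_nonneg.2 (by linarith)) hθ) hnp.le
      have hD := hρ k hk
      have hE : ‖(-(n:ℝ)) • w i - k‖ ≤ ‖(-(n:ℝ)) • w i - s⁻¹ • k‖ + ‖s⁻¹ • k - k‖ := by
        have := norm_add_le ((-(n:ℝ)) • w i - s⁻¹ • k) (s⁻¹ • k - k)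
        rwa [sub_add_sub_cancel] at this
      rw [inner_sub_right] at hA
      have : c ≤ n * (1 - l i) := by rw [hc]; linarith
      linarith
    · rw [indicator_of_notMem hx, sub_zero]
      exact le_suppFn hDn hkD
  have hint := integral_mono (suppFn_int hne hKn)
    (((suppFn_int hDne hDn).sub ((integrable_const c).indicator (evt_meas i))).const_mul s) hpt
  have e1 : ∫ x, s * (suppFn (Dl w) x - (evt w i).indicator (fun _ => c) x) ∂(stdGaussian (EuclideanSpace ℝ (Fin n)))
      = s * (bG (Dl w) - P * c) := by
    rw [integral_const_mul, integral_sub (suppFn_int hDne hDn) ((integrable_const c).indicator (evt_meas i)),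
      integral_indicator (evt_meas i), setIntegral_const, smul_eq_mul, bG]
  have hint' : bG K ≤ s * (bG (Dl w) - P * c) := by rw [← e1]; exact hint
  have hPl := evt_prob hw hn i
  rw [← hP] at hPl
  have hbD : bG (Dl w) ≤ n ^ 2 := by
    refine (bG_le hDne hDn).trans ?_
    have : Real.sqrt n ≤ n := by
      rw [Real.sqrt_le_iff]; exact ⟨hnp.le, by nlinarith⟩
    nlinarith
  have hP0 : 0 ≤ P := measureReal_nonneg
  have h1 : P * c ≤ (θ + ε) * n ^ 2 := by
    have h2 : P * c ≤ s * (P * c) := le_mul_of_one_le_left (mul_nonneg hP0 hc0) hs1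
    have h3 : (θ + ε) * bG (Dl w) ≤ (θ + ε) * n ^ 2 := mul_le_mul_of_nonneg_left hbD (by positivity)
    have h4 : s * (P * c) ≤ (θ + ε) * bG (Dl w) := by rw [hs] at hint' ⊢; nlinarith
    linarith
  have h2 : c ≤ 32 ^ (n + 1) * ((θ + ε) * n ^ 2) := by
    have h3 := (mul_le_mul_of_nonneg_right hPl hc0).trans h1
    rw [one_div, inv_pow, inv_mul_le_iff₀ (by positivity)] at h3
    exact h3
  rw [hc] at h2
  linarith

lemma haus (hw : IsRegVerts w) (hn : 1 ≤ n) (hKc : IsCompact K) (hKv : Convex ℝ K)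
    (hKn : K ⊆ closedBall 0 n) (hne : K.Nonempty)
    {θ ε : ℝ} (hθ : 0 ≤ θ) (hε : 0 < ε) (hKw : ∀ i, ∀ x ∈ K, ⟪w i, x⟫ ≤ 1 + θ)
    (hb : (1 - ε) * bG (Dl w) ≤ bG K) :
    hausdorffDist K (Dl w) ≤ n * θ + 2 * 32 ^ (n + 1) * n ^ 2 * (θ + ε) := by
  have hn1 : (1:ℝ) ≤ n := by exact_mod_cast hn
  have hnp : (0:ℝ) < n := by linarith
  have hpos : 0 ≤ 2 * 32 ^ (n + 1) * (n:ℝ) ^ 2 * (θ + ε) := by positivity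
  refine hausdorffDist_le_of_mem_dist (by positivity) (fun k hk => ?_) (fun y hy => ?_)
  · have hs : (0:ℝ) < 1 + θ := by linarith
    refine ⟨(1 + θ)⁻¹ • k, ?_, ?_⟩
    · rw [mem_Dl]; intro j
      rw [real_inner_smul_right, inv_mul_le_iff₀ hs, mul_one]
      exact hKw j k hk
    · have e : k - (1 + θ)⁻¹ • k = ((1 + θ)⁻¹ * θ) • k := by
        have e : 1 - (1 + θ)⁻¹ = (1 + θ)⁻¹ * θ := by
          field_simp; ring
        rw [← e, sub_smul, one_smul]
      rw [dist_eq_norm, e, norm_smul, Real.norm_eq_abs, abs_of_nonneg (mul_nonneg (inv_nonneg.2 hs.le) hθ)]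
      have hkn := hKn hk
      rw [mem_closedBall_zero_iff] at hkn
      have hsi : (1 + θ)⁻¹ ≤ 1 := inv_le_one_of_one_le₀ (by linarith)
      have h1 : (1 + θ)⁻¹ * θ ≤ θ := mul_le_of_le_one_left hθ hsi
      have := mul_le_mul h1 hkn (norm_nonneg _) hθ
      linarith
  · have hex : ∀ j, ∃ k ∈ K, ‖(-(n:ℝ)) • w j - k‖ ≤ n * θ + 2 * 32 ^ (n + 1) * n ^ 2 * (θ + ε) := by
      intro j
      obtain ⟨k, hk, hkd⟩ := hKc.exists_infDist_eq_dist hne ((-(n:ℝ)) • w j)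
      refine ⟨k, hk, vert_dist hw hn hKn hne hθ hε hKw hb j fun k' hk' => ?_⟩
      rw [← dist_eq_norm, ← dist_eq_norm, ← hkd]
      exact infDist_le_dist_of_mem hk'
    choose k hk hkd using hex
    obtain ⟨l, hl0, hl1, hly⟩ := bary hw hn hy
    refine ⟨∑ j, l j • k j, hKv.sum_mem (fun j _ => hl0 j) hl1 (fun j _ => hk j), ?_⟩
    rw [dist_eq_norm, ← hly, ← Finset.sum_sub_distrib]
    calc _ ≤ ∑ j, ‖l j • ((-(n:ℝ)) • w j) - l j • k j‖ := norm_sum_le _ _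
      _ ≤ ∑ j, l j * (n * θ + 2 * 32 ^ (n + 1) * n ^ 2 * (θ + ε)) := by
          refine Finset.sum_le_sum fun j _ => ?_
          rw [← smul_sub, norm_smul, Real.norm_eq_abs, abs_of_nonneg (hl0 j)]
          exact mul_le_mul_of_nonneg_left (hkd j) (hl0 j)
      _ = _ := by rw [← Finset.sum_mul, hl1, one_mul]

end Fin
end JMW

namespace JMW
open ProbabilityTheory Filter Topology
section Main
variable {n : ℕ} {w : Fin (n + 1) → EuclideanSpace ℝ (Fin n)} {K : Set (EuclideanSpace ℝ (Fin n))}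

lemma reg_map (hw : IsRegVerts w) (T : EuclideanSpace ℝ (Fin n) ≃ₗᵢ[ℝ] EuclideanSpace ℝ (Fin n)) :
    IsRegVerts (fun i => T (w i)) :=
  ⟨fun i => by rw [T.norm_map]; exact hw.1 i, fun i j hij => by rw [T.inner_map_map]; exact hw.2 i j hij⟩

lemma Dl_map (T : EuclideanSpace ℝ (Fin n) ≃ₗᵢ[ℝ] EuclideanSpace ℝ (Fin n)) :
    T '' Dl w = Dl (fun i => T (w i)) := by
  ext x
  rw [mem_Dl]
  constructor
  · rintro ⟨y, hy, rfl⟩ i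
    rw [T.inner_map_map]; exact mem_Dl.1 hy i
  · intro h
    refine ⟨T.symm x, mem_Dl.2 fun i => ?_, T.apply_symm_apply x⟩
    rw [← T.inner_map_map, T.apply_symm_apply]; exact h i

lemma supp_map (T : EuclideanSpace ℝ (Fin n) ≃ₗᵢ[ℝ] EuclideanSpace ℝ (Fin n)) (x : EuclideanSpace ℝ (Fin n)) :
    suppFn (T '' K) x = suppFn K (T.symm x) := by
  unfold suppFn
  rw [image_image]
  congr 1
  refine image_congr fun y _ => ?_
  conv_lhs => rw [← T.apply_symm_apply x]
  rw [T.inner_map_map]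

lemma bG_map (T : EuclideanSpace ℝ (Fin n) ≃ₗᵢ[ℝ] EuclideanSpace ℝ (Fin n)) : bG (T '' K) = bG K := by
  rw [← bG_iso (K := K) T.symm, bG]
  simp only [supp_map]

lemma numer (hn : 2 ≤ n) {M : ℝ} (hM : M = n * (160 * (n + 1)) * 32 ^ (n + 1) * 2 ^ 48) {μ : ℝ}
    (hμ : μ ^ 4 = 9 ^ n * M) :
    260 * 32 ^ n * (n:ℝ) ^ 3 * (n + 1) * μ ≤ (n:ℝ) ^ (27 * n) := by
  have h2 : (2:ℝ) ≤ n := by exact_mod_cast hn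
  have hN : (n:ℝ) + 1 ≤ n ^ 2 := by nlinarith
  have key : (260 * 32 ^ n * (n:ℝ) ^ 3 * (n + 1) * μ) ^ 4 ≤ ((n:ℝ) ^ (27 * n)) ^ 4 := by
    have h9 : (9:ℝ) ^ n ≤ 2 ^ (4 * n) := by
      rw [pow_mul]; exact pow_le_pow_left₀ (by norm_num) (by norm_num) n
    calc (260 * 32 ^ n * (n:ℝ) ^ 3 * (n + 1) * μ) ^ 4
        = (260 ^ 4 * 160) * (((32:ℝ) ^ n) ^ 4 * 32 ^ (n + 1) * 2 ^ 48) * 9 ^ n * ((n:ℝ) ^ 13 * ((n:ℝ) + 1) ^ 5) := by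
          rw [mul_pow _ μ, hμ, hM]; ring
      _ ≤ 2 ^ 41 * (((32:ℝ) ^ n) ^ 4 * 32 ^ (n + 1) * 2 ^ 48) * 2 ^ (4 * n) * ((n:ℝ) ^ 13 * ((n:ℝ) ^ 2) ^ 5) := by
          gcongr
          norm_num
      _ = 2 ^ (94 + 29 * n) * (n:ℝ) ^ 23 := by
          have : (32:ℝ) = 2 ^ 5 := by norm_num
          rw [this]
          simp only [← pow_mul, ← pow_add]
          congr 2
          ring
      _ ≤ (n:ℝ) ^ (94 + 29 * n) * (n:ℝ) ^ 23 := by gcongr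
      _ = (n:ℝ) ^ (117 + 29 * n) := by rw [← pow_add]; congr 1; ring
      _ ≤ (n:ℝ) ^ (27 * n * 4) := pow_le_pow_right₀ (by linarith) (by omega)
      _ = _ := by rw [pow_mul]
  exact le_of_pow_le_pow_left₀ (by norm_num) (by positivity) key

lemma main_one (hn : n = 1) (hK : IsCompact K) (hKc : Convex ℝ K)
    (hJ : IsJohnEllipsoid (closedBall 0 1) K) (hw : IsRegVerts w) : K = Dl w := by
  subst hn
  obtain ⟨ι, _, u, p, hJD⟩ := john le_rfl hK hKc hJ
  have h1 := hJD.sub le_rfl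
  have h2 := Dl_sub hw le_rfl
  rw [Nat.cast_one] at h1 h2
  have h3 : closedBall 0 1 ⊆ Dl w := by
    intro x hx
    rw [mem_closedBall_zero_iff] at hx
    rw [mem_Dl]; intro i
    refine (real_inner_le_norm _ _).trans ?_
    rw [hw.1, one_mul]; exact hx
  exact subset_antisymm (h1.trans h3) (h2.trans hJ.2.1)

set_option maxHeartbeats 1000000 in
lemma main_two (hn : 2 ≤ n) (hK : IsCompact K) (hKc : Convex ℝ K)
    (hJ : IsJohnEllipsoid (closedBall 0 1) K) (hw : IsRegVerts w) {ε : ℝ} (hε : 0 < ε) (hε1 : ε < 1)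
    (hW : (1 - ε) * meanWidth n (Dl w) ≤ meanWidth n K) :
    ∃ T : EuclideanSpace ℝ (Fin n) ≃ₗᵢ[ℝ] EuclideanSpace ℝ (Fin n),
      hausdorffDist K (T '' Dl w) ≤ (n:ℝ) ^ (27 * n) * ε ^ ((1:ℝ) / 4) := by
  have hn1 : 1 ≤ n := by omega
  have h2 : (2:ℝ) ≤ n := by exact_mod_cast hn
  have hnp : (0:ℝ) < n := by linarith
  have hne : K.Nonempty := ⟨0, hJ.2.1 (by simp)⟩
  obtain ⟨ι, _, u, p, hJD⟩ := john hn1 hK hKc hJ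
  have hKn := hJD.sub hn1
  have hb : (1 - ε) * bG (Dl w) ≤ bG K := by
    obtain ⟨C, hC, hCw⟩ := width_gauss hn1
    rw [← hCw K n hne hKn, ← hCw (Dl w) n (Dl_ne hw hn1) (Dl_sub hw hn1)]
    nlinarith
  have hen := energy hJD hw hn1 hne hε hb
  obtain ⟨c, hc⟩ := select' hJD hn1
  set M : ℝ := n * (160 * (n + 1)) * 32 ^ (n + 1) * 2 ^ 48 with hM
  have hMp : 0 < M := by positivity
  set μ : ℝ := (9 ^ n * M) ^ ((1:ℝ) / 4) with hμd
  have h4 : ∀ x : ℝ, 0 ≤ x → (x ^ ((1:ℝ) / 4)) ^ 4 = x := by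
    intro x hx
    rw [← Real.rpow_natCast, ← Real.rpow_mul hx]; norm_num
  have hμ4 : μ ^ 4 = 9 ^ n * M := h4 _ (by positivity)
  have hμ0 : 0 ≤ μ := by positivity
  have hM1 : 1 ≤ 9 ^ n * M := by
    have e9 : (1:ℝ) ≤ 9 ^ n := one_le_pow₀ (by norm_num)
    have e32 : (1:ℝ) ≤ 32 ^ (n + 1) := one_le_pow₀ (by norm_num)
    have : 1 ≤ M := by
      rw [hM]
      refine one_le_mul_of_one_le_of_one_le (one_le_mul_of_one_le_of_one_le ?_ e32) (by norm_num)
      nlinarith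
    exact one_le_mul_of_one_le_of_one_le e9 this
  have hμ1 : 1 ≤ μ := Real.one_le_rpow hM1 (by norm_num)
  set e : ℝ := ε ^ ((1:ℝ) / 4) with hed
  have he0 : 0 < e := by positivity
  have he4 : e ^ 4 = ε := h4 _ hε.le
  have hee : ε ≤ e := by
    have := Real.rpow_le_rpow_of_exponent_ge hε hε1.le (by norm_num : (1:ℝ) / 4 ≤ 1)
    rwa [Real.rpow_one] at this
  set δ : ℝ := Real.sqrt (3 ^ n * EK n u p) with hδd
  have hδ0 : 0 ≤ δ := Real.sqrt_nonneg _
  have hEK : 0 ≤ EK n u p := Ed_nonneg (hJD.frame hn1)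
  have hδ2 : δ ^ 2 = 3 ^ n * EK n u p := Real.sq_sqrt (by positivity)
  have hδ : δ ≤ μ * e := by
    refine le_of_pow_le_pow_left₀ (n := 4) (by norm_num) (by positivity) ?_
    have e1 : δ ^ 4 = 9 ^ n * EK n u p ^ 2 := by
      have : δ ^ 4 = (δ ^ 2) ^ 2 := by ring
      rw [this, hδ2, mul_pow, ← pow_mul, mul_comm n 2, pow_mul]; norm_num
    rw [e1, mul_pow, hμ4, he4]
    have := mul_le_mul_of_nonneg_left hen (by positivity : (0:ℝ) ≤ 9 ^ n)
    linarith
  have hnum := numer hn hM hμ4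
  have hfinal : 260 * 32 ^ n * (n:ℝ) ^ 3 * (n + 1) * μ * e ≤ (n:ℝ) ^ (27 * n) * e :=
    mul_le_mul_of_nonneg_right hnum he0.le
  by_cases hs : ((n:ℝ) + 1) * δ ≤ 1 / 2
  · obtain ⟨T, hT⟩ := rot (U := fun k => u (c k)) hw hn1 (fun k => hJD.unit _) hδ0
      (fun k l hkl => by
        rw [← Real.sqrt_sq_eq_abs]
        exact Real.sqrt_le_sqrt (hc k l hkl)) hs
    refine ⟨T, ?_⟩
    have hw' := reg_map hw T
    have hb' : (1 - ε) * bG (Dl fun i => T (w i)) ≤ bG K := by rw [← Dl_map, bG_map]; exact hb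
    have hKw : ∀ i, ∀ x ∈ K, ⟪T (w i), x⟫ ≤ 1 + 3 * n * (n + 1) * δ := by
      intro i x hx
      have a1 := hJD.le (c i) x hx
      have a2 : ⟪T (w i) - u (c i), x⟫ ≤ 3 * ((n:ℝ) + 1) * δ * n := by
        refine (real_inner_le_norm _ _).trans ?_
        have := hKn hx
        rw [mem_closedBall_zero_iff] at this
        exact mul_le_mul (hT i) this (norm_nonneg _) (by positivity)
      rw [inner_sub_left] at a2
      linarith
    have hh := haus hw' hn1 hK hKc hKn hne (by positivity) hε hKw hb'
    rw [Dl_map]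
    refine hh.trans (le_trans ?_ hfinal)
    set θ : ℝ := 3 * n * (n + 1) * δ with hθ
    have t1 : θ + ε ≤ 4 * n * (n + 1) * (μ * e) := by
      have a1 : θ ≤ 3 * n * (n + 1) * (μ * e) := mul_le_mul_of_nonneg_left hδ (by positivity)
      have a2 : e ≤ μ * e := le_mul_of_one_le_left he0.le hμ1
      have a3 : μ * e ≤ (n * (n + 1)) * (μ * e) := le_mul_of_one_le_left (by positivity) (by nlinarith)
      linarith
    have hθ0 : 0 ≤ θ := by positivity
    have t2 : (n:ℝ) * θ ≤ 32 ^ n * n ^ 2 * (θ + ε) := by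
      have e32 : (1:ℝ) ≤ 32 ^ n := one_le_pow₀ (by norm_num)
      have b1 : (n:ℝ) ≤ 32 ^ n * n ^ 2 := by
        have : (n:ℝ) ≤ n ^ 2 := by nlinarith
        exact this.trans (le_mul_of_one_le_left (by positivity) e32)
      exact mul_le_mul b1 (by linarith) hθ0 (by positivity)
    calc (n:ℝ) * θ + 2 * 32 ^ (n + 1) * n ^ 2 * (θ + ε) ≤ 65 * 32 ^ n * n ^ 2 * (θ + ε) := by
          rw [pow_succ]; linarith
      _ ≤ 65 * 32 ^ n * n ^ 2 * (4 * n * (n + 1) * (μ * e)) := mul_le_mul_of_nonneg_left t1 (by positivity)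
      _ = _ := by ring
  · push Not at hs
    refine ⟨LinearIsometryEquiv.refl ℝ _, ?_⟩
    rw [LinearIsometryEquiv.coe_refl, image_id]
    refine le_trans ?_ hfinal
    have hd : hausdorffDist K (Dl w) ≤ 2 * n := by
      obtain ⟨k0, hk0⟩ := hne
      obtain ⟨y0, hy0⟩ := Dl_ne hw hn1
      have hdist : ∀ x ∈ K, ∀ y ∈ Dl w, dist x y ≤ 2 * n := by
        intro x hx y hy
        have a1 := hKn hx
        have a2 := Dl_sub hw hn1 hy
        rw [mem_closedBall_zero_iff] at a1 a2
        rw [dist_eq_norm]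
        linarith [norm_sub_le x y]
      exact hausdorffDist_le_of_mem_dist (by positivity) (fun x hx => ⟨y0, hy0, hdist x hx y0 hy0⟩)
        (fun y hy => ⟨k0, hk0, by rw [dist_comm]; exact hdist k0 hk0 y hy⟩)
    refine hd.trans ?_
    have t1 : (1:ℝ) ≤ 2 * ((n + 1) * (μ * e)) := by
      have := mul_le_mul_of_nonneg_left hδ (by positivity : (0:ℝ) ≤ n + 1)
      linarith
    have e32 : (1:ℝ) ≤ 32 ^ n := one_le_pow₀ (by norm_num)
    have b1 : (4:ℝ) * n ≤ 260 * 32 ^ n * n ^ 3 := by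
      have c1 : (n:ℝ) ≤ n ^ 3 := by nlinarith [mul_pos hnp hnp]
      have c2 : (n:ℝ) ^ 3 ≤ 32 ^ n * n ^ 3 := le_mul_of_one_le_left (by positivity) e32
      linarith
    calc (2:ℝ) * n ≤ 2 * n * (2 * ((n + 1) * (μ * e))) := le_mul_of_one_le_right (by positivity) t1
      _ = 4 * n * ((n + 1) * (μ * e)) := by ring
      _ ≤ 260 * 32 ^ n * n ^ 3 * ((n + 1) * (μ * e)) := mul_le_mul_of_nonneg_right b1 (by positivity)
      _ = _ := by ring

end Main
end JMW

theorem john_mean_width_stability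
    (n : ℕ) (hn : 1 ≤ n) (K : Set (EuclideanSpace ℝ (Fin n)))
    (hKcomp : IsCompact K) (hKconv : Convex ℝ K) (hKint : (interior K).Nonempty)
    (hJohn : IsJohnEllipsoid (closedBall (0 : EuclideanSpace ℝ (Fin n)) 1) K)
    (w : Fin (n + 1) → EuclideanSpace ℝ (Fin n)) (hw : IsRegVerts w)
    (ε : ℝ) (hε0 : 0 < ε) (hε1 : ε < 1)
    (hW : (1 - ε) * meanWidth n (polarSet (convexHull ℝ (Set.range w))) ≤ meanWidth n K) :
    ∃ T : EuclideanSpace ℝ (Fin n) ≃ₗᵢ[ℝ] EuclideanSpace ℝ (Fin n),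
      hausdorffDist K (T '' polarSet (convexHull ℝ (Set.range w))) ≤
        (n : ℝ) ^ (27 * n) * ε ^ ((1 : ℝ) / 4) := by
  rcases Nat.lt_or_ge 1 n with h | h
  · exact JMW.main_two h hKcomp hKconv hJohn hw hε0 hε1 hW
  · have h1 : n = 1 := by omega
    refine ⟨LinearIsometryEquiv.refl ℝ _, ?_⟩
    have h2 : K = polarSet (convexHull ℝ (Set.range w)) := JMW.main_one h1 hKcomp hKconv hJohn hw
    rw [LinearIsometryEquiv.coe_refl, image_id, ← h2, hausdorffDist_self_zero]
    positivity

end
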